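/- Additivity of generalized squared Bessel processes: if X and Y are independent solutions of dX_u = (2β_u X_u + δ_u) du + 2√(X_u) dW_u and dY_u = (2β_u Y_u + δ'_u) du + 2√(Y_u) dW'_u with X_0 = x, Y_0 = x', driven by independent Brownian motions, then H := X + Y has the law of the generalized squared Bessel process with dimension δ + δ', drift β, and initial state x + x'. -/

import Mathlib

open MeasureTheory ProbabilityTheory Filter

noncomputable section

/-- The path space `C(ℝ⁺, ℝ)` modelled as functions `ℝ → ℝ`. -/
abbrev RPath : Type := ℝ → ℝ

/-- The class `D` of nonnegative, measurable, locally bounded, piecewise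
continuous functions. -/
def MemD (f : ℝ → ℝ) : Prop :=
  Measurable f ∧ (∀ t, 0 ≤ f t) ∧
    (∀ T : ℝ, ∃ C : ℝ, ∀ t ∈ Set.Icc (0 : ℝ) T, f t ≤ C) ∧
    ∃ S : Set ℝ, S.Countable ∧ ∀ t ∉ S, ContinuousAt f t

/-- `W` is a standard Brownian motion with respect to the filtration `ℱ`:
it starts at `0`, has continuous paths, is adapted, has Gaussian increments
`W t - W s ∼ N(0, t - s)` that are independent of `ℱ s`. -/
structure IsBrownianMotion {Ω : Type*} [m : MeasurableSpace Ω] (P : Measure Ω)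
    (ℱ : Filtration ℝ m) (W : ℝ → Ω → ℝ) : Prop where
  start : ∀ ω, W 0 ω = 0
  cont : ∀ ω, Continuous fun t => W t ω
  adapted : Adapted ℱ W
  gaussian_increments : ∀ s t : ℝ, 0 ≤ s → s ≤ t →
    P.map (fun ω => W t ω - W s ω) = gaussianReal 0 (Real.toNNReal (t - s))
  indep_increments : ∀ s t : ℝ, 0 ≤ s → s ≤ t →
    Indep (MeasurableSpace.comap (fun ω => W t ω - W s ω) (borel ℝ)) (ℱ s) P

/-- `X` is a (strong) solution of the SDE `dX_t = b(t, X_t) dt + σ(X_t) dW_t`,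
`X_0 = x`, formulated through the martingale problem relative to `W`:
`M_t := X_t - x - ∫_0^t b(s, X_s) ds` is a martingale, its quadratic variation
is `∫_0^t σ(X_s)² ds`, and its covariation with `W` is `∫_0^t σ(X_s) ds`
(the latter characterizes `M_t = ∫_0^t σ(X_s) dW_s`). -/
structure IsSDESolution {Ω : Type*} [m : MeasurableSpace Ω] (P : Measure Ω)
    (ℱ : Filtration ℝ m) (W : ℝ → Ω → ℝ)
    (b : ℝ → ℝ → ℝ) (σ : ℝ → ℝ) (x : ℝ) (X : ℝ → Ω → ℝ) : Prop where
  init : ∀ ω, X 0 ω = x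
  cont : ∀ ω, Continuous fun t => X t ω
  adapted : Adapted ℱ X
  drift_mart : Martingale
    (fun t ω => X t ω - x - ∫ s in Set.Ioc (0 : ℝ) t, b s (X s ω)) ℱ P
  quad_var : Martingale
    (fun t ω => (X t ω - x - ∫ s in Set.Ioc (0 : ℝ) t, b s (X s ω)) ^ 2
      - ∫ s in Set.Ioc (0 : ℝ) t, (σ (X s ω)) ^ 2) ℱ P
  driven_by : Martingale
    (fun t ω => (X t ω - x - ∫ s in Set.Ioc (0 : ℝ) t, b s (X s ω)) * W t ω
      - ∫ s in Set.Ioc (0 : ℝ) t, σ (X s ω)) ℱ P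

/-- The drift `(t, y) ↦ 2 β_t y + δ_t` of the generalized squared Bessel process. -/
def gbesqDrift (β δ : ℝ → ℝ) : ℝ → ℝ → ℝ := fun t y => 2 * β t * y + δ t

/-- The diffusion coefficient `y ↦ 2 √y` of the squared Bessel process. -/
def besqSigma : ℝ → ℝ := fun y => 2 * Real.sqrt y

/-- `X` is a generalized squared Bessel process `GBESQ^{β,δ}_x` driven by `W`. -/
def IsGBESQ {Ω : Type*} [m : MeasurableSpace Ω] (P : Measure Ω)
    (ℱ : Filtration ℝ m) (W : ℝ → Ω → ℝ) (β δ : ℝ → ℝ) (x : ℝ)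
    (X : ℝ → Ω → ℝ) : Prop :=
  IsSDESolution P ℱ W (gbesqDrift β δ) besqSigma x X

/-- The law on path space of a process `X`. -/
def pathLaw {Ω : Type*} [m : MeasurableSpace Ω] (P : Measure Ω)
    (X : ℝ → Ω → ℝ) : Measure RPath :=
  P.map fun ω t => X t ω

/-- A realization of the generalized squared Bessel process `GBESQ^{β,δ}_x`
whose law on path space is `μ`. -/
structure GBESQRealization (β δ : ℝ → ℝ) (x : ℝ) (μ : Measure RPath) where
  (Ω : Type)
  [m : MeasurableSpace Ω]
  (P : Measure Ω)
  (ℱ : Filtration ℝ m)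
  (W : ℝ → Ω → ℝ)
  (X : ℝ → Ω → ℝ)
  (prob : IsProbabilityMeasure P)
  (bm : IsBrownianMotion P ℱ W)
  (sol : IsGBESQ P ℱ W β δ x X)
  (law : μ = pathLaw P X)

/-- `μ` is the law `{}^β Q^δ_x` of the generalized squared Bessel process with
drift function `β`, dimension function `δ` and initial value `x`. -/
def IsGBESQLaw (β δ : ℝ → ℝ) (x : ℝ) (μ : Measure RPath) : Prop :=
  Nonempty (GBESQRealization β δ x μ)

/-- Convolution of two laws on path space: the law of the pathwise sum of
independent copies. -/
def mconv (μ ν : Measure RPath) : Measure RPath :=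
  (μ.prod ν).map fun p => p.1 + p.2

namespace GB
open Set
set_option linter.unusedSectionVars false

/-- Square-integrable martingale, in weak form, for nonnegative times. -/
structure L2M {Ω : Type*} [m : MeasurableSpace Ω] (P : Measure Ω) (G : Filtration ℝ m)
    (N : ℝ → Ω → ℝ) : Prop where
  adapted : ∀ t, StronglyMeasurable[G t] (N t)
  memLp : ∀ t, MemLp (N t) 2 P
  mart : ∀ s t, 0 ≤ s → s ≤ t → ∀ η : Ω → ℝ, StronglyMeasurable[G s] η → MemLp η 2 P →
    ∫ ω, η ω * N t ω ∂P = ∫ ω, η ω * N s ω ∂P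

/-- The covariation of `N` and `N'` has density `c`. -/
structure Cov {Ω : Type*} [m : MeasurableSpace Ω] (P : Measure Ω) (G : Filtration ℝ m)
    (N N' c : ℝ → Ω → ℝ) : Prop where
  int : ∀ T, IntegrableOn (fun p : ℝ × Ω => c p.1 p.2) (Ioc 0 T ×ˢ univ) (volume.prod P)
  eq : ∀ s t, 0 ≤ s → s ≤ t → ∀ ξ : Ω → ℝ, StronglyMeasurable[G s] ξ →
    (∃ C, ∀ ω, |ξ ω| ≤ C) →
    ∫ ω, ξ ω * (N t ω * N' t ω) ∂P - ∫ ω, ξ ω * (N s ω * N' s ω) ∂P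
      = ∫ p in Ioc s t ×ˢ univ, ξ p.2 * c p.1 p.2 ∂(volume.prod P)

section
variable {Ω : Type*} [m : MeasurableSpace Ω] {P : Measure Ω} [IsProbabilityMeasure P]
  {G : Filtration ℝ m}

lemma memLp_bdd_mul {ξ f : Ω → ℝ} {q : ENNReal} (hξ : AEStronglyMeasurable ξ P)
    (hb : ∃ C, ∀ ω, |ξ ω| ≤ C) (hf : MemLp f q P) : MemLp (fun ω => ξ ω * f ω) q P := by
  obtain ⟨C, hC⟩ := hb
  have h1 : MemLp ξ ⊤ P := memLp_top_of_bound hξ C (Eventually.of_forall hC)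
  exact hf.mul h1

lemma integrable_mul2 {f g : Ω → ℝ} (hf : MemLp f 2 P) (hg : MemLp g 2 P) :
    Integrable (fun ω => f ω * g ω) P := hf.integrable_mul hg

lemma integrable_bdd_mul2 {ξ f g : Ω → ℝ} (hξ : AEStronglyMeasurable ξ P)
    (hb : ∃ C, ∀ ω, |ξ ω| ≤ C) (hf : MemLp f 2 P) (hg : MemLp g 2 P) :
    Integrable (fun ω => ξ ω * (f ω * g ω)) P := by
  have := memLp_bdd_mul hξ hb (memLp_one_iff_integrable.2 (integrable_mul2 hf hg))
  exact memLp_one_iff_integrable.1 this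

lemma sm {s : ℝ} {ξ : Ω → ℝ} (h : StronglyMeasurable[G s] ξ) : AEStronglyMeasurable ξ P :=
  (h.mono (G.le s)).aestronglyMeasurable

lemma bdd_mul {ξ α : Ω → ℝ} (h : ∃ C, ∀ ω, |ξ ω| ≤ C) (h' : ∃ C, ∀ ω, |α ω| ≤ C) :
    ∃ C, ∀ ω, |ξ ω * α ω| ≤ C := by
  obtain ⟨C, hC⟩ := h
  obtain ⟨D, hD⟩ := h'
  refine ⟨C * D, fun ω => ?_⟩
  rw [abs_mul]
  exact mul_le_mul (hC ω) (hD ω) (abs_nonneg _) ((abs_nonneg _).trans (hC ω))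

lemma cov_int_st {N N' c : ℝ → Ω → ℝ} (h : Cov P G N N' c) {s t : ℝ} (hs : 0 ≤ s) :
    IntegrableOn (fun p : ℝ × Ω => c p.1 p.2) (Ioc s t ×ˢ univ) (volume.prod P) :=
  (h.int t).mono_set (prod_mono (Ioc_subset_Ioc_left hs) subset_rfl)

lemma integrableOn_bdd_mul {R : Set (ℝ × Ω)} {c : ℝ × Ω → ℝ} {f : ℝ × Ω → ℝ}
    (hf : AEStronglyMeasurable f (volume.prod P)) (hb : ∃ C, ∀ p, |f p| ≤ C)
    (hc : IntegrableOn c R (volume.prod P)) :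
    IntegrableOn (fun p => f p * c p) R (volume.prod P) := by
  obtain ⟨C, hC⟩ := hb
  exact Integrable.bdd_mul hc hf.restrict (Eventually.of_forall hC)

lemma weight_int {N N' c : ℝ → Ω → ℝ} (h : Cov P G N N' c) {s t r : ℝ} (hs : 0 ≤ s)
    {ξ : Ω → ℝ} (hξ : StronglyMeasurable[G r] ξ) (hb : ∃ C, ∀ ω, |ξ ω| ≤ C) :
    IntegrableOn (fun p : ℝ × Ω => ξ p.2 * c p.1 p.2) (Ioc s t ×ˢ univ) (volume.prod P) := by
  refine integrableOn_bdd_mul (f := fun p => ξ p.2) ?_ ?_ (cov_int_st h hs)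
  · exact ((hξ.mono (G.le r)).comp_measurable measurable_snd).aestronglyMeasurable
  · obtain ⟨C, hC⟩ := hb
    exact ⟨C, fun p => hC _⟩

lemma Cov.symm {N N' c : ℝ → Ω → ℝ} (h : Cov P G N N' c) : Cov P G N' N c := by
  refine ⟨h.int, fun s t hs hst ξ hξ hb => ?_⟩
  rw [← h.eq s t hs hst ξ hξ hb]
  simp only [mul_comm]

lemma Cov.congr {N N' c c' : ℝ → Ω → ℝ} (h : Cov P G N N' c)
    (hc : ∀ᵐ ω ∂P, ∀ r, 0 ≤ r → c r ω = c' r ω) :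
    Cov P G N N' c' := by
  have key : ∀ᵐ p ∂(volume.prod P : Measure (ℝ × Ω)), 0 ≤ p.1 → c p.1 p.2 = c' p.1 p.2 := by
    have := Measure.quasiMeasurePreserving_snd (μ := (volume : Measure ℝ)) (ν := P) |>.ae hc
    filter_upwards [this] with p hp h0 using hp _ h0
  refine ⟨fun T => ?_, fun s t hs hst ξ hξ hb => ?_⟩
  · refine (h.int T).congr ?_
    rw [EventuallyEq, ae_restrict_iff' (measurableSet_Ioc.prod .univ)]
    filter_upwards [key] with p hp hp1 using hp hp1.1.1.le
  · rw [h.eq s t hs hst ξ hξ hb]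
    refine setIntegral_congr_ae (measurableSet_Ioc.prod .univ) ?_
    filter_upwards [key] with p hp hp1
    rw [hp (hs.trans hp1.1.1.le)]

lemma Cov.add {N₁ N₂ N' c₁ c₂ : ℝ → Ω → ℝ} (hN₁ : L2M P G N₁) (hN₂ : L2M P G N₂)
    (hN' : L2M P G N') (h₁ : Cov P G N₁ N' c₁) (h₂ : Cov P G N₂ N' c₂) :
    Cov P G (fun t ω => N₁ t ω + N₂ t ω) N' (fun t ω => c₁ t ω + c₂ t ω) := by
  refine ⟨fun T => (h₁.int T).add (h₂.int T), fun s t hs hst ξ hξ hb => ?_⟩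
  have i1 := weight_int h₁ (s := s) (t := t) hs hξ hb
  have i2 := weight_int h₂ (s := s) (t := t) hs hξ hb
  have j : ∀ {A : ℝ → Ω → ℝ} (hA : L2M P G A) (r : ℝ),
      Integrable (fun ω => ξ ω * (A r ω * N' r ω)) P := fun hA r =>
    integrable_bdd_mul2 (sm hξ) hb (hA.memLp r) (hN'.memLp r)
  simp only [add_mul, mul_add]
  rw [integral_add i1 i2, integral_add (j hN₁ t) (j hN₂ t), integral_add (j hN₁ s) (j hN₂ s),
    ← h₁.eq s t hs hst ξ hξ hb, ← h₂.eq s t hs hst ξ hξ hb]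
  ring

lemma Cov.neg {N N' c : ℝ → Ω → ℝ} (h : Cov P G N N' c) :
    Cov P G (fun t ω => - N t ω) N' (fun t ω => - c t ω) := by
  refine ⟨fun T => (h.int T).neg, fun s t hs hst ξ hξ hb => ?_⟩
  simp only [neg_mul, mul_neg, integral_neg]
  rw [← h.eq s t hs hst ξ hξ hb]
  ring

lemma L2M.add {N N' : ℝ → Ω → ℝ} (h : L2M P G N) (h' : L2M P G N') :
    L2M P G (fun t ω => N t ω + N' t ω) := by
  refine ⟨fun t => (h.adapted t).add (h'.adapted t), fun t => (h.memLp t).add (h'.memLp t),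
    fun s t hs hst η hη hb => ?_⟩
  simp only [mul_add]
  rw [integral_add (integrable_mul2 hb (h.memLp t)) (integrable_mul2 hb (h'.memLp t)),
    integral_add (integrable_mul2 hb (h.memLp s)) (integrable_mul2 hb (h'.memLp s)),
    h.mart s t hs hst η hη hb, h'.mart s t hs hst η hη hb]

lemma L2M.neg {N : ℝ → Ω → ℝ} (h : L2M P G N) : L2M P G (fun t ω => - N t ω) := by
  refine ⟨fun t => (h.adapted t).neg, fun t => (h.memLp t).neg, fun s t hs hst η hη hb => ?_⟩
  simp only [mul_neg, integral_neg]
  rw [h.mart s t hs hst η hη hb]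

lemma L2M.zero : L2M P G (fun _ _ => 0) :=
  ⟨fun _ => stronglyMeasurable_const, fun _ => MemLp.zero', fun _ _ _ _ _ _ _ => rfl⟩

lemma Cov.zero {N : ℝ → Ω → ℝ} : Cov P G (fun _ _ => 0) N (fun _ _ => 0) := by
  refine ⟨fun T => ?_, fun s t hs hst ξ hξ hb => by simp⟩
  exact integrableOn_zero

lemma L2M.sum {N : ℕ → ℝ → Ω → ℝ} (n : ℕ) (h : ∀ i < n, L2M P G (N i)) :
    L2M P G (fun t ω => ∑ i ∈ Finset.range n, N i t ω) := by
  induction n with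
  | zero => simpa using L2M.zero
  | succ n ih =>
    simp only [Finset.sum_range_succ]
    exact (ih fun i hi => h i (by omega)).add (h n (by omega))

lemma Cov.sum {N c : ℕ → ℝ → Ω → ℝ} {N' : ℝ → Ω → ℝ} (hN' : L2M P G N') (n : ℕ)
    (h : ∀ i < n, L2M P G (N i)) (hc : ∀ i < n, Cov P G (N i) N' (c i)) :
    Cov P G (fun t ω => ∑ i ∈ Finset.range n, N i t ω) N'
      (fun t ω => ∑ i ∈ Finset.range n, c i t ω) := by
  induction n with
  | zero => simpa using Cov.zero
  | succ n ih =>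
    simp only [Finset.sum_range_succ]
    exact Cov.add (L2M.sum n fun i hi => h i (by omega)) (h n (by omega)) hN'
      (ih (fun i hi => h i (by omega)) fun i hi => hc i (by omega)) (hc n (by omega))

/-- One-step stochastic integral. -/
def sgl (α : Ω → ℝ) (u v : ℝ) (N : ℝ → Ω → ℝ) : ℝ → Ω → ℝ :=
  fun t ω => α ω * (N (min t v) ω - N (min t u) ω)

lemma sgl_le {α : Ω → ℝ} {u v : ℝ} (huv : u ≤ v) {N : ℝ → Ω → ℝ} {t : ℝ} (ht : t ≤ u) (ω : Ω) :
    sgl α u v N t ω = 0 := by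
  simp [sgl, min_eq_left ht, min_eq_left (ht.trans huv)]

lemma sgl_mid {α : Ω → ℝ} {u v : ℝ} {N : ℝ → Ω → ℝ} {t : ℝ} (ht : u ≤ t) (ht' : t ≤ v) (ω : Ω) :
    sgl α u v N t ω = α ω * (N t ω - N u ω) := by
  simp [sgl, min_eq_left ht', min_eq_right ht]

lemma sgl_ge {α : Ω → ℝ} {u v : ℝ} (huv : u ≤ v) {N : ℝ → Ω → ℝ} {t : ℝ} (ht : v ≤ t) (ω : Ω) :
    sgl α u v N t ω = α ω * (N v ω - N u ω) := by
  simp [sgl, min_eq_right ht, min_eq_right (huv.trans ht)]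

lemma L2M.sgl {α : Ω → ℝ} {u v : ℝ} {N : ℝ → Ω → ℝ} (h : L2M P G N) (hu : 0 ≤ u) (huv : u ≤ v)
    (hα : StronglyMeasurable[G u] α) (hαb : ∃ C, ∀ ω, |α ω| ≤ C) : L2M P G (sgl α u v N) := by
  refine ⟨fun t => ?_, fun t => ?_, fun s t hs hst η hη hηb => ?_⟩
  · rcases le_total t u with htu | htu
    · have : GB.sgl α u v N t = fun _ => 0 := funext (sgl_le huv htu)
      rw [this]
      exact stronglyMeasurable_const
    · exact (hα.mono (G.mono htu)).mul (((h.adapted _).mono (G.mono (min_le_left _ _))).sub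
        ((h.adapted _).mono (G.mono (min_le_left _ _))))
  · exact memLp_bdd_mul (sm hα) hαb ((h.memLp _).sub (h.memLp _))
  · have hηα : MemLp (fun ω => η ω * α ω) 2 P := by
      simpa only [mul_comm] using memLp_bdd_mul (sm hα) hαb hηb
    have key : ∀ r a b, r ≤ a → a ≤ b → u ≤ a → s ≤ a → 0 ≤ a →
        ∫ ω, η ω * (α ω * (N b ω - N a ω)) ∂P = 0 := by
      intro r a b _ hab hua hsa ha
      have := h.mart a b ha hab (fun ω => η ω * α ω)
        ((hη.mono (G.mono hsa)).mul (hα.mono (G.mono hua))) hηα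
      simp only [← mul_assoc, mul_sub]
      rw [integral_sub (integrable_mul2 hηα (h.memLp b)) (integrable_mul2 hηα (h.memLp a)), this,
        sub_self]
    rcases le_total s u with hsu | hsu
    · simp only [sgl_le huv hsu, mul_zero, integral_zero]
      rcases le_total t u with htu | htu
      · simp only [sgl_le huv htu, mul_zero, integral_zero]
      · rcases le_total t v with htv | htv
        · simp only [sgl_mid htu htv]
          exact key u u t le_rfl htu le_rfl hsu hu
        · simp only [sgl_ge huv htv]
          exact key u u v le_rfl huv le_rfl hsu hu
    · rcases le_total v s with hvs | hvs
      · simp only [sgl_ge huv hvs, sgl_ge huv (hvs.trans hst)]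
      · have e1 : ∃ b, s ≤ b ∧ ∀ ω, GB.sgl α u v N t ω = α ω * (N b ω - N u ω) := by
          rcases le_total t v with htv | htv
          · exact ⟨t, hst, sgl_mid (hsu.trans hst) htv⟩
          · exact ⟨v, hvs, sgl_ge huv htv⟩
        obtain ⟨b, hb, e1⟩ := e1
        simp only [e1, sgl_mid hsu hvs]
        have := key s s b le_rfl hb hsu le_rfl hs
        rw [← sub_eq_zero, ← integral_sub, ← this]
        · congr 1
          ext ω
          ring
        · exact integrable_mul2 hηb (memLp_bdd_mul (sm hα) hαb ((h.memLp _).sub (h.memLp _)))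
        · exact integrable_mul2 hηb (memLp_bdd_mul (sm hα) hαb ((h.memLp _).sub (h.memLp _)))

lemma Cov.sgl {α : Ω → ℝ} {u v : ℝ} {N N' c : ℝ → Ω → ℝ} (hN : L2M P G N) (hN' : L2M P G N')
    (h : Cov P G N N' c) (hu : 0 ≤ u) (huv : u ≤ v)
    (hα : StronglyMeasurable[G u] α) (hαb : ∃ C, ∀ ω, |α ω| ≤ C) :
    Cov P G (sgl α u v N) N' (fun r ω => (Ioc u v).indicator 1 r * α ω * c r ω) := by
  have hS := hN.sgl hu huv hα hαb
  have hIntg : ∀ T, IntegrableOn (fun p : ℝ × Ω => (Ioc u v).indicator 1 p.1 * α p.2 * c p.1 p.2)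
      (Ioc 0 T ×ˢ univ) (volume.prod P) := by
    intro T
    refine integrableOn_bdd_mul (f := fun p => (Ioc u v).indicator 1 p.1 * α p.2) ?_ ?_ (h.int T)
    · refine Measurable.aestronglyMeasurable ?_
      refine Measurable.mul ?_ ?_
      · exact (measurable_one.indicator measurableSet_Ioc).comp measurable_fst
      · exact (hα.mono (G.le u)).measurable.comp measurable_snd
    · refine bdd_mul ⟨1, fun p => ?_⟩ ?_
      · by_cases hp : p.1 ∈ Ioc u v <;> simp [hp]
      · obtain ⟨C, hC⟩ := hαb
        exact ⟨C, fun p => hC _⟩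
  refine ⟨hIntg, ?_⟩
  set c' : ℝ → Ω → ℝ := fun r ω => (Ioc u v).indicator 1 r * α ω * c r ω with hc'
  let Φ : ℝ → ℝ → Prop := fun s t => ∀ ξ : Ω → ℝ, StronglyMeasurable[G s] ξ →
    (∃ C, ∀ ω, |ξ ω| ≤ C) →
    ∫ ω, ξ ω * (GB.sgl α u v N t ω * N' t ω) ∂P - ∫ ω, ξ ω * (GB.sgl α u v N s ω * N' s ω) ∂P
      = ∫ p in Ioc s t ×ˢ univ, ξ p.2 * c' p.1 p.2 ∂(volume.prod P)
  have refl : ∀ s, Φ s s := by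
    intro s ξ hξ hb
    simp
  have trans : ∀ s r t, 0 ≤ s → s ≤ r → r ≤ t → Φ s r → Φ r t → Φ s t := by
    intro s r t hs hsr hrt h1 h2 ξ hξ hb
    have e1 := h1 ξ hξ hb
    have e2 := h2 ξ (hξ.mono (G.mono hsr)) hb
    have wi : ∀ a b, 0 ≤ a → IntegrableOn (fun p : ℝ × Ω => ξ p.2 * c' p.1 p.2)
        (Ioc a b ×ˢ univ) (volume.prod P) := fun a b ha => by
      refine integrableOn_bdd_mul (f := fun p => ξ p.2) ?_ ?_
        ((hIntg b).mono_set (prod_mono (Ioc_subset_Ioc_left ha) subset_rfl))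
      · exact ((hξ.mono (G.le s)).comp_measurable measurable_snd).aestronglyMeasurable
      · obtain ⟨C, hC⟩ := hb
        exact ⟨C, fun p => hC _⟩
    rw [← Ioc_union_Ioc_eq_Ioc hsr hrt, union_prod, setIntegral_union, ← e1, ← e2]
    · ring
    · rw [Set.disjoint_prod]
      exact Or.inl (Ioc_disjoint_Ioc_of_le le_rfl)
    · exact measurableSet_Ioc.prod .univ
    · exact wi s r hs
    · exact wi r t (hs.trans hsr)
  have zero_int : ∀ s t, (t ≤ u ∨ v ≤ s) → ∀ ξ : Ω → ℝ,
      ∫ p in Ioc s t ×ˢ univ, ξ p.2 * c' p.1 p.2 ∂(volume.prod P) = 0 := by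
    intro s t hst ξ
    rw [setIntegral_eq_zero_of_forall_eq_zero]
    rintro ⟨r, ω⟩ ⟨hr, -⟩
    have : r ∉ Ioc u v := by
      rintro ⟨h1, h2⟩
      rcases hst with h | h
      · exact absurd (hr.2.trans h) (not_le.2 h1)
      · exact absurd (h.trans_lt hr.1) (not_lt.2 h2)
    simp [hc', this]
  have low : ∀ s t, 0 ≤ s → s ≤ t → t ≤ u → Φ s t := by
    intro s t hs hst htu ξ hξ hb
    rw [zero_int s t (Or.inl htu)]
    simp only [sgl_le huv htu, sgl_le huv (hst.trans htu)]
    simp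
  have high : ∀ s t, 0 ≤ s → s ≤ t → v ≤ s → Φ s t := by
    intro s t hs hst hvs ξ hξ hb
    rw [zero_int s t (Or.inr hvs)]
    have hm := hN'.mart s t hs hst (fun ω => ξ ω * GB.sgl α u v N s ω)
      (hξ.mul (hS.adapted s)) (memLp_bdd_mul (sm hξ) hb (hS.memLp s))
    simp only [sgl_ge huv hvs, sgl_ge huv (hvs.trans hst), ← mul_assoc] at hm ⊢
    rw [hm, sub_self]
  have mid : ∀ s t, 0 ≤ s → s ≤ t → u ≤ s → t ≤ v → Φ s t := by
    intro s t hs hst hus htv ξ hξ hb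
    have hξα : StronglyMeasurable[G s] (fun ω => ξ ω * α ω) := hξ.mul (hα.mono (G.mono hus))
    have hξαb := bdd_mul hb hαb
    have e := h.eq s t hs hst (fun ω => ξ ω * α ω) hξα hξαb
    have hL : MemLp (fun ω => (ξ ω * α ω) * N u ω) 2 P := memLp_bdd_mul (sm hξα) hξαb (hN.memLp u)
    have hm := hN'.mart s t hs hst (fun ω => (ξ ω * α ω) * N u ω)
      (hξα.mul ((hN.adapted u).mono (G.mono hus))) hL
    have e3 : ∫ p in Ioc s t ×ˢ univ, ξ p.2 * c' p.1 p.2 ∂(volume.prod P)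
        = ∫ p in Ioc s t ×ˢ univ, (ξ p.2 * α p.2) * c p.1 p.2 ∂(volume.prod P) := by
      refine setIntegral_congr_fun (measurableSet_Ioc.prod .univ) ?_
      rintro ⟨r, ω⟩ ⟨hr, -⟩
      have : r ∈ Ioc u v := ⟨hus.trans_lt hr.1, hr.2.trans htv⟩
      simp only [hc', indicator_of_mem this, Pi.one_apply]
      ring
    have e4 : ∀ r, u ≤ r → r ≤ v → ∫ ω, ξ ω * (GB.sgl α u v N r ω * N' r ω) ∂P
        = ∫ ω, ξ ω * α ω * (N r ω * N' r ω) ∂P - ∫ ω, ξ ω * α ω * N u ω * N' r ω ∂P := by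
      intro r h1 h2
      rw [← integral_sub (integrable_bdd_mul2 (sm hξα) hξαb (hN.memLp r) (hN'.memLp r))
        (integrable_mul2 hL (hN'.memLp r))]
      congr 1
      ext ω
      rw [sgl_mid h1 h2]
      ring
    rw [e3, ← e, e4 t (hus.trans hst) htv, e4 s hus (hst.trans htv), hm]
    ring
  intro s t hs hst
  show Φ s t
  rcases le_total t u with htu | htu
  · exact low s t hs hst htu
  rcases le_total v s with hvs | hvs
  · exact high s t hs hst hvs
  have hA : Φ s (max s u) := by
    rcases le_total s u with h1 | h1
    · rw [max_eq_right h1]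
      exact low s u hs h1 le_rfl
    · rw [max_eq_left h1]
      exact refl s
  have hB : Φ (min t v) t := by
    rcases le_total t v with h1 | h1
    · rw [min_eq_left h1]
      exact refl t
    · rw [min_eq_right h1]
      exact high v t (hu.trans huv) h1 le_rfl
  have hle : max s u ≤ min t v := max_le (le_min hst hvs) (le_min htu huv)
  have hC : Φ (max s u) (min t v) :=
    mid _ _ (hs.trans (le_max_left _ _)) hle (le_max_right _ _) (min_le_right _ _)
  exact trans s _ t hs (le_max_left _ _) (hle.trans (min_le_left _ _)) hA
    (trans _ _ t (hs.trans (le_max_left _ _)) hle (min_le_left _ _) hC hB)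

end
end GB

namespace GB
open Set
set_option linter.unusedSectionVars false

/-- Uniform grid. -/
def grid (q T : ℝ) (n i : ℕ) : ℝ := q + (T - q) * (i / (n + 1))

lemma grid_zero (q T : ℝ) (n : ℕ) : grid q T n 0 = q := by simp [grid]

lemma grid_last (q T : ℝ) (n : ℕ) : grid q T n (n + 1) = T := by
  have : (n + 1 : ℝ) ≠ 0 := by positivity
  simp [grid, this]

lemma grid_mono {q T : ℝ} (h : q ≤ T) (n : ℕ) : Monotone (grid q T n) := by
  intro i j hij
  have : (i : ℝ) ≤ j := by exact_mod_cast hij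
  have h' : 0 ≤ T - q := by linarith
  unfold grid
  gcongr

lemma grid_ge {q T : ℝ} (h : q ≤ T) (n i : ℕ) : q ≤ grid q T n i := by
  have := grid_mono h n (Nat.zero_le i)
  rwa [grid_zero] at this

lemma grid_cell {q T r : ℝ} (hr : r ∈ Ioc q T) (n : ℕ) :
    ∃ i < n + 1, (∀ j, r ∈ Ioc (grid q T n j) (grid q T n (j + 1)) ↔ j = i) ∧
      |grid q T n i - r| ≤ (T - q) / (n + 1) := by
  have hq : 0 < T - q := by linarith [hr.1, hr.2]
  have hn : (0 : ℝ) < n + 1 := by positivity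
  set x := (r - q) / (T - q) * (n + 1) with hx
  have hx0 : 0 < x := mul_pos (div_pos (by linarith [hr.1]) hq) hn
  have hxn : x ≤ n + 1 := by
    have : (r - q) / (T - q) ≤ 1 := by rw [div_le_one hq]; linarith [hr.2]
    nlinarith
  have hrx : r = q + (T - q) * (x / (n + 1)) := by
    rw [hx]; field_simp; ring
  have hiff : ∀ j : ℕ, r ∈ Ioc (grid q T n j) (grid q T n (j + 1)) ↔ ((j : ℝ) < x ∧ x ≤ j + 1) := by
    intro j
    rw [mem_Ioc, hrx, grid, grid]
    push_cast
    simp only [add_lt_add_iff_left, add_le_add_iff_left, mul_lt_mul_iff_right₀ hq,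
      mul_le_mul_iff_right₀ hq, div_lt_div_iff_of_pos_right hn, div_le_div_iff_of_pos_right hn]
  have hc : 0 < ⌈x⌉₊ := Nat.ceil_pos.2 hx0
  have h1 : ∀ j : ℕ, ((j : ℝ) < x ∧ x ≤ j + 1) ↔ j = ⌈x⌉₊ - 1 := by
    intro j
    have := Nat.ceil_eq_iff (a := x) (n := j + 1) (by omega)
    simp only [Nat.add_sub_cancel] at this
    push_cast at this
    rw [← this]
    omega
  refine ⟨⌈x⌉₊ - 1, ?_, fun j => (hiff j).trans (h1 j), ?_⟩
  · have : ⌈x⌉₊ ≤ n + 1 := Nat.ceil_le.2 (by push_cast; exact hxn)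
    omega
  · have h2 := (h1 _).2 rfl
    set i := ⌈x⌉₊ - 1
    have h3 : grid q T n i - r = - ((T - q) / (n + 1) * (x - i)) := by
      rw [hrx, grid]; field_simp; ring
    rw [h3, abs_neg, abs_of_nonneg (mul_nonneg (by positivity) (by linarith [h2.1]))]
    have : 0 ≤ (T - q) / (n + 1) := by positivity
    nlinarith [h2.2]

section
variable {Ω : Type*} [m : MeasurableSpace Ω] {P : Measure Ω} [IsProbabilityMeasure P]
  {G : Filtration ℝ m}

/-- Stochastic integral of the step approximation of `a` against `N`. -/
def SI (q T : ℝ) (n : ℕ) (a N : ℝ → Ω → ℝ) : ℝ → Ω → ℝ := fun t ω =>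
  ∑ i ∈ Finset.range (n + 1),
    sgl (a (grid q T n i)) (grid q T n i) (grid q T n (i + 1)) N t ω

/-- Step approximation of `a`. -/
def SA (q T : ℝ) (n : ℕ) (a : ℝ → Ω → ℝ) : ℝ → Ω → ℝ := fun r ω =>
  ∑ i ∈ Finset.range (n + 1),
    (Ioc (grid q T n i) (grid q T n (i + 1))).indicator 1 r * a (grid q T n i) ω

lemma SA_cell {q T r : ℝ} (hr : r ∈ Ioc q T) (n : ℕ) (a : ℝ → Ω → ℝ) :
    ∃ i < n + 1, |grid q T n i - r| ≤ (T - q) / (n + 1) ∧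
      ∀ ω, SA q T n a r ω = a (grid q T n i) ω := by
  obtain ⟨i, hi, h1, h2⟩ := grid_cell hr n
  refine ⟨i, hi, h2, fun ω => ?_⟩
  unfold SA
  rw [Finset.sum_eq_single i]
  · rw [indicator_of_mem ((h1 i).2 rfl)]; simp
  · intro j _ hj
    rw [indicator_of_notMem (fun h => hj ((h1 j).1 h))]; simp
  · intro h
    exact absurd (Finset.mem_range.2 hi) h

lemma SA_out {q T r : ℝ} (hqT : q ≤ T) (hr : r ∉ Ioc q T) (n : ℕ) (a : ℝ → Ω → ℝ) (ω : Ω) :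
    SA q T n a r ω = 0 := by
  unfold SA
  refine Finset.sum_eq_zero fun i hi => ?_
  rw [indicator_of_notMem, zero_mul]
  rintro ⟨h1, h2⟩
  refine hr ⟨(grid_ge hqT n i).trans_lt h1, h2.trans ?_⟩
  have := grid_mono hqT n (show i + 1 ≤ n + 1 by have := Finset.mem_range.1 hi; omega)
  rwa [grid_last] at this

lemma SA_bdd {q T : ℝ} (hqT : q ≤ T) (n : ℕ) {a : ℝ → Ω → ℝ} {C : ℝ} (hC : 0 ≤ C)
    (h : ∀ r ω, |a r ω| ≤ C) (r : ℝ) (ω : Ω) : |SA q T n a r ω| ≤ C := by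
  by_cases hr : r ∈ Ioc q T
  · obtain ⟨i, _, _, h2⟩ := SA_cell hr n a
    rw [h2]; exact h _ _
  · rw [SA_out hqT hr]; simpa

lemma SA_tendsto {q T r : ℝ} (hr : r ∈ Ioc q T) {a : ℝ → Ω → ℝ} (ω : Ω)
    (hc : Continuous fun r => a r ω) :
    Tendsto (fun n => SA q T n a r ω) atTop (nhds (a r ω)) := by
  choose i hi h1 h2 using fun n => SA_cell hr n a
  simp only [h2]
  refine (hc.tendsto r).comp ?_
  rw [tendsto_iff_dist_tendsto_zero]
  refine squeeze_zero (fun _ => dist_nonneg) (fun n => h1 n) ?_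
  have := tendsto_one_div_add_atTop_nhds_zero_nat (𝕜 := ℝ)
  simpa [div_eq_mul_inv] using this.const_mul (T - q)

lemma SA_measurable {q T : ℝ} (n : ℕ) {a : ℝ → Ω → ℝ} (ha : ∀ r, Measurable (a r)) :
    Measurable fun p : ℝ × Ω => SA q T n a p.1 p.2 := by
  unfold SA
  refine Finset.measurable_sum _ fun i _ => ?_
  exact ((measurable_one.indicator measurableSet_Ioc).comp measurable_fst).mul
    ((ha _).comp measurable_snd)

lemma L2M.SI {q T : ℝ} (hq : 0 ≤ q) (hqT : q ≤ T) (n : ℕ) {a N : ℝ → Ω → ℝ} (h : L2M P G N)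
    (ha : ∀ r, StronglyMeasurable[G r] (a r)) {C : ℝ} (hb : ∀ r ω, |a r ω| ≤ C) :
    L2M P G (SI q T n a N) := by
  refine L2M.sum _ fun i _ => ?_
  exact h.sgl (hq.trans (grid_ge hqT n i)) (grid_mono hqT n (Nat.le_succ i)) (ha _) ⟨C, hb _⟩

lemma Cov.SI {q T : ℝ} (hq : 0 ≤ q) (hqT : q ≤ T) (n : ℕ) {a N N' c : ℝ → Ω → ℝ}
    (hN : L2M P G N) (hN' : L2M P G N') (h : Cov P G N N' c)
    (ha : ∀ r, StronglyMeasurable[G r] (a r)) {C : ℝ} (hb : ∀ r ω, |a r ω| ≤ C) :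
    Cov P G (SI q T n a N) N' (fun r ω => SA q T n a r ω * c r ω) := by
  have := Cov.sum hN' (n + 1) (N := fun i => GB.sgl (a (grid q T n i)) (grid q T n i)
    (grid q T n (i + 1)) N) (c := fun i r ω => (Ioc (grid q T n i) (grid q T n (i + 1))).indicator 1 r
      * a (grid q T n i) ω * c r ω)
    (fun i _ => hN.sgl (hq.trans (grid_ge hqT n i)) (grid_mono hqT n (Nat.le_succ i)) (ha _)
      ⟨C, hb _⟩)
    (fun i _ => Cov.sgl hN hN' h (hq.trans (grid_ge hqT n i)) (grid_mono hqT n (Nat.le_succ i))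
      (ha _) ⟨C, hb _⟩)
  simp only [SA, Finset.sum_mul]
  exact this

lemma SI_zero {q T : ℝ} (hqT : q ≤ T) (n : ℕ) {a N : ℝ → Ω → ℝ} {t : ℝ} (ht : t ≤ q) (ω : Ω) :
    SI q T n a N t ω = 0 := by
  refine Finset.sum_eq_zero fun i _ => ?_
  exact sgl_le (grid_mono hqT n (Nat.le_succ i)) (ht.trans (grid_ge hqT n i)) ω

lemma SI_cont {q T : ℝ} (n : ℕ) {a N : ℝ → Ω → ℝ} (ω : Ω) (hN : Continuous fun t => N t ω) :
    Continuous fun t => SI q T n a N t ω := by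
  unfold SI sgl
  refine continuous_finsetSum _ fun i _ => ?_
  refine continuous_const.mul ?_
  exact (hN.comp (continuous_id.min continuous_const)).sub
    (hN.comp (continuous_id.min continuous_const))

lemma SI_cell {q T : ℝ} (hqT : q ≤ T) {n i : ℕ} (hi : i < n + 1) {a N : ℝ → Ω → ℝ} {s t : ℝ}
    (hst : s ≤ t) (hs : grid q T n i ≤ s) (ht : t ≤ grid q T n (i + 1)) (ω : Ω) :
    SI q T n a N t ω - SI q T n a N s ω = a (grid q T n i) ω * (N t ω - N s ω) := by
  unfold SI
  rw [← Finset.sum_sub_distrib, Finset.sum_eq_single i]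
  · rw [sgl_mid (hs.trans hst) ht, sgl_mid hs (hst.trans ht)]
    ring
  · intro j _ hj
    rcases lt_or_gt_of_ne hj with h | h
    · have h1 := grid_mono hqT n (show j + 1 ≤ i from h)
      have h2 := grid_mono hqT n (Nat.le_succ j)
      rw [sgl_ge h2 (h1.trans (hs.trans hst)), sgl_ge h2 (h1.trans hs), sub_self]
    · have h1 := grid_mono hqT n (show i + 1 ≤ j from h)
      have h2 := grid_mono hqT n (Nat.le_succ j)
      rw [sgl_le h2 (ht.trans h1), sgl_le h2 (hst.trans (ht.trans h1)), sub_self]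
  · intro h
    exact absurd (Finset.mem_range.2 hi) h

lemma SI_const {q T : ℝ} (hqT : q ≤ T) (n : ℕ) {a N : ℝ → Ω → ℝ} {ω : Ω}
    (h : ∀ r ∈ Icc q T, a r ω = 1) : SI q T n a N T ω = N T ω - N q ω := by
  have : ∀ k ≤ n + 1, SI q T n a N (grid q T n k) ω = N (grid q T n k) ω - N q ω := by
    intro k
    induction k with
    | zero => intro _; rw [grid_zero, SI_zero hqT n le_rfl]; simp
    | succ k ih =>
      intro hk
      have h1 := SI_cell hqT (show k < n + 1 by omega) (a := a) (N := N)
        (grid_mono hqT n (Nat.le_succ k)) le_rfl le_rfl ω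
      have h2 := grid_mono hqT n (show k ≤ n + 1 by omega)
      rw [grid_last] at h2
      rw [h _ ⟨grid_ge hqT n k, h2⟩, ih (by omega)] at h1
      simp only [Nat.succ_eq_add_one] at h1
      linarith
  have h3 := this (n + 1) le_rfl
  rwa [grid_last] at h3

/-- Rotation-invariance of the increments of a planar Brownian motion. -/
def Rot (P : Measure Ω) (G : Filtration ℝ m) (W W' : ℝ → Ω → ℝ) : Prop :=
  ∀ s t, 0 ≤ s → s ≤ t → ∀ (Z : Ω → ℂ) (ξ η : Ω → ℝ), StronglyMeasurable[G s] Z →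
    (∃ C, ∀ ω, ‖Z ω‖ ≤ C) → StronglyMeasurable[G s] ξ → StronglyMeasurable[G s] η →
    (∀ ω, ξ ω ^ 2 + η ω ^ 2 = 1) → ∀ u : ℝ,
    ∫ ω, Z ω * Complex.exp ((u * (ξ ω * (W t ω - W s ω) + η ω * (W' t ω - W' s ω)) : ℝ) * Complex.I) ∂P
      = Complex.exp ((-(u ^ 2 * (t - s) / 2) : ℝ)) * ∫ ω, Z ω ∂P

lemma SI_rot {W W' a b : ℝ → Ω → ℝ} (hR : Rot P G W W') {T : ℝ} (hT : 0 ≤ T) (n : ℕ)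
    (hW : L2M P G W) (hW' : L2M P G W') 
    (ha : ∀ r, StronglyMeasurable[G r] (a r)) (hb : ∀ r, StronglyMeasurable[G r] (b r))
    (hab : ∀ r ω, a r ω ^ 2 + b r ω ^ 2 = 1) {s t : ℝ} (hs : 0 ≤ s) (hst : s ≤ t) (htT : t ≤ T)
    (Z : Ω → ℂ) (hZ : StronglyMeasurable[G s] Z) (hZb : ∃ C, ∀ ω, ‖Z ω‖ ≤ C) (u : ℝ) :
    ∫ ω, Z ω * Complex.exp ((u * ((SI 0 T n a W t ω + SI 0 T n b W' t ω)
        - (SI 0 T n a W s ω + SI 0 T n b W' s ω)) : ℝ) * Complex.I) ∂P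
      = Complex.exp ((-(u ^ 2 * (t - s) / 2) : ℝ)) * ∫ ω, Z ω ∂P := by
  have ha1 : ∀ r ω, |a r ω| ≤ 1 := fun r ω => by
    rw [← sq_le_one_iff_abs_le_one]; nlinarith [hab r ω, sq_nonneg (b r ω)]
  have hb1 : ∀ r ω, |b r ω| ≤ 1 := fun r ω => by
    rw [← sq_le_one_iff_abs_le_one]; nlinarith [hab r ω, sq_nonneg (a r ω)]
  have hS := (hW.SI le_rfl hT n ha ha1).add (hW'.SI le_rfl hT n hb hb1)
  set S : ℝ → Ω → ℝ := fun t ω => SI 0 T n a W t ω + SI 0 T n b W' t ω with hSdef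
  let Φ : ℝ → ℝ → Prop := fun s t => ∀ Z : Ω → ℂ, StronglyMeasurable[G s] Z →
    (∃ C, ∀ ω, ‖Z ω‖ ≤ C) →
    ∫ ω, Z ω * Complex.exp ((u * (S t ω - S s ω) : ℝ) * Complex.I) ∂P
      = Complex.exp ((-(u ^ 2 * (t - s) / 2) : ℝ)) * ∫ ω, Z ω ∂P
  have trans : ∀ s r t, s ≤ r → r ≤ t → Φ s r → Φ r t → Φ s t := by
    intro s r t hsr hrt h1 h2 Z hZ hZb
    have e1 := h1 Z hZ hZb
    have hm : StronglyMeasurable[G r]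
        (fun ω => Z ω * Complex.exp ((u * (S r ω - S s ω) : ℝ) * Complex.I)) := by
      refine (hZ.mono (G.mono hsr)).mul ?_
      refine Complex.continuous_exp.comp_stronglyMeasurable ?_
      refine StronglyMeasurable.mul ?_ stronglyMeasurable_const
      refine Complex.continuous_ofReal.comp_stronglyMeasurable ?_
      exact stronglyMeasurable_const.mul ((hS.adapted r).sub ((hS.adapted s).mono (G.mono hsr)))
    have e2 := h2 _ hm (by
      obtain ⟨C, hC⟩ := hZb
      refine ⟨C, fun ω => ?_⟩
      rw [norm_mul, Complex.norm_exp_ofReal_mul_I, mul_one]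
      exact hC ω)
    rw [e1, ← mul_assoc, ← Complex.exp_add] at e2
    convert e2 using 2
    · ext ω
      rw [mul_assoc, ← Complex.exp_add]
      push_cast
      ring_nf
    · push_cast
      ring_nf
  have cell : ∀ i < n + 1, ∀ s t, s ≤ t → grid 0 T n i ≤ s → t ≤ grid 0 T n (i + 1) → Φ s t := by
    intro i hi s t hst h1 h2 Z hZ hZb
    have h0 := grid_ge hT n i
    have := hR s t (h0.trans h1) hst Z (a (grid 0 T n i)) (b (grid 0 T n i)) hZ hZb
      ((ha _).mono (G.mono h1)) ((hb _).mono (G.mono h1)) (hab _) u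
    rw [← this]
    congr 1
    ext ω
    have c1 := SI_cell hT hi (a := a) (N := W) hst h1 h2 ω
    have c2 := SI_cell hT hi (a := b) (N := W') hst h1 h2 ω
    rw [← c1, ← c2, hSdef]
    congr 4
    ring
  have main : ∀ k ≤ n + 1, ∀ s t, 0 ≤ s → s ≤ t → t ≤ grid 0 T n k → Φ s t := by
    intro k
    induction k with
    | zero =>
      intro _ s t hs hst ht
      rw [grid_zero] at ht
      obtain rfl : s = t := by linarith
      intro Z hZ hZb
      simp
    | succ k ih =>
      intro hk s t hs hst ht
      rcases le_total t (grid 0 T n k) with h1 | h1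
      · exact ih (by omega) s t hs hst h1
      rcases le_total (grid 0 T n k) s with h2 | h2
      · exact cell k (by omega) s t hst h2 ht
      · exact trans s _ t h2 h1 (ih (by omega) s _ hs h2 le_rfl)
          (cell k (by omega) _ t h1 le_rfl ht)
  exact main (n + 1) le_rfl s t hs hst (by rw [grid_last]; exact htT) Z hZ hZb

end
end GB

namespace GB
open Set
set_option linter.unusedSectionVars false

section
variable {Ω : Type*} [m : MeasurableSpace Ω] {P : Measure Ω} [IsProbabilityMeasure P]
  {G : Filtration ℝ m}

lemma mart_pull {N : ℝ → Ω → ℝ} (h : Martingale N G P) {s t : ℝ} (hst : s ≤ t) {η : Ω → ℝ}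
    (hη : StronglyMeasurable[G s] η) (hi : Integrable (fun ω => η ω * N t ω) P) :
    ∫ ω, η ω * N t ω ∂P = ∫ ω, η ω * N s ω ∂P := by
  have h1 := condExp_mul_of_stronglyMeasurable_left hη hi (h.integrable t)
  rw [← integral_condExp (G.le s) (f := fun ω => η ω * N t ω)]
  refine integral_congr_ae ?_
  filter_upwards [h1, h.2 s t hst] with ω h1 h2
  rw [← h2]
  exact h1

lemma L2M.of_martingale {N : ℝ → Ω → ℝ} (h : Martingale N G P) (h2 : ∀ t, MemLp (N t) 2 P) :
    L2M P G N :=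
  ⟨h.1, h2, fun _ t _ hst _ hη hb => mart_pull h hst hη (integrable_mul2 hb (h2 t))⟩

lemma martingale_of_weak {f : ℝ → Ω → ℝ} (ha : ∀ t, StronglyMeasurable[G t] (f t))
    (hi : ∀ t, Integrable (f t) P) (h0 : ∀ t ≤ 0, f t =ᵐ[P] 0)
    (h : ∀ s t, 0 ≤ s → s ≤ t → ∀ A, MeasurableSet[G s] A → ∫ ω in A, f t ω ∂P = ∫ ω in A, f s ω ∂P) :
    Martingale f G P := by
  have z : ∀ t ≤ 0, ∀ A, ∫ ω in A, f t ω ∂P = 0 := by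
    intro t ht A
    rw [integral_congr_ae (ae_restrict_of_ae (h0 t ht))]
    simp
  have hall : ∀ s t, s ≤ t → ∀ A, MeasurableSet[G s] A →
      ∫ ω in A, f t ω ∂P = ∫ ω in A, f s ω ∂P := by
    intro s t hst A hA
    rcases le_total 0 s with hs | hs
    · exact h s t hs hst A hA
    · rw [z s hs]
      rcases le_total 0 t with ht | ht
      · rw [h 0 t le_rfl ht A (G.mono hs A hA), z 0 le_rfl]
      · exact z t ht A
  refine ⟨ha, fun s t hst => ?_⟩
  symm
  refine ae_eq_condExp_of_forall_setIntegral_eq (G.le s) (hi t) (fun A _ _ => (hi s).integrableOn)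
    (fun A hA _ => (hall s t hst A hA).symm) (ha s).aestronglyMeasurable

lemma fubini_weight {c : ℝ → Ω → ℝ} {R : Set ℝ} {ξ : Ω → ℝ}
    (hi : IntegrableOn (fun p : ℝ × Ω => ξ p.2 * c p.1 p.2) (R ×ˢ univ) (volume.prod P)) :
    ∫ p in R ×ˢ univ, ξ p.2 * c p.1 p.2 ∂(volume.prod P) = ∫ ω, ξ ω * (∫ r in R, c r ω) ∂P := by
  have e : (volume.prod P).restrict (R ×ˢ (univ : Set Ω)) = (volume.restrict R).prod P := by
    rw [← Measure.prod_restrict, Measure.restrict_univ]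
  rw [IntegrableOn, e] at hi
  rw [e, integral_prod_symm _ hi]
  congr 1
  ext ω
  rw [← integral_const_mul]

lemma path_int {c : ℝ → Ω → ℝ} {R : Set ℝ}
    (hi : IntegrableOn (fun p : ℝ × Ω => c p.1 p.2) (R ×ˢ univ) (volume.prod P)) :
    Integrable (fun ω => ∫ r in R, c r ω) P ∧ ∀ᵐ ω ∂P, IntegrableOn (fun r => c r ω) R := by
  have e : (volume.prod P).restrict (R ×ˢ (univ : Set Ω)) = (volume.restrict R).prod P := by
    rw [← Measure.prod_restrict, Measure.restrict_univ]
  rw [IntegrableOn, e] at hi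
  exact ⟨hi.integral_prod_right, hi.prod_left_ae⟩

lemma path_split {c : ℝ → Ω → ℝ} {s t : ℝ} (hs : 0 ≤ s) (hst : s ≤ t)
    (hi : IntegrableOn (fun p : ℝ × Ω => c p.1 p.2) (Ioc 0 t ×ˢ univ) (volume.prod P)) :
    ∀ᵐ ω ∂P, ∫ r in Ioc 0 t, c r ω = (∫ r in Ioc 0 s, c r ω) + ∫ r in Ioc s t, c r ω := by
  filter_upwards [(path_int hi).2] with ω hω
  rw [← Ioc_union_Ioc_eq_Ioc hs hst, setIntegral_union (Ioc_disjoint_Ioc_of_le le_rfl)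
    measurableSet_Ioc (hω.mono_set (Ioc_subset_Ioc_right hst))
    (hω.mono_set (Ioc_subset_Ioc_left hs))]

lemma Cov.of_martingale {N N' c : ℝ → Ω → ℝ} (hN : L2M P G N) (hN' : L2M P G N')
    (hc : ∀ T, IntegrableOn (fun p : ℝ × Ω => c p.1 p.2) (Ioc 0 T ×ˢ univ) (volume.prod P))
    (h : Martingale (fun t ω => N t ω * N' t ω - ∫ r in Ioc 0 t, c r ω) G P) :
    Cov P G N N' c := by
  refine ⟨hc, fun s t hs hst ξ hξ hb => ?_⟩
  have hbm : ∀ {f : Ω → ℝ}, Integrable f P → Integrable (fun ω => ξ ω * f ω) P := fun hf =>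
    memLp_one_iff_integrable.1 (memLp_bdd_mul (sm hξ) hb (memLp_one_iff_integrable.2 hf))
  have e := mart_pull h hst hξ (hbm (h.integrable t))
  have hcI : ∀ r, Integrable (fun ω => ∫ r in Ioc 0 r, c r ω) P := fun r => (path_int (hc r)).1
  have hi2 : IntegrableOn (fun p : ℝ × Ω => c p.1 p.2) (Ioc s t ×ˢ univ) (volume.prod P) :=
    (hc t).mono_set (prod_mono (Ioc_subset_Ioc_left hs) subset_rfl)
  have hi3 : IntegrableOn (fun p : ℝ × Ω => ξ p.2 * c p.1 p.2) (Ioc s t ×ˢ univ)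
      (volume.prod P) := by
    refine integrableOn_bdd_mul (f := fun p => ξ p.2) ?_ ?_ hi2
    · exact ((hξ.mono (G.le s)).comp_measurable measurable_snd).aestronglyMeasurable
    · obtain ⟨C, hC⟩ := hb
      exact ⟨C, fun p => hC _⟩
  have hNN : ∀ r, Integrable (fun ω => N r ω * N' r ω) P := fun r =>
    integrable_mul2 (hN.memLp r) (hN'.memLp r)
  rw [fubini_weight hi3]
  simp only [mul_sub] at e
  rw [integral_sub (hbm (hNN t)) (hbm (hcI t)), integral_sub (hbm (hNN s)) (hbm (hcI s))] at e
  have e2 : ∫ ω, ξ ω * (∫ r in Ioc 0 t, c r ω) ∂P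
      = ∫ ω, ξ ω * (∫ r in Ioc 0 s, c r ω) ∂P + ∫ ω, ξ ω * (∫ r in Ioc s t, c r ω) ∂P := by
    rw [← integral_add (hbm (hcI s)) (hbm (path_int hi2).1)]
    refine integral_congr_ae ?_
    filter_upwards [path_split hs hst (hc t)] with ω hω
    rw [hω, mul_add]
  linarith

lemma indicator_bdd (A : Set Ω) : ∃ C, ∀ ω, |A.indicator (fun _ => (1 : ℝ)) ω| ≤ C := by
  refine ⟨1, fun ω => ?_⟩
  by_cases h : ω ∈ A <;> simp [h]

lemma setInt_eq {f : Ω → ℝ} {A : Set Ω} (hA : MeasurableSet A) :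
    ∫ ω in A, f ω ∂P = ∫ ω, A.indicator (fun _ => (1 : ℝ)) ω * f ω ∂P := by
  rw [← integral_indicator hA]
  congr 1
  ext ω
  by_cases h : ω ∈ A <;> simp [h]

lemma L2M.martingale {N : ℝ → Ω → ℝ} (h : L2M P G N) (h0 : ∀ t ≤ 0, N t =ᵐ[P] 0) :
    Martingale N G P := by
  refine martingale_of_weak h.adapted (fun t => (h.memLp t).integrable (by norm_num)) h0 ?_
  intro s t hs hst A hA
  rw [setInt_eq (G.le s A hA), setInt_eq (G.le s A hA)]
  refine h.mart s t hs hst _ (stronglyMeasurable_const.indicator hA) ?_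
  exact (memLp_const (1 : ℝ)).indicator (G.le s A hA)

lemma Cov.martingale {N N' c : ℝ → Ω → ℝ} (hN : L2M P G N) (hN' : L2M P G N')
    (h : Cov P G N N' c) (h0 : ∀ t ≤ 0, N t =ᵐ[P] 0)
    (hc : ∀ t, StronglyMeasurable[G t] (fun ω => ∫ r in Ioc 0 t, c r ω)) :
    Martingale (fun t ω => N t ω * N' t ω - ∫ r in Ioc 0 t, c r ω) G P := by
  have hcI : ∀ r, Integrable (fun ω => ∫ r in Ioc 0 r, c r ω) P := fun r => (path_int (h.int r)).1
  have hNN : ∀ r, Integrable (fun ω => N r ω * N' r ω) P := fun r =>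
    integrable_mul2 (hN.memLp r) (hN'.memLp r)
  refine martingale_of_weak (fun t => ((hN.adapted t).mul (hN'.adapted t)).sub (hc t))
    (fun t => (hNN t).sub (hcI t)) ?_ ?_
  · intro t ht
    filter_upwards [h0 t ht] with ω hω
    simp [hω, Ioc_eq_empty (not_lt.2 ht)]
  · intro s t hs hst A hA
    have hξ : StronglyMeasurable[G s] (A.indicator (fun _ => (1 : ℝ))) :=
      stronglyMeasurable_const.indicator hA
    have hb := indicator_bdd A
    have hbm : ∀ {f : Ω → ℝ}, Integrable f P →
        Integrable (fun ω => A.indicator (fun _ => (1 : ℝ)) ω * f ω) P := fun hf =>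
      memLp_one_iff_integrable.1 (memLp_bdd_mul (sm hξ) hb (memLp_one_iff_integrable.2 hf))
    have e := h.eq s t hs hst _ hξ hb
    have hi2 := cov_int_st h (t := t) hs
    rw [fubini_weight (weight_int h hs hξ hb)] at e
    rw [setInt_eq (G.le s A hA), setInt_eq (G.le s A hA)]
    simp only [mul_sub]
    rw [integral_sub (hbm (hNN t)) (hbm (hcI t)), integral_sub (hbm (hNN s)) (hbm (hcI s))]
    have e2 : ∫ ω, A.indicator (fun _ => (1 : ℝ)) ω * (∫ r in Ioc 0 t, c r ω) ∂P
        = ∫ ω, A.indicator (fun _ => (1 : ℝ)) ω * (∫ r in Ioc 0 s, c r ω) ∂P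
          + ∫ ω, A.indicator (fun _ => (1 : ℝ)) ω * (∫ r in Ioc s t, c r ω) ∂P := by
      rw [← integral_add (hbm (hcI s)) (hbm (path_int hi2).1)]
      refine integral_congr_ae ?_
      filter_upwards [path_split hs hst (h.int t)] with ω hω
      rw [hω, mul_add]
    linarith

/-- Time integrals of continuous adapted processes are adapted. -/
lemma integral_adapted {c : ℝ → Ω → ℝ} (hc : ∀ ω, Continuous fun r => c r ω)
    (ha : ∀ r, StronglyMeasurable[G r] (c r)) {β : ℝ → ℝ} (hβ : Measurable β) (t : ℝ) :
    StronglyMeasurable[G t] (fun ω => ∫ r in Ioc 0 t, β r * c r ω) := by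
  have h1 : StronglyMeasurable[(borel ℝ).prod (G t)] (fun p : ℝ × Ω => c (min p.1 t) p.2) := by
    have hb : (borel ℝ) = (inferInstance : MeasurableSpace ℝ) := (BorelSpace.measurable_eq).symm
    rw [hb]
    exact @stronglyMeasurable_uncurry_of_continuous_of_stronglyMeasurable Ω ℝ ℝ _ _ _ _ _ _ _ (G t)
      (fun r ω => c (min r t) ω) (fun ω => (hc ω).comp (continuous_id.min continuous_const))
      (fun r => (ha _).mono (G.mono (min_le_right _ _)))
  have hb : (borel ℝ) = (inferInstance : MeasurableSpace ℝ) := (BorelSpace.measurable_eq).symm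
  rw [hb] at h1
  have h2 : StronglyMeasurable[(inferInstance : MeasurableSpace ℝ).prod (G t)]
      (fun p : ℝ × Ω => β p.1 * c (min p.1 t) p.2) := by
    refine StronglyMeasurable.mul ?_ h1
    exact hβ.stronglyMeasurable.comp_measurable (@measurable_fst ℝ Ω _ (G t))
  have h3 := @StronglyMeasurable.integral_prod_left ℝ Ω ℝ _ (G t) (volume.restrict (Ioc 0 t)) _ _ _
    (fun r ω => β r * c (min r t) ω) h2
  convert h3 using 2 with ω
  refine setIntegral_congr_fun measurableSet_Ioc fun r hr => ?_
  simp [min_eq_left hr.2]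

lemma joint_meas {c : ℝ → Ω → ℝ} (hc : ∀ ω, Continuous fun r => c r ω)
    (ha : ∀ r, Measurable (c r)) : Measurable fun p : ℝ × Ω => c p.1 p.2 :=
  (stronglyMeasurable_uncurry_of_continuous_of_stronglyMeasurable hc
    fun r => (ha r).stronglyMeasurable).measurable

end
end GB

namespace GB
open Set
set_option linter.unusedSectionVars false

lemma gron {f g : ℝ → ℝ} (hf : Continuous f) (hg : Continuous g) {K a T : ℝ} (hK : 0 ≤ K)
    (haT : a ≤ T) (hg0 : ∀ t, 0 ≤ g t)
    (h : ∀ t ∈ Icc a T, f t ≤ g t + K * ∫ s in a..t, f s) :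
    ∫ s in a..T, f s ≤ Real.exp (K * (T - a)) * ∫ s in a..T, g s := by
  set J : ℝ → ℝ := fun t => ∫ s in a..t, f s with hJ
  have dJ : ∀ t, HasDerivAt J (f t) t := fun t =>
    intervalIntegral.integral_hasDerivAt_right (hf.intervalIntegrable _ _)
      (hf.stronglyMeasurableAtFilter _ _) hf.continuousAt
  have dg : ∀ t, HasDerivAt (fun t => ∫ s in a..t, g s) (g t) t := fun t =>
    intervalIntegral.integral_hasDerivAt_right (hg.intervalIntegrable _ _)
      (hg.stronglyMeasurableAtFilter _ _) hg.continuousAt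
  set F : ℝ → ℝ := fun t => J t * Real.exp (-K * (t - a)) - ∫ s in a..t, g s with hF
  have dF : ∀ t, HasDerivAt F (f t * Real.exp (-K * (t - a))
      + J t * (Real.exp (-K * (t - a)) * (-K * 1)) - g t) t := fun t =>
    ((dJ t).mul ((((hasDerivAt_id t).sub_const a).const_mul (-K)).exp)).sub (dg t)
  have hA : AntitoneOn F (Icc a T) := by
    refine antitoneOn_of_deriv_nonpos (convex_Icc _ _)
      (fun t _ => (dF t).continuousAt.continuousWithinAt)
      (fun t _ => (dF t).differentiableAt.differentiableWithinAt) ?_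
    intro t ht
    rw [interior_Icc] at ht
    rw [(dF t).deriv]
    have h1 := h t (Ioo_subset_Icc_self ht)
    have h2 : Real.exp (-K * (t - a)) ≤ 1 := by
      rw [Real.exp_le_one_iff]
      nlinarith [ht.1, mul_nonneg hK (sub_nonneg.2 ht.1.le)]
    have h3 := Real.exp_pos (-K * (t - a))
    have h4 := hg0 t
    have h5 : (f t - K * J t) * Real.exp (-K * (t - a)) ≤ g t * 1 := by
      calc _ ≤ g t * Real.exp (-K * (t - a)) :=
            mul_le_mul_of_nonneg_right (by simp only [hJ]; linarith) h3.le
        _ ≤ _ := mul_le_mul_of_nonneg_left h2 h4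
    nlinarith
  have := hA (left_mem_Icc.2 haT) (right_mem_Icc.2 haT) haT
  simp only [hF, hJ, intervalIntegral.integral_same, zero_mul, sub_zero] at this
  have h3 := Real.exp_pos (K * (T - a))
  have e : Real.exp (K * (T - a)) * Real.exp (-K * (T - a)) = 1 := by
    rw [← Real.exp_add]; simp
  calc ∫ s in a..T, f s
      = Real.exp (K * (T - a)) * ((∫ s in a..T, f s) * Real.exp (-K * (T - a))) := by
        rw [mul_comm (∫ s in a..T, f s), ← mul_assoc, e, one_mul]
    _ ≤ _ := mul_le_mul_of_nonneg_left (by linarith) h3.le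

lemma int_max (f : ℝ → ℝ → ℝ) (X : ℝ → ℝ) (t : ℝ) :
    ∫ s in Ioc 0 (max t 0), f s (X s) = ∫ s in Ioc 0 t, f s (X (max s 0)) := by
  have : Ioc 0 (max t 0) = Ioc 0 t := by
    rcases le_total t 0 with h | h
    · simp [h]
    · simp [h]
  rw [this]
  refine setIntegral_congr_fun measurableSet_Ioc fun r hr => ?_
  simp [max_eq_left hr.1.le]

section
variable {Ω : Type*} [m : MeasurableSpace Ω] {P : Measure Ω} [IsProbabilityMeasure P]
  {G : Filtration ℝ m}

lemma mart_max {N : ℝ → Ω → ℝ} (h : Martingale N G P) (h0 : ∀ ω, N 0 ω = 0) :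
    Martingale (fun t => N (max t 0)) G P := by
  refine martingale_of_weak (fun t => ?_) (fun t => h.integrable _) (fun t ht => ?_) ?_
  · rcases le_total t 0 with ht | ht
    · simp only [max_eq_right ht]
      rw [show N 0 = fun _ => 0 from funext h0]
      exact stronglyMeasurable_const
    · simp only [max_eq_left ht]
      exact h.1 t
  · simp only [max_eq_right ht]
    exact Eventually.of_forall h0
  · intro s t hs hst A hA
    simp only [max_eq_left hs, max_eq_left (hs.trans hst)]
    exact (h.setIntegral_eq hst hA).symm

/-- A regularized solution (constant for negative times). -/
structure Sol (P : Measure Ω) (G : Filtration ℝ m) (W X M : ℝ → Ω → ℝ) (β δ : ℝ → ℝ) (x : ℝ) :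
    Prop where
  Wc : ∀ ω, Continuous fun t => W t ω
  Xc : ∀ ω, Continuous fun t => X t ω
  Mc : ∀ ω, Continuous fun t => M t ω
  W0 : ∀ t ≤ 0, ∀ ω, W t ω = 0
  X0 : ∀ t ≤ 0, ∀ ω, X t ω = x
  Xa : ∀ t, StronglyMeasurable[G t] (X t)
  Mdef : ∀ t ω, M t ω = X t ω - x - ∫ r in Ioc 0 t, gbesqDrift β δ r (X r ω)
  Wm : Martingale W G P
  Mm : Martingale M G P
  WW : Martingale (fun t ω => W t ω * W t ω - ∫ _r in Ioc 0 t, (1 : ℝ)) G P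
  MM : Martingale (fun t ω => M t ω * M t ω - ∫ r in Ioc 0 t, besqSigma (X r ω) ^ 2) G P
  MW : Martingale (fun t ω => M t ω * W t ω - ∫ r in Ioc 0 t, besqSigma (X r ω)) G P
  gau : ∀ s t : ℝ, 0 ≤ s → s ≤ t →
    P.map (fun ω => W t ω - W s ω) = gaussianReal 0 (Real.toNNReal (t - s))
  ind : ∀ s t : ℝ, 0 ≤ s → s ≤ t →
    Indep (MeasurableSpace.comap (fun ω => W t ω - W s ω) (borel ℝ)) (G s) P

lemma drift_int {β δ : ℝ → ℝ} (hβ : MemD β) (hδ : MemD δ) {y : ℝ → ℝ} (hy : Continuous y)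
    (T : ℝ) : IntegrableOn (fun r => gbesqDrift β δ r (y r)) (Icc 0 T) := by
  have key : ∀ f : ℝ → ℝ, MemD f → IntegrableOn f (Icc 0 T) := by
    intro f hf
    obtain ⟨C, hC⟩ := hf.2.2.1 T
    refine Measure.integrableOn_of_bounded (M := C) (by simp) hf.1.aestronglyMeasurable ?_
    refine (ae_restrict_iff' measurableSet_Icc).2 (Eventually.of_forall fun r hr => ?_)
    rw [Real.norm_of_nonneg (hf.2.1 r)]
    exact hC r hr
  unfold gbesqDrift
  refine Integrable.add ?_ (key δ hδ)
  have h2 : IntegrableOn (fun r => 2 * β r) (Icc 0 T) := (key β hβ).const_mul 2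
  exact h2.mul_continuousOn hy.continuousOn isCompact_Icc

lemma drift_cont {β δ : ℝ → ℝ} (hβ : MemD β) (hδ : MemD δ) {y : ℝ → ℝ} (hy : Continuous y) :
    Continuous fun t => ∫ r in Ioc 0 t, gbesqDrift β δ r (y r) := by
  set k : ℝ → ℝ := (Ioi 0).indicator fun r => gbesqDrift β δ r (y r) with hk
  have hki : ∀ a b, IntervalIntegrable k volume a b := by
    intro a b
    have : ∀ T, IntegrableOn k (Iic T) := by
      intro T
      rw [hk, integrableOn_indicator_iff measurableSet_Ioi, Ioi_inter_Iic]
      exact (drift_int hβ hδ hy T).mono_set Ioc_subset_Icc_self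
    rw [intervalIntegrable_iff]
    refine (this (max a b)).mono_set ?_
    intro r hr
    exact hr.2
  have h1 := (intervalIntegral.continuous_primitive hki 0).comp
    (continuous_id.max (continuous_const (y := (0:ℝ))))
  convert h1 using 2 with t
  simp only [Function.comp, id]
  rw [intervalIntegral.integral_of_le (le_max_right _ _)]
  have : Ioc 0 (max t 0) = Ioc 0 t := by
    rcases le_total t 0 with h | h
    · simp [h]
    · simp [h]
  rw [this]
  refine setIntegral_congr_fun measurableSet_Ioc fun r hr => ?_
  simp [hk, hr.1]

lemma bm_mart {W : ℝ → Ω → ℝ} (hW : IsBrownianMotion P G W) {s t : ℝ} (hs : 0 ≤ s) (hst : s ≤ t)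
    {A : Set Ω} (hA : MeasurableSet[G s] A) {φ : ℝ → ℝ} (hφ : Measurable φ) :
    ∫ ω in A, φ (W t ω - W s ω) ∂P
      = P.real A * ∫ y, φ y ∂(gaussianReal 0 (Real.toNNReal (t - s))) := by
  have hWm : ∀ r, Measurable (W r) := fun r => (hW.adapted r).mono (G.le r) le_rfl
  have hD : Measurable fun ω => W t ω - W s ω := (hWm t).sub (hWm s)
  have hb : (borel ℝ) = (inferInstance : MeasurableSpace ℝ) := (BorelSpace.measurable_eq).symm
  have hi := hW.indep_increments s t hs hst
  rw [setInt_eq (G.le s A hA)]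
  have hI : IndepFun (A.indicator (fun _ => (1 : ℝ))) (fun ω => φ (W t ω - W s ω)) P := by
    rw [IndepFun_iff_Indep]
    refine indep_of_indep_of_le_left (indep_of_indep_of_le_right hi.symm ?_) ?_
    · rintro _ ⟨B, hB, rfl⟩
      exact ⟨φ ⁻¹' B, by rw [hb]; exact hφ hB, rfl⟩
    · exact ((measurable_const.indicator hA : Measurable[G s] _)).comap_le
  rw [hI.integral_fun_mul_eq_mul_integral
    ((measurable_const.indicator (G.le s A hA)).aestronglyMeasurable)
    ((hφ.comp hD).aestronglyMeasurable)]
  congr 1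
  · rw [integral_indicator_const _ (G.le s A hA)]; simp
  · rw [← hW.gaussian_increments s t hs hst, integral_map hD.aemeasurable
      hφ.aestronglyMeasurable]

lemma bm_memLp {W : ℝ → Ω → ℝ} (hW : IsBrownianMotion P G W) {t : ℝ} (ht : 0 ≤ t) :
    MemLp (W t) 2 P := by
  have hWm : ∀ r, Measurable (W r) := fun r => (hW.adapted r).mono (G.le r) le_rfl
  have hg := hW.gaussian_increments 0 t le_rfl ht
  have e : (fun ω => W t ω - W 0 ω) = W t := by ext ω; simp [hW.start]
  rw [e] at hg
  have h1 : MemLp id 2 (P.map (W t)) := by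
    rw [hg]; exact memLp_id_gaussianReal' 2 (by simp)
  exact (memLp_map_measure_iff h1.1 (hWm t).aemeasurable).1 h1

lemma bm_L2M {W : ℝ → Ω → ℝ} (hW : IsBrownianMotion P G W) :
    L2M P G (fun t => W (max t 0)) ∧ Martingale (fun t => W (max t 0)) G P := by
  have hL : ∀ t, MemLp (W (max t 0)) 2 P := fun t => bm_memLp hW (le_max_right _ _)
  have hM : Martingale (fun t => W (max t 0)) G P := by
    refine martingale_of_weak (fun t => ?_) (fun t => (hL t).integrable (by norm_num))
      (fun t ht => ?_) ?_
    · rcases le_total t 0 with ht | ht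
      · simp only [max_eq_right ht]
        rw [show W 0 = fun _ => 0 from funext hW.start]
        exact stronglyMeasurable_const
      · simp only [max_eq_left ht]
        exact (hW.adapted t).stronglyMeasurable
    · simp only [max_eq_right ht]
      exact Eventually.of_forall hW.start
    · intro s t hs hst A hA
      have hi : ∀ t, Integrable (W (max t 0)) P := fun t => (hL t).integrable (by norm_num)
      have h1 := bm_mart hW hs hst hA (φ := fun y => y) measurable_id
      have h2 : ∫ y, y ∂(gaussianReal 0 (Real.toNNReal (t - s))) = 0 := integral_id_gaussianReal
      rw [h2, mul_zero] at h1
      have hit := hi t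
      have his := hi s
      simp only [max_eq_left hs, max_eq_left (hs.trans hst)] at hit his ⊢
      rw [integral_sub hit.integrableOn his.integrableOn] at h1
      linarith
  exact ⟨L2M.of_martingale hM hL, hM⟩

lemma bm_WW {W : ℝ → Ω → ℝ} (hW : IsBrownianMotion P G W) :
    Martingale (fun t ω => W (max t 0) ω * W (max t 0) ω - ∫ _r in Ioc 0 t, (1 : ℝ)) G P := by
  obtain ⟨hL, hM⟩ := bm_L2M hW
  have e : ∀ t, ∫ _r in Ioc 0 t, (1 : ℝ) = max t 0 := by
    intro t
    rcases le_total t 0 with h | h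
    · simp [Ioc_eq_empty (not_lt.2 h), h]
    · simp [Measure.real, Real.volume_Ioc, h]
  simp only [e]
  have hI : ∀ t, Integrable (fun ω => W (max t 0) ω * W (max t 0) ω) P := fun t =>
    integrable_mul2 (hL.memLp t) (hL.memLp t)
  refine martingale_of_weak (fun t => ((hL.adapted t).mul (hL.adapted t)).sub
    stronglyMeasurable_const) (fun t => (hI t).sub (integrable_const _)) (fun t ht => ?_) ?_
  · simp only [max_eq_right ht, hW.start]
    exact Eventually.of_forall fun ω => by simp
  · intro s t hs hst A hA
    rw [integral_sub (hI t).integrableOn (integrable_const _).integrableOn,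
      integral_sub (hI s).integrableOn (integrable_const _).integrableOn]
    have h1 := bm_mart hW hs hst hA (φ := fun y => y * y) (measurable_id.mul measurable_id)
    have h2 : ∫ y, y * y ∂(gaussianReal 0 (Real.toNNReal (t - s))) = t - s := by
      have h3 := variance_id_gaussianReal (μ := 0) (v := Real.toNNReal (t - s))
      rw [variance_eq_integral measurable_id.aemeasurable] at h3
      simp only [id, integral_id_gaussianReal, sub_zero, pow_two] at h3
      rw [h3, Real.coe_toNNReal _ (sub_nonneg.2 hst)]
    rw [h2] at h1
    have hAm := G.le s A hA
    have hη : StronglyMeasurable[G s] (A.indicator (W (max s 0))) := (hL.adapted s).indicator hA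
    have h4 := hL.mart s t hs hst _ hη ((hL.memLp s).indicator hAm)
    have h5 : ∀ r, ∫ ω, A.indicator (W (max s 0)) ω * W (max r 0) ω ∂P
        = ∫ ω in A, W (max s 0) ω * W (max r 0) ω ∂P := by
      intro r
      rw [← integral_indicator hAm]
      congr 1; ext ω
      by_cases h : ω ∈ A <;> simp [h]
    rw [h5, h5] at h4
    have hc := integrable_mul2 (hL.memLp s) (hL.memLp t)
    have hit := hI t
    have his := hI s
    simp only [max_eq_left hs, max_eq_left (hs.trans hst)] at *
    have h6 : ∫ ω in A, (W t ω - W s ω) * (W t ω - W s ω) ∂P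
        = ∫ ω in A, W t ω * W t ω ∂P - 2 * ∫ ω in A, W s ω * W t ω ∂P
          + ∫ ω in A, W s ω * W s ω ∂P := by
      rw [← integral_const_mul, ← integral_sub hit.integrableOn (hc.integrableOn.const_mul 2),
        ← integral_add (f := fun ω => W t ω * W t ω - 2 * (W s ω * W t ω))
          (hit.integrableOn.sub (hc.integrableOn.const_mul 2)) his.integrableOn]
      congr 1; ext ω; ring
    simp only [setIntegral_const, smul_eq_mul]
    rw [h6] at h1
    linarith

lemma Sol.mk' {W X : ℝ → Ω → ℝ} {β δ : ℝ → ℝ} {x : ℝ} (hβ : MemD β) (hδ : MemD δ)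
    (hW : IsBrownianMotion P G W) (hX : IsGBESQ P G W β δ x X) :
    ∃ M, Sol P G (fun t => W (max t 0)) (fun t => X (max t 0)) M β δ x := by
  set M : ℝ → Ω → ℝ := fun t ω => X t ω - x - ∫ s in Ioc (0 : ℝ) t, gbesqDrift β δ s (X s ω) with hM
  have hM0 : ∀ ω, M 0 ω = 0 := by intro ω; simp [hM, hX.1]
  have cmax : Continuous fun t : ℝ => max t 0 := continuous_id.max continuous_const
  have e1 : ∀ t ω, M (max t 0) ω = X (max t 0) ω - x
      - ∫ r in Ioc 0 t, gbesqDrift β δ r (X (max r 0) ω) := by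
    intro t ω
    simp only [hM]
    rw [int_max (fun s y => gbesqDrift β δ s y) (fun s => X s ω) t]
  refine ⟨fun t => M (max t 0), ⟨fun ω => (hW.cont ω).comp cmax, fun ω => (hX.cont ω).comp cmax, ?_,
    ?_, ?_, ?_, e1, (bm_L2M hW).2, mart_max hX.drift_mart hM0, bm_WW hW, ?_, ?_, ?_, ?_⟩⟩
  · intro ω
    simp only [e1]
    refine (((hX.cont ω).comp cmax).sub continuous_const).sub
      (drift_cont hβ hδ ((hX.cont ω).comp cmax))
  · intro t ht ω; simp only [max_eq_right ht, hW.start]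
  · intro t ht ω; simp only [max_eq_right ht, hX.1]
  · intro t
    rcases le_total t 0 with ht | ht
    · simp only [max_eq_right ht]
      rw [show X 0 = fun _ => x from funext hX.1]
      exact stronglyMeasurable_const
    · simp only [max_eq_left ht]
      exact (hX.adapted t).stronglyMeasurable
  · have := mart_max hX.quad_var (fun ω => by simp [hX.1])
    convert this using 3 with t ω
    rw [int_max (fun _ y => besqSigma y ^ 2) (fun s => X s ω) t, pow_two]
  · have := mart_max hX.driven_by (fun ω => by simp [hX.1])
    convert this using 3 with t ω
    rw [int_max (fun _ y => besqSigma y) (fun s => X s ω) t]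
  · intro s t hs hst
    simp only [max_eq_left hs, max_eq_left (hs.trans hst)]
    exact hW.gaussian_increments s t hs hst
  · intro s t hs hst
    simp only [max_eq_left hs, max_eq_left (hs.trans hst)]
    exact hW.indep_increments s t hs hst

lemma path_eq {W X : ℝ → Ω → ℝ} {β δ : ℝ → ℝ} {x : ℝ} (hX : IsGBESQ P G W β δ x X) :
    ∀ᵐ ω ∂P, ∀ t, X t ω = X (max t 0) ω := by
  have h1 : ∀ q : ℚ, ∀ᵐ ω ∂P, (q : ℝ) ≤ 0 → X q ω = x := by
    intro q
    by_cases hq : (q : ℝ) ≤ 0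
    · have h := hX.drift_mart.2 q 0 hq
      have e0 : (fun t ω => X t ω - x - ∫ s in Ioc (0 : ℝ) t, gbesqDrift β δ s (X s ω)) 0 = 0 := by
        ext ω; simp [hX.1]
      rw [e0, condExp_zero] at h
      filter_upwards [h] with ω hω _
      simp only [Ioc_eq_empty (not_lt.2 hq), Measure.restrict_empty, integral_zero_measure,
        Pi.zero_apply] at hω
      linarith
    · exact Eventually.of_forall fun ω h => absurd h hq
  filter_upwards [ae_all_iff.2 h1] with ω hω t
  rcases le_total t 0 with ht | ht
  · rw [max_eq_right ht, hX.1]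
    have hcl : IsClosed {s | X s ω = x} := isClosed_eq (hX.cont ω) continuous_const
    have hsub : Iio (0:ℝ) ⊆ {s | X s ω = x} := by
      refine (Dense.open_subset_closure_inter Rat.denseRange_cast isOpen_Iio).trans ?_
      refine hcl.closure_subset_iff.2 ?_
      rintro _ ⟨h, q, rfl⟩
      exact hω q (le_of_lt h)
    have := hcl.closure_subset_iff.2 hsub
    rw [closure_Iio] at this
    exact this ht
  · rw [max_eq_left ht]

end
end GB

namespace GB
open Set
set_option linter.unusedSectionVars false

section
variable {Ω : Type*} [m : MeasurableSpace Ω] {P : Measure Ω} [IsProbabilityMeasure P]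
  {G : Filtration ℝ m}

lemma restrict_prod_eq (R : Set ℝ) :
    (volume.prod P).restrict (R ×ˢ (univ : Set Ω)) = (volume.restrict R).prod P := by
  rw [← Measure.prod_restrict, Measure.restrict_univ]

section
variable {W X M : ℝ → Ω → ℝ} {β δ : ℝ → ℝ} {x : ℝ}

lemma Sol.Xmeas (h : Sol P G W X M β δ x) : Measurable fun p : ℝ × Ω => X p.1 p.2 :=
  joint_meas h.Xc fun r => ((h.Xa r).mono (G.le r)).measurable

lemma Sol.Mmeas (h : Sol P G W X M β δ x) : Measurable fun p : ℝ × Ω => M p.1 p.2 :=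
  joint_meas h.Mc fun r => ((h.Mm.1 r).mono (G.le r)).measurable

lemma Sol.M_int (h : Sol P G W X M β δ x) (T : ℝ) :
    IntegrableOn (fun p : ℝ × Ω => M p.1 p.2) (Ioc 0 T ×ˢ univ) (volume.prod P) := by
  rw [IntegrableOn, restrict_prod_eq]
  have hm : AEStronglyMeasurable (fun p : ℝ × Ω => M p.1 p.2) ((volume.restrict (Ioc 0 T)).prod P) :=
    h.Mmeas.aestronglyMeasurable
  rw [integrable_prod_iff hm]
  refine ⟨Eventually.of_forall fun r => h.Mm.integrable r, ?_⟩
  refine Measure.integrableOn_of_bounded (M := ∫ ω, ‖M T ω‖ ∂P) (by simp) ?_ ?_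
  · exact (h.Mmeas.norm.stronglyMeasurable.integral_prod_right').aestronglyMeasurable
  · refine (ae_restrict_iff' measurableSet_Ioc).2 (Eventually.of_forall fun r hr => ?_)
    rw [Real.norm_of_nonneg (integral_nonneg fun _ => norm_nonneg _)]
    have := integral_abs_condExp_le (m := G r) (μ := P) (M T)
    refine le_trans (le_of_eq ?_) this
    refine integral_congr_ae ?_
    filter_upwards [h.Mm.2 r T hr.2] with ω hω
    rw [hω]; rfl

lemma Sol.X_bound (h : Sol P G W X M β δ x) (hβ : MemD β) (hδ : MemD δ) {C D T : ℝ} 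
    (hC0 : 0 ≤ C)
    (hC : ∀ t ∈ Icc 0 T, β t ≤ C) (hD : ∀ t ∈ Icc 0 T, δ t ≤ D) (hT : 0 ≤ T) (hD0 : 0 ≤ D) (ω : Ω) :
    ∫ r in 0..T, |X r ω| ≤ Real.exp (2 * C * (T - 0)) * ∫ r in 0..T, (|x| + |M r ω| + D * T) := by
  refine gron (h.Xc ω).abs ((continuous_const.add (h.Mc ω).abs).add continuous_const)
    (by linarith) hT (fun t => by
      show 0 ≤ |x| + |M t ω| + D * T
      positivity) ?_
  intro t ht
  show |X t ω| ≤ |x| + |M t ω| + D * T + _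
  have e := h.Mdef t ω
  have hXi : IntegrableOn (fun r => |X r ω|) (Ioc 0 t) :=
    ((h.Xc ω).abs.integrableOn_Icc).mono_set Ioc_subset_Icc_self
  have hb : |∫ r in Ioc 0 t, gbesqDrift β δ r (X r ω)| ≤ ∫ r in Ioc 0 t, (2 * C * |X r ω| + D) := by
    refine abs_integral_le_integral_abs.trans ?_
    refine setIntegral_mono_on
      ((drift_int hβ hδ (h.Xc ω) t).mono_set Ioc_subset_Icc_self).abs
      ((hXi.const_mul _).add (by simp)) measurableSet_Ioc ?_
    intro r hr
    have hr' : r ∈ Icc 0 T := ⟨hr.1.le, hr.2.trans ht.2⟩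
    simp only [gbesqDrift]
    refine (abs_add_le _ _).trans ?_
    rw [abs_mul, abs_of_nonneg (hδ.2.1 r), abs_of_nonneg (by linarith [hβ.2.1 r] : 0 ≤ 2 * β r)]
    have := mul_le_mul_of_nonneg_right (hC r hr') (abs_nonneg (X r ω))
    linarith [hD r hr']
  rw [integral_add (hXi.const_mul _) (by simp), integral_const_mul] at hb
  simp only [setIntegral_const, Measure.real, Real.volume_Ioc, smul_eq_mul, sub_zero,
    ENNReal.toReal_ofReal ht.1] at hb
  rw [intervalIntegral.integral_of_le ht.1]
  have h1 : |X t ω| ≤ |x| + |M t ω| + |∫ r in Ioc 0 t, gbesqDrift β δ r (X r ω)| := by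
    have : X t ω = x + M t ω + ∫ r in Ioc 0 t, gbesqDrift β δ r (X r ω) := by rw [e]; ring
    rw [this]
    exact (abs_add_le _ _).trans (by gcongr; exact abs_add_le _ _)
  have h2 : t * D ≤ D * T := by nlinarith [ht.2]
  linarith

lemma Sol.X_int (h : Sol P G W X M β δ x) (hβ : MemD β) (hδ : MemD δ) (T : ℝ) :
    IntegrableOn (fun p : ℝ × Ω => X p.1 p.2) (Ioc 0 T ×ˢ univ) (volume.prod P) := by
  rcases lt_or_ge T 0 with hT | hT
  · simp [Ioc_eq_empty (not_lt.2 hT.le)]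
  obtain ⟨C, hC⟩ := hβ.2.2.1 T
  obtain ⟨D, hD⟩ := hδ.2.2.1 T
  have hC0 : 0 ≤ C := (hβ.2.1 0).trans (hC 0 ⟨le_rfl, hT⟩)
  have hD0 : 0 ≤ D := (hδ.2.1 0).trans (hD 0 ⟨le_rfl, hT⟩)
  have hMi := h.M_int T
  rw [IntegrableOn, restrict_prod_eq] at hMi ⊢
  rw [integrable_prod_iff' h.Xmeas.aestronglyMeasurable]
  refine ⟨Eventually.of_forall fun ω =>
    ((h.Xc ω).integrableOn_Icc).mono_set Ioc_subset_Icc_self, ?_⟩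
  have hg : Integrable (fun p : ℝ × Ω => |x| + |M p.1 p.2| + D * T)
      ((volume.restrict (Ioc 0 T)).prod P) :=
    ((integrable_const _).add hMi.abs).add (integrable_const _)
  refine (hg.integral_prod_right.const_mul (Real.exp (2 * C * (T - 0)))).mono' ?_ ?_
  · exact (h.Xmeas.norm.stronglyMeasurable.integral_prod_left').aestronglyMeasurable
  · refine Eventually.of_forall fun ω => ?_
    rw [Real.norm_of_nonneg (integral_nonneg fun _ => norm_nonneg _)]
    have := h.X_bound hβ hδ hC0 hC hD hT hD0 ω
    rw [intervalIntegral.integral_of_le hT, intervalIntegral.integral_of_le hT] at this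
    exact this

lemma sigma_cont : Continuous besqSigma := continuous_const.mul Real.continuous_sqrt

lemma sigma_sq (y : ℝ) : besqSigma y ^ 2 = 4 * max y 0 := by
  unfold besqSigma
  rw [mul_pow]
  rcases le_total y 0 with h | h
  · rw [Real.sqrt_eq_zero_of_nonpos h, max_eq_right h]; norm_num
  · rw [Real.sq_sqrt h, max_eq_left h]; norm_num

lemma Sol.sq_int (h : Sol P G W X M β δ x) (hβ : MemD β) (hδ : MemD δ) (T : ℝ) :
    IntegrableOn (fun p : ℝ × Ω => besqSigma (X p.1 p.2) ^ 2) (Ioc 0 T ×ˢ univ)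
      (volume.prod P) := by
  refine ((h.X_int hβ hδ T).norm.const_mul 4).mono' ?_ ?_
  · exact ((sigma_cont.measurable.comp h.Xmeas).pow_const 2).aestronglyMeasurable
  · refine Eventually.of_forall fun p => ?_
    rw [Real.norm_of_nonneg (sq_nonneg _), sigma_sq]
    have : max (X p.1 p.2) 0 ≤ ‖X p.1 p.2‖ := max_le (le_abs_self _) (abs_nonneg _)
    linarith

lemma int_of_sq {f : ℝ × Ω → ℝ} {T : ℝ} (hf : Measurable f)
    (h : IntegrableOn (fun p => f p ^ 2) (Ioc 0 T ×ˢ univ) (volume.prod P)) :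
    IntegrableOn f (Ioc 0 T ×ˢ univ) (volume.prod P) := by
  have h1 : IntegrableOn (fun _ : ℝ × Ω => (1:ℝ)) (Ioc 0 T ×ˢ univ) (volume.prod P) := by
    rw [IntegrableOn, restrict_prod_eq]
    exact integrable_const _
  refine (h1.add h).mono' hf.aestronglyMeasurable (Eventually.of_forall fun p => ?_)
  simp only [Pi.add_apply, Real.norm_eq_abs]
  rw [← sq_abs (f p)]
  nlinarith [sq_nonneg (|f p| - 1), abs_nonneg (f p)]

lemma Sol.ML2 (h : Sol P G W X M β δ x) (hβ : MemD β) (hδ : MemD δ) : L2M P G M := by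
  refine L2M.of_martingale h.Mm fun t => ?_
  rw [memLp_two_iff_integrable_sq (sm (h.Mm.1 t))]
  have := (h.MM.integrable t).add (path_int (c := fun r ω => besqSigma (X r ω) ^ 2) (h.sq_int hβ hδ t)).1
  refine this.congr (Eventually.of_forall fun ω => ?_)
  simp [pow_two]

lemma Sol.WL2 (h : Sol P G W X M β δ x) : L2M P G W := by
  refine L2M.of_martingale h.Wm fun t => ?_
  rw [memLp_two_iff_integrable_sq (sm (h.Wm.1 t))]
  have := (h.WW.integrable t).add (integrable_const (∫ _r in Ioc 0 t, (1:ℝ)))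
  refine this.congr (Eventually.of_forall fun ω => ?_)
  simp [pow_two]

lemma Sol.cMM (h : Sol P G W X M β δ x) (hβ : MemD β) (hδ : MemD δ) :
    Cov P G M M (fun r ω => besqSigma (X r ω) ^ 2) :=
  Cov.of_martingale (h.ML2 hβ hδ) (h.ML2 hβ hδ) (h.sq_int hβ hδ) h.MM

/-- Weight-free form of the covariation. -/
lemma Cov.eq0 {N N' c : ℝ → Ω → ℝ} (h : Cov P G N N' c) (h0 : ∀ ω, N 0 ω = 0) {t : ℝ}
    (ht : 0 ≤ t) :
    ∫ ω, N t ω * N' t ω ∂P = ∫ p in Ioc 0 t ×ˢ univ, c p.1 p.2 ∂(volume.prod P) := by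
  have := h.eq 0 t le_rfl ht (fun _ => 1) stronglyMeasurable_const ⟨1, by simp⟩
  simpa [h0] using this

lemma Sol.const_neg (h : Sol P G W X M β δ x) (hβ : MemD β) (hδ : MemD δ) {q T : ℝ} (hq : 0 ≤ q)
    (hqT : q ≤ T) : ∀ᵐ ω ∂P, (∀ r ∈ Icc q T, X r ω < 0) → M T ω = M q ω := by
  set a : ℝ → Ω → ℝ := fun r => {ω | X r ω < 0}.indicator fun _ => 1 with ha
  have haA : ∀ r, MeasurableSet[G r] {ω | X r ω < 0} := fun r =>
    (h.Xa r).measurable measurableSet_Iio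
  have ham : ∀ r, StronglyMeasurable[G r] (a r) := fun r =>
    stronglyMeasurable_const.indicator (haA r)
  have hab : ∀ r ω, |a r ω| ≤ 1 := by
    intro r ω
    simp only [ha, indicator]
    split_ifs <;> simp
  have hL := h.ML2 hβ hδ
  have hS := fun n => L2M.SI hq hqT n hL ham hab
  have hc1 := fun n => Cov.SI hq hqT n hL hL (h.cMM hβ hδ) ham hab
  have hc2 := fun n => Cov.SI hq hqT n hL (hS n) (hc1 n).symm ham hab
  have hT : 0 ≤ T := hq.trans hqT
  have e := fun n => (hc2 n).eq0 (fun ω => SI_zero hqT n hq ω) hT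
  have hlim : Tendsto (fun n => ∫ p in Ioc 0 T ×ˢ univ, (SA q T n a p.1 p.2
      * (SA q T n a p.1 p.2 * besqSigma (X p.1 p.2) ^ 2)) ∂(volume.prod P)) atTop
      (nhds (∫ p in Ioc 0 T ×ˢ univ, (0:ℝ) ∂((volume : Measure ℝ).prod P))) := by
    refine tendsto_integral_of_dominated_convergence (fun p => besqSigma (X p.1 p.2) ^ 2) ?_
      (h.sq_int hβ hδ T) ?_ ?_
    · intro n
      have h1 := SA_measurable (q := q) (T := T) n (fun r => ((ham r).mono (G.le r)).measurable)
      exact (h1.mul (h1.mul ((sigma_cont.measurable.comp h.Xmeas).pow_const 2))).aestronglyMeasurable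
    · intro n
      refine Eventually.of_forall fun p => ?_
      have h1 := SA_bdd hqT n zero_le_one hab p.1 p.2
      rw [← mul_assoc, norm_mul, Real.norm_of_nonneg (sq_nonneg (besqSigma _)), norm_mul]
      refine mul_le_of_le_one_left (sq_nonneg _) ?_
      exact mul_le_one₀ h1 (abs_nonneg _) h1
    · refine Eventually.of_forall fun p => ?_
      rcases le_or_gt (X p.1 p.2) 0 with hX | hX
      · simp [sigma_sq, max_eq_right hX]
      · by_cases hr : p.1 ∈ Ioc q T
        · refine tendsto_const_nhds.congr' ?_
          have h1 : ∀ᶠ s in nhds p.1, 0 < X s p.2 :=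
            (h.Xc p.2).continuousAt.eventually_const_lt hX
          obtain ⟨ε, hε, h2⟩ := Metric.eventually_nhds_iff.1 h1
          have h3 : Tendsto (fun n : ℕ => (T - q) / ((n : ℝ) + 1)) atTop (nhds 0) :=
            tendsto_const_nhds.div_atTop
              (tendsto_atTop_add_const_right _ _ tendsto_natCast_atTop_atTop)
          filter_upwards [h3.eventually_lt_const hε] with n hn
          obtain ⟨i, _, hi, hSA⟩ := SA_cell hr n a
          have h4 := h2 (y := grid q T n i) (lt_of_le_of_lt hi hn)
          rw [hSA]
          simp [ha, not_lt.2 h4.le]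
        · simp [SA_out hqT hr]
  simp only [integral_zero] at hlim
  rw [tendsto_congr (fun n => (e n).symm)] at hlim
  have hSm : ∀ n, Measurable (SI q T n a M T) := fun n =>
    (((hS n).adapted T).mono (G.le T)).measurable
  set f : Ω → ENNReal := fun ω => ⨅ n, ENNReal.ofReal (SI q T n a M T ω * SI q T n a M T ω) with hf
  have hfm : Measurable f := Measurable.iInf fun n => ((hSm n).mul (hSm n)).ennreal_ofReal
  have hlim' := ENNReal.tendsto_ofReal hlim
  rw [ENNReal.ofReal_zero] at hlim'
  have hf0 : ∫⁻ ω, f ω ∂P = 0 := by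
    refine le_antisymm (ge_of_tendsto' hlim' fun n => ?_) bot_le
    rw [ofReal_integral_eq_lintegral_ofReal (integrable_mul2 ((hS n).memLp T) ((hS n).memLp T))
      (Eventually.of_forall fun ω => mul_self_nonneg _)]
    exact lintegral_mono fun ω => iInf_le _ n
  rw [lintegral_eq_zero_iff hfm] at hf0
  filter_upwards [hf0] with ω hω hneg
  have h1 : ∀ n, SI q T n a M T ω = M T ω - M q ω := fun n =>
    SI_const hqT n (fun r hr => by simp [ha, hneg r hr])
  simp only [hf, h1, ciInf_const, Pi.zero_apply, ENNReal.ofReal_eq_zero] at hω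
  have : M T ω - M q ω = 0 := by
    have := mul_self_nonneg (M T ω - M q ω)
    exact mul_self_eq_zero.1 (le_antisymm hω this)
  linarith

lemma path_pos {X M β δ : ℝ → ℝ} {x : ℝ} (hβ : MemD β) (hδ : MemD δ) (hx : 0 ≤ x)
    (hX : Continuous X) (hM : Continuous M) (hX0 : X 0 = x)
    (hdef : ∀ t, M t = X t - x - ∫ r in Ioc 0 t, gbesqDrift β δ r (X r))
    (h : ∀ q T : ℚ, 0 ≤ (q : ℝ) → (q : ℝ) ≤ T → (∀ r ∈ Icc (q : ℝ) T, X r < 0) → M T = M q)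
    {t : ℝ} (ht : 0 ≤ t) : 0 ≤ X t := by
  by_contra! hneg
  set E := {s | s ∈ Icc 0 t ∧ 0 ≤ X s} with hE
  have hEc : IsClosed E := isClosed_Icc.inter (isClosed_le continuous_const hX)
  have hEn : E.Nonempty := ⟨0, ⟨le_rfl, ht⟩, by rw [hX0]; exact hx⟩
  have hEb : BddAbove E := ⟨t, fun s hs => hs.1.2⟩
  set τ := sSup E with hτ
  have hτE : τ ∈ E := hEc.csSup_mem hEn hEb
  have hτt : τ < t := by
    refine lt_of_le_of_ne hτE.1.2 fun h => ?_
    rw [h] at hτE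
    exact absurd hτE.2 (not_le.2 hneg)
  have hlt : ∀ s ∈ Ioc τ t, X s < 0 := by
    intro s hs
    by_contra! hc
    exact absurd (le_csSup hEb (show s ∈ E from ⟨⟨hτE.1.1.trans hs.1.le, hs.2⟩, hc⟩))
      (not_le.2 hs.1)
  obtain ⟨r0, hr0, hr0'⟩ := exists_rat_btwn hτt
  have hcl : IsClosed {s | M s = M r0} := isClosed_eq hM continuous_const
  have hsub : Icc τ t ⊆ {s | M s = M r0} := by
    rw [← closure_Ioo hτt.ne]
    refine hcl.closure_subset_iff.2 ?_
    refine (Dense.open_subset_closure_inter Rat.denseRange_cast isOpen_Ioo).trans ?_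
    refine hcl.closure_subset_iff.2 ?_
    rintro _ ⟨hq, q, rfl⟩
    rcases le_total (q : ℝ) r0 with hle | hle
    · refine (h q r0 (hτE.1.1.trans hq.1.le) hle fun r hr => hlt r ⟨?_, ?_⟩).symm
      · exact lt_of_lt_of_le hq.1 hr.1
      · exact hr.2.trans hr0'.le
    · refine h r0 q (hτE.1.1.trans hr0.le) hle fun r hr => hlt r ⟨?_, ?_⟩
      · exact lt_of_lt_of_le hr0 hr.1
      · exact hr.2.trans hq.2.le
  obtain ⟨C, hC⟩ := hβ.2.2.1 t
  have hC0 : 0 ≤ C := (hβ.2.1 0).trans (hC 0 ⟨le_rfl, ht⟩)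
  have key : ∀ s ∈ Icc τ t, -X s ≤ 0 + 2 * C * ∫ r in τ..s, - X r := by
    intro s hs
    have e1 := hdef s
    have e2 := hdef τ
    rw [hsub hs] at e1
    rw [hsub (left_mem_Icc.2 hτt.le)] at e2
    have di := fun T => (drift_int hβ hδ hX T).mono_set (Ioc_subset_Icc_self)
    rw [← Ioc_union_Ioc_eq_Ioc hτE.1.1 hs.1, setIntegral_union (Ioc_disjoint_Ioc_of_le le_rfl)
      measurableSet_Ioc (di τ) ((di s).mono_set (Ioc_subset_Ioc_left hτE.1.1))] at e1
    have hle : ∫ r in Ioc τ s, (2 * C * X r) ≤ ∫ r in Ioc τ s, gbesqDrift β δ r (X r) := by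
      refine setIntegral_mono_on ?_ ((di s).mono_set (Ioc_subset_Ioc_left hτE.1.1))
        measurableSet_Ioc ?_
      · exact ((continuous_const.mul hX).integrableOn_Icc).mono_set Ioc_subset_Icc_self
      · intro r hr
        have h1 := hlt r ⟨hr.1, hr.2.trans hs.2⟩
        have h2 := hC r ⟨hτE.1.1.trans hr.1.le, hr.2.trans hs.2⟩
        have h3 := hδ.2.1 r
        simp only [gbesqDrift]
        nlinarith
    rw [integral_const_mul] at hle
    rw [intervalIntegral.integral_neg, intervalIntegral.integral_of_le hs.1]
    linarith [hτE.2]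
  have hg := gron hX.neg (g := fun _ => 0) continuous_const (by linarith) hτt.le
    (fun _ => le_rfl) key
  simp only [intervalIntegral.integral_zero, mul_zero] at hg
  have hpos : 0 < ∫ r in τ..t, - X r := by
    refine intervalIntegral.intervalIntegral_pos_of_pos_on (hX.neg.intervalIntegrable _ _) ?_ hτt
    intro r hr
    linarith [hlt r ⟨hr.1, hr.2.le⟩]
  exact absurd hg (not_le.2 hpos)

lemma Sol.pos (h : Sol P G W X M β δ x) (hβ : MemD β) (hδ : MemD δ) (hx : 0 ≤ x) :
    ∀ᵐ ω ∂P, ∀ t, 0 ≤ X t ω := by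
  have h1 : ∀ q T : ℚ, ∀ᵐ ω ∂P, 0 ≤ (q : ℝ) → (q : ℝ) ≤ T → (∀ r ∈ Icc (q : ℝ) T, X r ω < 0) →
      M T ω = M q ω := by
    intro q T
    by_cases hq : 0 ≤ (q : ℝ)
    · by_cases hT : (q : ℝ) ≤ T
      · filter_upwards [h.const_neg hβ hδ hq hT] with ω hω _ _ using hω
      · exact Eventually.of_forall fun ω _ h => absurd h hT
    · exact Eventually.of_forall fun ω h => absurd h hq
  filter_upwards [ae_all_iff.2 fun q => ae_all_iff.2 (h1 q)] with ω hω t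
  rcases le_total t 0 with ht | ht
  · rw [h.X0 t ht]; exact hx
  · exact path_pos hβ hδ hx (h.Xc ω) (h.Mc ω) (h.X0 0 le_rfl ω) (fun t => h.Mdef t ω) hω ht

end
end
end GB

namespace GB
open Set
set_option linter.unusedSectionVars false

section
variable {Ω₁ Ω₂ : Type*} [m₁ : MeasurableSpace Ω₁] [m₂ : MeasurableSpace Ω₂]
  {P₁ : Measure Ω₁} {P₂ : Measure Ω₂} [IsProbabilityMeasure P₁] [IsProbabilityMeasure P₂]
  {F₁ : Filtration ℝ m₁} {F₂ : Filtration ℝ m₂}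

lemma prod_mono_ms {a b : MeasurableSpace Ω₁} {c d : MeasurableSpace Ω₂} (h : a ≤ b) (h' : c ≤ d) :
    a.prod c ≤ b.prod d :=
  sup_le_sup (MeasurableSpace.comap_mono h) (MeasurableSpace.comap_mono h')

/-- The augmented product filtration. -/
def PF (P₁ : Measure Ω₁) (P₂ : Measure Ω₂) (F₁ : Filtration ℝ m₁) (F₂ : Filtration ℝ m₂) :
    Filtration ℝ (m₁.prod m₂) where
  seq t := (m₁.prod m₂) ⊓ eventuallyMeasurableSpace ((F₁ t).prod (F₂ t)) (ae (P₁.prod P₂))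
  mono' := by
    intro s t hst A hA
    obtain ⟨h1, B, hB, hAB⟩ := hA
    exact ⟨h1, B, prod_mono_ms (F₁.mono hst) (F₂.mono hst) B hB, hAB⟩
  le' := fun t => inf_le_left

lemma PF_iff {t : ℝ} {A : Set (Ω₁ × Ω₂)} : MeasurableSet[PF P₁ P₂ F₁ F₂ t] A ↔
    MeasurableSet A ∧ ∃ B, MeasurableSet[(F₁ t).prod (F₂ t)] B ∧ A =ᵐ[P₁.prod P₂] B := Iff.rfl

lemma prod_le_PF (t : ℝ) : (F₁ t).prod (F₂ t) ≤ PF P₁ P₂ F₁ F₂ t := by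
  intro A hA
  exact ⟨prod_mono_ms (F₁.le t) (F₂.le t) A hA, A, hA, ae_eq_rfl⟩

lemma PF_null {t : ℝ} {A : Set (Ω₁ × Ω₂)} (hA : MeasurableSet A) (h0 : ∀ᵐ p ∂(P₁.prod P₂), p ∈ A) :
    MeasurableSet[PF P₁ P₂ F₁ F₂ t] A :=
  ⟨hA, univ, MeasurableSet.univ, eventuallyEq_univ.2 h0⟩

lemma lift_fst {t : ℝ} {f : Ω₁ → ℝ} (hf : StronglyMeasurable[F₁ t] f) :
    StronglyMeasurable[PF P₁ P₂ F₁ F₂ t] (fun p : Ω₁ × Ω₂ => f p.1) := by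
  refine StronglyMeasurable.mono ?_ (prod_le_PF t)
  exact hf.comp_measurable (@measurable_fst Ω₁ Ω₂ (F₁ t) (F₂ t))

lemma lift_snd {t : ℝ} {f : Ω₂ → ℝ} (hf : StronglyMeasurable[F₂ t] f) :
    StronglyMeasurable[PF P₁ P₂ F₁ F₂ t] (fun p : Ω₁ × Ω₂ => f p.2) := by
  refine StronglyMeasurable.mono ?_ (prod_le_PF t)
  exact hf.comp_measurable (@measurable_snd Ω₁ Ω₂ (F₁ t) (F₂ t))

lemma sect1 {s t : ℝ} (hst : s ≤ t) {N : ℝ → Ω₁ → ℝ} (hN : Martingale N F₁ P₁) {g : Ω₂ → ℝ}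
    (hg : Integrable g P₂) {B : Set (Ω₁ × Ω₂)} (hB : MeasurableSet[(F₁ s).prod (F₂ s)] B) :
    ∫ p in B, N t p.1 * g p.2 ∂(P₁.prod P₂) = ∫ p in B, N s p.1 * g p.2 ∂(P₁.prod P₂) := by
  have hBm : MeasurableSet B := prod_mono_ms (F₁.le s) (F₂.le s) B hB
  rw [← integral_indicator hBm, ← integral_indicator hBm,
    integral_prod_symm _ (((hN.integrable t).mul_prod hg).indicator hBm),
    integral_prod_symm _ (((hN.integrable s).mul_prod hg).indicator hBm)]
  congr 1
  ext ω'
  have hA : MeasurableSet[F₁ s] ((fun ω => (ω, ω')) ⁻¹' B) :=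
    (@measurable_prodMk_right Ω₁ Ω₂ (F₁ s) (F₂ s) ω') hB
  have e : ∀ r, ∫ ω, B.indicator (fun p : Ω₁ × Ω₂ => N r p.1 * g p.2) (ω, ω') ∂P₁
      = (∫ ω in ((fun ω => (ω, ω')) ⁻¹' B), N r ω ∂P₁) * g ω' := by
    intro r
    rw [← integral_mul_const, ← integral_indicator (F₁.le s _ hA)]
    congr 1
  rw [e, e, hN.setIntegral_eq hst hA]

lemma sect2 {s t : ℝ} (hst : s ≤ t) {N : ℝ → Ω₂ → ℝ} (hN : Martingale N F₂ P₂) {g : Ω₁ → ℝ}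
    (hg : Integrable g P₁) {B : Set (Ω₁ × Ω₂)} (hB : MeasurableSet[(F₁ s).prod (F₂ s)] B) :
    ∫ p in B, g p.1 * N t p.2 ∂(P₁.prod P₂) = ∫ p in B, g p.1 * N s p.2 ∂(P₁.prod P₂) := by
  have hBm : MeasurableSet B := prod_mono_ms (F₁.le s) (F₂.le s) B hB
  rw [← integral_indicator hBm, ← integral_indicator hBm,
    integral_prod _ ((hg.mul_prod (hN.integrable t)).indicator hBm),
    integral_prod _ ((hg.mul_prod (hN.integrable s)).indicator hBm)]
  congr 1
  ext ω
  have hA : MeasurableSet[F₂ s] ((fun ω' => (ω, ω')) ⁻¹' B) :=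
    (@measurable_prodMk_left Ω₁ Ω₂ (F₁ s) (F₂ s) ω) hB
  have e : ∀ r, ∫ ω', B.indicator (fun p : Ω₁ × Ω₂ => g p.1 * N r p.2) (ω, ω') ∂P₂
      = g ω * (∫ ω' in ((fun ω' => (ω, ω')) ⁻¹' B), N r ω' ∂P₂) := by
    intro r
    rw [← integral_const_mul, ← integral_indicator (F₂.le s _ hA)]
    congr 1
  rw [e, e, hN.setIntegral_eq hst hA]

lemma lift_mart {N : ℝ → Ω₁ → ℝ} {N' : ℝ → Ω₂ → ℝ} (h : Martingale N F₁ P₁)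
    (h' : Martingale N' F₂ P₂) :
    Martingale (fun t (p : Ω₁ × Ω₂) => N t p.1 * N' t p.2) (PF P₁ P₂ F₁ F₂) (P₁.prod P₂) := by
  have hi : ∀ t, Integrable (fun p : Ω₁ × Ω₂ => N t p.1 * N' t p.2) (P₁.prod P₂) := fun t =>
    (h.integrable t).mul_prod (h'.integrable t)
  have ha : ∀ t, StronglyMeasurable[PF P₁ P₂ F₁ F₂ t]
      (fun p : Ω₁ × Ω₂ => N t p.1 * N' t p.2) := fun t => (lift_fst (h.1 t)).mul (lift_snd (h'.1 t))
  refine ⟨ha, fun s t hst => ?_⟩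
  symm
  refine ae_eq_condExp_of_forall_setIntegral_eq ((PF P₁ P₂ F₁ F₂).le s) (hi t)
    (fun A _ _ => (hi s).integrableOn) (fun A hA _ => ?_) (ha s).aestronglyMeasurable
  obtain ⟨h1, B, hB, hAB⟩ := hA
  rw [setIntegral_congr_set hAB, setIntegral_congr_set hAB,
    sect1 hst h (h'.integrable t) hB, sect2 hst h' (h.integrable s) hB]

lemma mart_one : Martingale (fun _ _ => (1:ℝ)) F₁ P₁ := martingale_const _ _ _

lemma lift_mart1 {N : ℝ → Ω₁ → ℝ} (h : Martingale N F₁ P₁) :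
    Martingale (fun t (p : Ω₁ × Ω₂) => N t p.1) (PF P₁ P₂ F₁ F₂) (P₁.prod P₂) := by
  simpa using lift_mart h (mart_one (P₁ := P₂) (F₁ := F₂))

lemma lift_mart2 {N : ℝ → Ω₂ → ℝ} (h : Martingale N F₂ P₂) :
    Martingale (fun t (p : Ω₁ × Ω₂) => N t p.2) (PF P₁ P₂ F₁ F₂) (P₁.prod P₂) := by
  simpa using lift_mart (mart_one (P₁ := P₁) (F₁ := F₁)) h

lemma lift_int1 {c : ℝ → Ω₁ → ℝ} {T : ℝ}
    (h : IntegrableOn (fun p : ℝ × Ω₁ => c p.1 p.2) (Ioc 0 T ×ˢ univ) (volume.prod P₁)) :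
    IntegrableOn (fun p : ℝ × (Ω₁ × Ω₂) => c p.1 p.2.1) (Ioc 0 T ×ˢ univ)
      (volume.prod (P₁.prod P₂)) := by
  rw [IntegrableOn, restrict_prod_eq] at *
  have h1 : MeasurePreserving (Prod.map id Prod.fst) ((volume.restrict (Ioc 0 T)).prod (P₁.prod P₂))
    ((volume.restrict (Ioc (0:ℝ) T)).prod P₁) :=
    (MeasurePreserving.id _).prod measurePreserving_fst
  exact h1.integrable_comp_of_integrable h

lemma lift_int2 {c : ℝ → Ω₂ → ℝ} {T : ℝ}
    (h : IntegrableOn (fun p : ℝ × Ω₂ => c p.1 p.2) (Ioc 0 T ×ˢ univ) (volume.prod P₂)) :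
    IntegrableOn (fun p : ℝ × (Ω₁ × Ω₂) => c p.1 p.2.2) (Ioc 0 T ×ˢ univ)
      (volume.prod (P₁.prod P₂)) := by
  rw [IntegrableOn, restrict_prod_eq] at *
  have h1 : MeasurePreserving (Prod.map id Prod.snd) ((volume.restrict (Ioc 0 T)).prod (P₁.prod P₂))
    ((volume.restrict (Ioc (0:ℝ) T)).prod P₂) :=
    (MeasurePreserving.id _).prod measurePreserving_snd
  exact h1.integrable_comp_of_integrable h

lemma lift_L2M1 {N : ℝ → Ω₁ → ℝ} (h : Martingale N F₁ P₁) (h2 : ∀ t, MemLp (N t) 2 P₁) :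
    L2M (P₁.prod P₂) (PF P₁ P₂ F₁ F₂) (fun t (p : Ω₁ × Ω₂) => N t p.1) :=
  L2M.of_martingale (lift_mart1 h) fun t => (h2 t).comp_measurePreserving measurePreserving_fst

lemma lift_L2M2 {N : ℝ → Ω₂ → ℝ} (h : Martingale N F₂ P₂) (h2 : ∀ t, MemLp (N t) 2 P₂) :
    L2M (P₁.prod P₂) (PF P₁ P₂ F₁ F₂) (fun t (p : Ω₁ × Ω₂) => N t p.2) :=
  L2M.of_martingale (lift_mart2 h) fun t => (h2 t).comp_measurePreserving measurePreserving_snd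

lemma lift_cov0 {N : ℝ → Ω₁ → ℝ} (h : Martingale N F₁ P₁) (h2 : ∀ t, MemLp (N t) 2 P₁)
    {N' : ℝ → Ω₂ → ℝ} (h' : Martingale N' F₂ P₂) (h2' : ∀ t, MemLp (N' t) 2 P₂) :
    Cov (P₁.prod P₂) (PF P₁ P₂ F₁ F₂) (fun t (p : Ω₁ × Ω₂) => N t p.1)
      (fun t (p : Ω₁ × Ω₂) => N' t p.2) (fun _ _ => 0) := by
  refine Cov.of_martingale (lift_L2M1 h h2) (lift_L2M2 h' h2') (fun T => by simp) ?_
  simpa using lift_mart h h'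

/-- increments of independent Brownian motions -/
lemma indep_incr {s t : ℝ} {D₁ : Ω₁ → ℝ} {D₂ : Ω₂ → ℝ} (hD₁ : Measurable D₁) (hD₂ : Measurable D₂)
    (h₁ : Indep (MeasurableSpace.comap D₁ (borel ℝ)) (F₁ s) P₁)
    (h₂ : Indep (MeasurableSpace.comap D₂ (borel ℝ)) (F₂ s) P₂) :
    Indep (PF P₁ P₂ F₁ F₂ s)
      (MeasurableSpace.comap (fun p : Ω₁ × Ω₂ => (D₁ p.1, D₂ p.2)) inferInstance)
      (P₁.prod P₂) := by
  have hb : (borel ℝ) = (inferInstance : MeasurableSpace ℝ) := (BorelSpace.measurable_eq).symm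
  have hD : Measurable (fun p : Ω₁ × Ω₂ => (D₁ p.1, D₂ p.2)) :=
    (hD₁.comp measurable_fst).prodMk (hD₂.comp measurable_snd)
  have key : Indep ((F₁ s).prod (F₂ s))
      (MeasurableSpace.comap (fun p : Ω₁ × Ω₂ => (D₁ p.1, D₂ p.2)) inferInstance)
      (P₁.prod P₂) := by
    refine IndepSets.indep (prod_mono_ms (F₁.le s) (F₂.le s)) hD.comap_le
      (@isPiSystem_prod Ω₁ Ω₂ (F₁ s) (F₂ s))
      ((isPiSystem_prod (α := ℝ) (β := ℝ)).comap (fun p : Ω₁ × Ω₂ => (D₁ p.1, D₂ p.2)))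
      (@generateFrom_prod Ω₁ Ω₂ (F₁ s) (F₂ s)).symm ?_ ?_
    · rw [← generateFrom_prod, MeasurableSpace.comap_generateFrom]
      rfl
    · rw [IndepSets_iff]
      rintro _ _ ⟨A₁, hA₁, A₂, hA₂, rfl⟩ ⟨_, ⟨C₁, hC₁, C₂, hC₂, rfl⟩, rfl⟩
      have e : (fun p : Ω₁ × Ω₂ => (D₁ p.1, D₂ p.2)) ⁻¹' (C₁ ×ˢ C₂)
          = (D₁ ⁻¹' C₁) ×ˢ (D₂ ⁻¹' C₂) := rfl
      rw [e, prod_inter_prod, Measure.prod_prod, Measure.prod_prod, Measure.prod_prod]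
      have i₁ := (Indep_iff _ _ _).1 h₁ (D₁ ⁻¹' C₁) A₁ ⟨C₁, by rw [hb]; exact hC₁, rfl⟩ hA₁
      have i₂ := (Indep_iff _ _ _).1 h₂ (D₂ ⁻¹' C₂) A₂ ⟨C₂, by rw [hb]; exact hC₂, rfl⟩ hA₂
      rw [inter_comm A₁, inter_comm A₂, i₁, i₂]
      ring
  rw [Indep_iff] at key ⊢
  rintro A C ⟨_, B, hB, hAB⟩ hC
  rw [measure_congr hAB, measure_congr (hAB.inter (ae_eq_refl C)), key B C hB hC]

lemma gauss_int (v : NNReal) (a : ℝ) :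
    ∫ y, Complex.exp ((a * y : ℝ) * Complex.I) ∂(gaussianReal 0 v)
      = Complex.exp ((-(a ^ 2 * v / 2) : ℝ)) := by
  have := charFun_gaussianReal (μ := 0) (v := v) a
  rw [charFun_apply_real] at this
  push_cast
  rw [this]
  congr 1
  push_cast
  ring

lemma Rot_prod {W₁ : ℝ → Ω₁ → ℝ} {W₂ : ℝ → Ω₂ → ℝ} (hm₁ : ∀ t, Measurable (W₁ t))
    (hm₂ : ∀ t, Measurable (W₂ t))
    (g₁ : ∀ s t : ℝ, 0 ≤ s → s ≤ t →
      P₁.map (fun ω => W₁ t ω - W₁ s ω) = gaussianReal 0 (Real.toNNReal (t - s)))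
    (i₁ : ∀ s t : ℝ, 0 ≤ s → s ≤ t →
      Indep (MeasurableSpace.comap (fun ω => W₁ t ω - W₁ s ω) (borel ℝ)) (F₁ s) P₁)
    (g₂ : ∀ s t : ℝ, 0 ≤ s → s ≤ t →
      P₂.map (fun ω => W₂ t ω - W₂ s ω) = gaussianReal 0 (Real.toNNReal (t - s)))
    (i₂ : ∀ s t : ℝ, 0 ≤ s → s ≤ t →
      Indep (MeasurableSpace.comap (fun ω => W₂ t ω - W₂ s ω) (borel ℝ)) (F₂ s) P₂) :
    Rot (P₁.prod P₂) (PF P₁ P₂ F₁ F₂) (fun t p => W₁ t p.1) (fun t p => W₂ t p.2) := by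
  intro s t hs hst Z ξ η hZ hZb hξ hη h1 u
  set G := PF P₁ P₂ F₁ F₂ with hG
  set D₁ := fun ω => W₁ t ω - W₁ s ω with hD₁
  set D₂ := fun ω => W₂ t ω - W₂ s ω with hD₂
  have mD₁ : Measurable D₁ := (hm₁ t).sub (hm₁ s)
  have mD₂ : Measurable D₂ := (hm₂ t).sub (hm₂ s)
  set D : Ω₁ × Ω₂ → ℝ × ℝ := fun p => (D₁ p.1, D₂ p.2) with hD
  have mD : Measurable D := (mD₁.comp measurable_fst).prodMk (mD₂.comp measurable_snd)
  set V : Ω₁ × Ω₂ → ℂ × ℝ × ℝ := fun p => (Z p, ξ p, η p) with hV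
  have mV' : Measurable[G s] V := hZ.measurable.prodMk (hξ.measurable.prodMk hη.measurable)
  have mV : Measurable V := mV'.mono (G.le s) le_rfl
  have hind : IndepFun V D (P₁.prod P₂) := by
    rw [IndepFun_iff_Indep]
    exact indep_of_indep_of_le_left
      (indep_incr (s := s) (t := t) mD₁ mD₂ (i₁ s t hs hst) (i₂ s t hs hst)) mV'.comap_le
  have hDmap : (P₁.prod P₂).map D
      = (gaussianReal 0 (Real.toNNReal (t - s))).prod (gaussianReal 0 (Real.toNNReal (t - s))) := by
    have := Measure.map_prod_map P₁ P₂ mD₁ mD₂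
    rw [g₁ s t hs hst, g₂ s t hs hst] at this
    exact this.symm
  have hmap := (indepFun_iff_map_prod_eq_prod_map_map mV.aemeasurable mD.aemeasurable).1 hind
  set v := Real.toNNReal (t - s) with hv
  set ψ : (ℂ × ℝ × ℝ) × (ℝ × ℝ) → ℂ := fun q =>
    q.1.1 * Complex.exp ((u * (q.1.2.1 * q.2.1 + q.1.2.2 * q.2.2) : ℝ) * Complex.I) with hψ
  have hψc : Continuous ψ := by fun_prop
  obtain ⟨C, hC⟩ := hZb
  have hψi : Integrable ψ (((P₁.prod P₂).map V).prod ((P₁.prod P₂).map D)) := by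
    rw [← hmap, integrable_map_measure hψc.aestronglyMeasurable (mV.prodMk mD).aemeasurable]
    refine Integrable.of_bound (C := C) (hψc.measurable.comp (mV.prodMk mD)).aestronglyMeasurable ?_
    refine Eventually.of_forall fun p => ?_
    simp only [hψ, Function.comp, norm_mul, Complex.norm_exp_ofReal_mul_I, mul_one]
    exact hC p
  have e1 : ∫ p, Z p * Complex.exp ((u * (ξ p * (W₁ t p.1 - W₁ s p.1)
      + η p * (W₂ t p.2 - W₂ s p.2)) : ℝ) * Complex.I) ∂(P₁.prod P₂)
      = ∫ q, ψ q ∂((P₁.prod P₂).map (fun p => (V p, D p))) := by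
    rw [integral_map (mV.prodMk mD).aemeasurable hψc.aestronglyMeasurable]
  rw [e1, hmap, integral_prod _ hψi, hDmap, integral_map mV.aemeasurable]
  · have e2 : ∀ p, ∫ d, ψ (V p, d) ∂((gaussianReal 0 v).prod (gaussianReal 0 v))
        = Z p * Complex.exp ((-(u ^ 2 * (t - s) / 2) : ℝ)) := by
      intro p
      simp only [hψ, hV]
      rw [integral_const_mul]
      congr 1
      have e3 : ∀ d : ℝ × ℝ, Complex.exp ((u * (ξ p * d.1 + η p * d.2) : ℝ) * Complex.I)
          = Complex.exp (((u * ξ p) * d.1 : ℝ) * Complex.I)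
            * Complex.exp (((u * η p) * d.2 : ℝ) * Complex.I) := by
        intro d
        rw [← Complex.exp_add]
        congr 1
        push_cast
        ring
      simp_rw [e3]
      rw [integral_prod_mul (f := fun y : ℝ => Complex.exp (((u * ξ p) * y : ℝ) * Complex.I))
        (g := fun y : ℝ => Complex.exp (((u * η p) * y : ℝ) * Complex.I)),
        gauss_int, gauss_int, ← Complex.exp_add]
      congr 1
      rw [← Complex.ofReal_add]
      congr 1
      rw [hv, Real.coe_toNNReal _ (sub_nonneg.2 hst)]
      linear_combination (-(u ^ 2 * (t - s) / 2)) * h1 p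
    simp_rw [e2]
    rw [integral_mul_const, mul_comm]
  · rw [← hDmap]
    exact hψi.1.integral_prod_right'

end
end GB

namespace GB
open Set
set_option linter.unusedSectionVars false

section
variable {Ω : Type*} [m : MeasurableSpace Ω] {P : Measure Ω} [IsProbabilityMeasure P]
  {G : Filtration ℝ m}

lemma doob_dyadic {D : ℝ → Ω → ℝ} (h : Martingale D G P) {T : ℝ} (hT : 0 ≤ T) (ε : NNReal) (n : ℕ) :
    ε * P {ω | ∃ i : ℕ, i ≤ 2 ^ n ∧ (ε : ℝ) ≤ |D (T * (i / 2 ^ n)) ω|} ≤ ENNReal.ofReal (∫ ω, |D T ω| ∂P) := by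
  have hmono : Monotone fun i : ℕ => T * ((i : ℝ) / 2 ^ n) := by
    intro i j hij
    have : (i : ℝ) ≤ j := by exact_mod_cast hij
    dsimp only
    gcongr
  let F : Filtration ℕ m := ⟨fun i => G (T * (i / 2 ^ n)), fun i j hij => G.mono (hmono hij),
    fun i => G.le _⟩
  have hm : Martingale (fun i : ℕ => D (T * (i / 2 ^ n))) F P :=
    ⟨fun i => h.1 _, fun i j hij => h.2 _ _ (hmono hij)⟩
  have hsub := hm.submartingale.sup hm.neg.submartingale
  have h0 : (0 : ℕ → Ω → ℝ) ≤ (fun i : ℕ => D (T * (i / 2 ^ n))) ⊔ -(fun i : ℕ => D (T * (i / 2 ^ n))) := by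
    intro i ω
    exact abs_nonneg (D (T * (i / 2 ^ n)) ω)
  have key := maximal_ineq hsub h0 (ε := ε) (2 ^ n)
  refine (le_trans ?_ key).trans ?_
  · gcongr
    rename_i ω
    rintro ⟨i, hi, h1⟩
    have : i ∈ Finset.range (2 ^ n + 1) := Finset.mem_range.2 (by omega)
    exact h1.trans (Finset.le_sup' (fun k => ((fun i : ℕ => D (T * (i / 2 ^ n))) ⊔ -(fun i : ℕ => D (T * (i / 2 ^ n)))) k ω) this)
  · apply ENNReal.ofReal_le_ofReal
    have e : ∀ ω, ((fun i : ℕ => D (T * (i / 2 ^ n))) ⊔ -(fun i : ℕ => D (T * (i / 2 ^ n)))) (2 ^ n) ω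
        = |D T ω| := by
      intro ω
      have : T * (((2 ^ n : ℕ) : ℝ) / 2 ^ n) = T := by push_cast; field_simp
      show |D (T * (((2 ^ n : ℕ) : ℝ) / 2 ^ n)) ω| = _
      rw [this]
    simp only [e]
    exact setIntegral_le_integral (h.integrable T).abs (Eventually.of_forall fun _ => abs_nonneg _)

lemma doob {D : ℝ → Ω → ℝ} (h : Martingale D G P) (hc : ∀ ω, Continuous fun t => D t ω)
    {T : ℝ} (hT : 0 ≤ T) (ε : NNReal) :
    ε * P {ω | ∃ t ∈ Icc 0 T, (ε : ℝ) < |D t ω|} ≤ ENNReal.ofReal (∫ ω, |D T ω| ∂P) := by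
  set E : ℕ → Set Ω := fun n => {ω | ∃ i : ℕ, i ≤ 2 ^ n ∧ (ε : ℝ) ≤ |D (T * (i / 2 ^ n)) ω|} with hE
  have hEm : Monotone E := by
    refine monotone_nat_of_le_succ fun n => ?_
    rintro ω ⟨i, hi, h1⟩
    refine ⟨2 * i, by rw [pow_succ]; omega, ?_⟩
    have : T * (((2 * i : ℕ) : ℝ) / 2 ^ (n + 1)) = T * (i / 2 ^ n) := by
      push_cast; rw [pow_succ]; field_simp
    rw [this]; exact h1
  have hsub : {ω | ∃ t ∈ Icc 0 T, (ε : ℝ) < |D t ω|} ⊆ ⋃ n, E n := by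
    rintro ω ⟨t, ht, h1⟩
    have hlim : Tendsto (fun n : ℕ => T * ((⌊t / T * 2 ^ n⌋₊ : ℝ) / 2 ^ n)) atTop (nhds t) := by
      have a0 : 0 ≤ t / T := div_nonneg ht.1 hT
      have := (tendsto_nat_floor_mul_div_atTop a0).comp
        (tendsto_pow_atTop_atTop_of_one_lt (r := (2 : ℝ)) (by norm_num))
      have := this.const_mul T
      have e : T * (t / T) = t := by
        rcases hT.eq_or_lt with h' | h'
        · subst h'; simp [le_antisymm ht.2 ht.1]
        · field_simp
      rw [e] at this
      exact this
    have h2 := ((hc ω).abs.tendsto t).comp hlim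
    obtain ⟨n, hn⟩ := (h2.eventually (lt_mem_nhds h1)).exists
    refine mem_iUnion.2 ⟨n, ⌊t / T * 2 ^ n⌋₊, ?_, hn.le⟩
    have : t / T * 2 ^ n ≤ ((2 ^ n : ℕ) : ℝ) := by
      push_cast
      have : t / T ≤ 1 := div_le_one_of_le₀ ht.2 hT
      have h2 : (0 : ℝ) < 2 ^ n := by positivity
      nlinarith
    exact_mod_cast Nat.floor_le_of_le this
  calc (ε : ENNReal) * P {ω | ∃ t ∈ Icc 0 T, (ε : ℝ) < |D t ω|} ≤ ε * P (⋃ n, E n) := by gcongr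
    _ = ⨆ n, ε * P (E n) := by rw [hEm.measure_iUnion, ENNReal.mul_iSup]
    _ ≤ _ := iSup_le fun n => doob_dyadic h hT ε n

lemma abs_le_of_sq {f : Ω → ℝ} (hf : MemLp f 2 P) {c : ℝ} (hc : 0 ≤ c)
    (h : ∫ ω, f ω ^ 2 ∂P ≤ c ^ 2) : ∫ ω, |f ω| ∂P ≤ c := by
  have h1 := variance_nonneg (fun ω => |f ω|) P
  rw [variance_eq_sub (X := fun ω => |f ω|) (hf.abs)] at h1
  have h2 : (∫ ω, |f ω| ∂P) ^ 2 ≤ c ^ 2 := by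
    have : P[(fun ω => |f ω|) ^ 2] = ∫ ω, f ω ^ 2 ∂P := by
      refine integral_congr_ae (Eventually.of_forall fun ω => ?_)
      simp
    rw [this] at h1
    linarith
  exact abs_le_of_sq_le_sq' h2 hc |>.2

/-- Limits of sequences of `L²` martingales. -/
lemma borel_cantelli {S : ℕ → ℝ → Ω → ℝ} (hS : ∀ k, L2M P G (S k))
    (hc : ∀ k ω, Continuous fun t => S k t ω) (h0 : ∀ k, ∀ t ≤ 0, ∀ ω, S k t ω = 0)
    (hD : ∀ k : ℕ, ∫ ω, (S (k + 1) k ω - S k k ω) ^ 2 ∂P ≤ 16 * (1 / 16) ^ k) :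
    ∀ᵐ ω ∂P, ∃ K : ℕ, ∀ k ≥ K, ∀ t ≤ (k : ℝ), |S (k + 1) t ω - S k t ω| ≤ (1 / 2) ^ k := by
  have hDL : ∀ k, L2M P G (fun t ω => S (k + 1) t ω + - S k t ω) := fun k => (hS _).add (hS _).neg
  have hbound : ∀ k : ℕ, P {ω | ∃ t ∈ Icc 0 (k : ℝ), (((1 / 2) ^ k : NNReal) : ℝ) < |S (k + 1) t ω + - S k t ω|}
      ≤ ENNReal.ofReal (4 * (1 / 2) ^ k) := by
    intro k
    have hm := (hDL k).martingale (fun t ht => Eventually.of_forall fun ω => by simp [h0 _ t ht])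
    have h1 := doob hm (fun ω => (hc _ ω).add (hc _ ω).neg) (Nat.cast_nonneg k) ((1 / 2) ^ k)
    have h2 : ∫ ω, |S (k + 1) k ω + - S k k ω| ∂P ≤ 4 * (1 / 4) ^ k := by
      refine abs_le_of_sq ((hDL k).memLp k) (by positivity) ?_
      simp only [← sub_eq_add_neg]
      refine (hD k).trans (le_of_eq ?_)
      rw [mul_pow, ← pow_mul, mul_comm k 2, pow_mul]; norm_num
    have h3 := h1.trans (ENNReal.ofReal_le_ofReal h2)
    have h4 : ENNReal.ofReal (4 * (1 / 4) ^ k) = (((1 / 2) ^ k : NNReal) : ENNReal) * ENNReal.ofReal (4 * (1 / 2) ^ k) := by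
      rw [← ENNReal.ofReal_coe_nnreal, ← ENNReal.ofReal_mul (by positivity)]
      congr 1
      push_cast
      rw [mul_left_comm, ← mul_pow]; norm_num
    rw [h4] at h3
    refine (ENNReal.mul_le_mul_iff_right ?_ ENNReal.coe_ne_top).1 h3
    simp
  have hsum : ∑' k : ℕ, P {ω | ∃ t ∈ Icc 0 (k : ℝ), (((1 / 2) ^ k : NNReal) : ℝ) < |S (k + 1) t ω + - S k t ω|} ≠ ⊤ := by
    refine ne_top_of_le_ne_top ?_ (ENNReal.tsum_le_tsum hbound)
    have : Summable fun k : ℕ => 4 * (1 / 2 : ℝ) ^ k :=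
      (summable_geometric_of_lt_one (by norm_num) (by norm_num)).mul_left _
    exact this.tsum_ofReal_ne_top
  filter_upwards [ae_eventually_notMem hsum] with ω hω
  obtain ⟨K, hK⟩ := eventually_atTop.1 hω
  refine ⟨K, fun k hk t ht => ?_⟩
  rcases le_total t 0 with h | h
  · simp [h0 _ t h]
  · have := hK k hk
    simp only [mem_ofPred_eq, not_exists, not_and, not_lt] at this
    have := this t ⟨h, ht⟩
    rw [← sub_eq_add_neg] at this
    simpa using this
end
end GB

namespace GB
open Set
set_option linter.unusedSectionVars false

section
variable {Ω : Type*} [m : MeasurableSpace Ω] {P : Measure Ω} [IsProbabilityMeasure P]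
  {G : Filtration ℝ m}

lemma fatou_sq {f : ℕ → Ω → ℝ} {g : Ω → ℝ} (hf : ∀ l, MemLp (f l) 2 P)
    (hg : AEStronglyMeasurable g P)
    (hlim : ∀ᵐ ω ∂P, Tendsto (fun l => f l ω) atTop (nhds (g ω))) {c : ℝ}
    (hb : ∀ᶠ l in atTop, ∫ ω, f l ω ^ 2 ∂P ≤ c) :
    MemLp g 2 P ∧ ∫ ω, g ω ^ 2 ∂P ≤ c := by
  have hc : 0 ≤ c := by
    obtain ⟨l, hl⟩ := hb.exists
    exact (integral_nonneg fun ω => sq_nonneg _).trans hl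
  have e1 : ∫⁻ ω, ENNReal.ofReal (g ω ^ 2) ∂P ≤ ENNReal.ofReal c := by
    have : ∫⁻ ω, ENNReal.ofReal (g ω ^ 2) ∂P
        = ∫⁻ ω, liminf (fun l => ENNReal.ofReal (f l ω ^ 2)) atTop ∂P := by
      refine lintegral_congr_ae ?_
      filter_upwards [hlim] with ω hω
      exact (((ENNReal.continuous_ofReal.tendsto _).comp (hω.pow 2)).liminf_eq).symm
    rw [this]
    refine (lintegral_liminf_le' fun l => ?_).trans ?_
    · exact ((hf l).1.aemeasurable.pow_const 2).ennreal_ofReal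
    · refine liminf_le_of_frequently_le' (Eventually.frequently ?_)
      filter_upwards [hb] with l hl
      rw [← ofReal_integral_eq_lintegral_ofReal ((memLp_two_iff_integrable_sq (hf l).1).1 (hf l))
        (Eventually.of_forall fun _ => sq_nonneg _)]
      exact ENNReal.ofReal_le_ofReal hl
  have hIntg : Integrable (fun ω => g ω ^ 2) P := by
    refine ⟨hg.pow 2, ?_⟩
    rw [hasFiniteIntegral_iff_ofReal (Eventually.of_forall fun _ => sq_nonneg _)]
    exact e1.trans_lt ENNReal.ofReal_lt_top
  refine ⟨(memLp_two_iff_integrable_sq hg).2 hIntg, ?_⟩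
  rw [← ofReal_integral_eq_lintegral_ofReal hIntg (Eventually.of_forall fun _ => sq_nonneg _)] at e1
  exact (ENNReal.ofReal_le_ofReal_iff hc).1 e1

/-- `L²` convergence implies convergence of pairings. -/
lemma l2_lim {α : Type*} [MeasurableSpace α] {μ : Measure α} {f : ℕ → α → ℝ} {g η : α → ℝ}
    (hf : ∀ k, MemLp (fun ω => f k ω - g ω) 2 μ) (hg : MemLp g 2 μ) (hη : MemLp η 2 μ)
    (h : Tendsto (fun k => ∫ ω, (f k ω - g ω) ^ 2 ∂μ) atTop (nhds 0)) :
    Tendsto (fun k => ∫ ω, η ω * f k ω ∂μ) atTop (nhds (∫ ω, η ω * g ω ∂μ)) := by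
  rw [tendsto_iff_dist_tendsto_zero]
  have hb : ∀ k, dist (∫ ω, η ω * f k ω ∂μ) (∫ ω, η ω * g ω ∂μ)
      ≤ (∫ ω, η ω ^ 2 ∂μ) ^ (1 / 2 : ℝ) * (∫ ω, (f k ω - g ω) ^ 2 ∂μ) ^ (1 / 2 : ℝ) := by
    intro k
    have i1 : Integrable (fun ω => η ω * (f k ω - g ω)) μ := hη.integrable_mul (hf k)
    have i2 : Integrable (fun ω => η ω * g ω) μ := hη.integrable_mul hg
    have i3 : Integrable (fun ω => η ω * f k ω) μ := by
      refine (i1.add i2).congr (Eventually.of_forall fun ω => ?_)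
      simp; ring
    rw [Real.dist_eq, ← integral_sub i3 i2]
    have hpq : (2 : ℝ).HolderConjugate 2 := by
      rw [Real.holderConjugate_iff]; norm_num
    have h2 : ENNReal.ofReal 2 = 2 := by norm_num
    have hh := integral_mul_norm_le_Lp_mul_Lq (μ := μ) hpq (f := η) (g := fun ω => f k ω - g ω)
      (by rw [h2]; exact hη) (by rw [h2]; exact hf k)
    calc |∫ ω, (η ω * f k ω - η ω * g ω) ∂μ| ≤ ∫ ω, |η ω * f k ω - η ω * g ω| ∂μ :=
          abs_integral_le_integral_abs
      _ = ∫ ω, ‖η ω‖ * ‖f k ω - g ω‖ ∂μ := by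
          refine integral_congr_ae (Eventually.of_forall fun ω => ?_)
          simp only [← mul_sub, abs_mul, Real.norm_eq_abs]
      _ ≤ _ := hh
      _ = _ := by
          simp only [Real.norm_eq_abs]
          norm_num
  refine squeeze_zero (fun _ => dist_nonneg) hb ?_
  have h1 := (h.rpow_const (p := (1 / 2 : ℝ)) (Or.inr (by norm_num))).const_mul
    ((∫ ω, η ω ^ 2 ∂μ) ^ (1 / 2 : ℝ))
  rw [Real.zero_rpow (by norm_num), mul_zero] at h1
  exact h1

lemma path_limit {S : ℕ → ℝ → ℝ} (hc : ∀ k, Continuous (S k)) {K : ℕ}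
    (hK : ∀ k ≥ K, ∀ t ≤ (k : ℝ), |S (k + 1) t - S k t| ≤ (1 / 2) ^ k) :
    (∀ t, Tendsto (fun k => S k t) atTop (nhds (limUnder atTop (fun k => S k t)))) ∧
      Continuous (fun t => limUnder atTop (fun k => S k t)) := by
  have hstep : ∀ k ≥ K, ∀ t ≤ (k : ℝ), ∀ n, dist (S (k + n) t) (S (k + (n + 1)) t)
      ≤ (1 / 2) ^ k * (1 / 2) ^ n := by
    intro k hk t ht n
    have := hK (k + n) (by omega) t (ht.trans (by push_cast; linarith [Nat.cast_nonneg (α := ℝ) n]))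
    rw [dist_comm, Real.dist_eq, ← pow_add]
    exact this
  have hlim : ∀ t, Tendsto (fun k => S k t) atTop (nhds (limUnder atTop (fun k => S k t))) := by
    intro t
    obtain ⟨k, hk⟩ := exists_nat_ge t
    have hcs := cauchySeq_of_le_geometric (1 / 2) _ (by norm_num)
      (hstep (max K k) (le_max_left _ _) t (hk.trans (by exact_mod_cast le_max_right _ _)))
    obtain ⟨a, ha⟩ := cauchySeq_tendsto_of_complete hcs
    refine tendsto_nhds_limUnder ⟨a, ?_⟩
    rw [← tendsto_add_atTop_iff_nat (max K k)]
    refine ha.congr fun n => by rw [add_comm]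
  refine ⟨hlim, ?_⟩
  have hdist : ∀ k ≥ K, ∀ t ≤ (k : ℝ), dist (S k t) (limUnder atTop (fun k => S k t)) ≤ 2 * (1 / 2) ^ k := by
    intro k hk t ht
    have h1 : Tendsto (fun n => S (k + n) t) atTop (nhds (limUnder atTop (fun k => S k t))) := by
      have := (tendsto_add_atTop_iff_nat k).2 (hlim t)
      exact this.congr fun n => by rw [add_comm]
    have := dist_le_of_le_geometric_of_tendsto₀ (1 / 2) _ (by norm_num) (hstep k hk t ht) h1
    refine this.trans (le_of_eq ?_)
    norm_num
    ring
  rw [continuous_iff_continuousAt]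
  intro t
  refine continuousAt_of_locally_uniform_approx_of_continuousAt fun u hu => ?_
  obtain ⟨ε, hε, hεu⟩ := Metric.mem_uniformity_dist.1 hu
  have hz : Tendsto (fun k : ℕ => 2 * (1 / 2 : ℝ) ^ k) atTop (nhds 0) := by
    simpa using (tendsto_pow_atTop_nhds_zero_of_lt_one (r := (1 / 2 : ℝ)) (by norm_num) (by norm_num)).const_mul 2
  obtain ⟨k0, hk0⟩ := exists_nat_gt t
  obtain ⟨k, hk1, hk2⟩ := ((hz.eventually (gt_mem_nhds hε)).and (eventually_ge_atTop (max K k0))).exists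
  refine ⟨Iio (k : ℝ), Iio_mem_nhds (hk0.trans_le (by exact_mod_cast (le_max_right K k0).trans hk2)), S k,
    (hc k).continuousAt, fun y hy => hεu ?_⟩
  rw [dist_comm]
  exact (hdist k ((le_max_left _ _).trans hk2) y (le_of_lt hy)).trans_lt hk1

lemma exists_limit (hnull : ∀ t A, MeasurableSet A → (∀ᵐ ω ∂P, ω ∈ A) → MeasurableSet[G t] A)
    {S : ℕ → ℝ → Ω → ℝ} (hS : ∀ k, L2M P G (S k))
    (hc : ∀ k ω, Continuous fun t => S k t ω) (h0 : ∀ k, ∀ t ≤ 0, ∀ ω, S k t ω = 0)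
    (hD : ∀ k l : ℕ, k ≤ l → ∀ t : ℝ, t ≤ k → ∫ ω, (S l t ω - S k t ω) ^ 2 ∂P ≤ 16 * (1 / 16) ^ k) :
    ∃ V : ℝ → Ω → ℝ, L2M P G V ∧ (∀ ω, Continuous fun t => V t ω) ∧ (∀ t ≤ 0, ∀ ω, V t ω = 0) ∧
      (∀ t, ∀ᵐ ω ∂P, Tendsto (fun k => S k t ω) atTop (nhds (V t ω))) ∧
      (∀ t, Tendsto (fun k => ∫ ω, (S k t ω - V t ω) ^ 2 ∂P) atTop (nhds 0)) := by
  obtain ⟨E, hEa, hEm, hEs⟩ := (borel_cantelli hS hc h0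
    (fun k => hD k (k + 1) (by omega) k le_rfl)).exists_measurable_mem
  classical
  have hE : ∀ᵐ ω ∂P, ω ∈ E := hEa
  have hp : ∀ ω ∈ E, (∀ t, Tendsto (fun k => S k t ω) atTop (nhds (limUnder atTop (fun k => S k t ω)))) ∧
      Continuous (fun t => limUnder atTop (fun k => S k t ω)) := by
    intro ω hω
    obtain ⟨K, hK⟩ := hEs ω hω
    exact path_limit (fun k => hc k ω) hK
  set V : ℝ → Ω → ℝ := fun t ω => if ω ∈ E then limUnder atTop (fun k => S k t ω) else 0 with hV
  have hVE : ∀ t, ∀ ω ∈ E, Tendsto (fun k => S k t ω) atTop (nhds (V t ω)) := by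
    intro t ω hω
    simp only [hV, hω, if_true]
    exact (hp ω hω).1 t
  have hlim : ∀ t, ∀ᵐ ω ∂P, Tendsto (fun k => S k t ω) atTop (nhds (V t ω)) := by
    intro t
    filter_upwards [hE] with ω hω using hVE t ω hω
  have had : ∀ t, StronglyMeasurable[G t] (V t) := by
    intro t
    refine stronglyMeasurable_of_tendsto atTop
      (f := fun k => E.indicator (S k t)) (fun k => ((hS k).adapted t).indicator (hnull t E hEm hE)) ?_
    rw [tendsto_pi_nhds]
    intro ω
    by_cases hω : ω ∈ E
    · simp only [indicator_of_mem hω]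
      exact hVE t ω hω
    · simp [hV, hω]
  have hLp : ∀ t : ℝ, ∀ k : ℕ, t ≤ k → MemLp (fun ω => V t ω - S k t ω) 2 P ∧
      ∫ ω, (V t ω - S k t ω) ^ 2 ∂P ≤ 16 * (1 / 16) ^ k := by
    intro t k htk
    refine fatou_sq (f := fun l ω => S l t ω - S k t ω) (fun l => ((hS l).memLp t).sub ((hS k).memLp t))
      ((sm (had t)).sub ((hS k).memLp t).1) ?_ ?_
    · filter_upwards [hlim t] with ω hω using hω.sub_const _
    · filter_upwards [eventually_ge_atTop k] with l hl using hD k l hl t htk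
  have hVL : ∀ t, MemLp (V t) 2 P := by
    intro t
    obtain ⟨k, hk⟩ := exists_nat_ge t
    have := (hLp t k hk).1.add ((hS k).memLp t)
    refine this.ae_eq (Eventually.of_forall fun ω => ?_)
    simp
  have hL2 : ∀ t, Tendsto (fun k => ∫ ω, (S k t ω - V t ω) ^ 2 ∂P) atTop (nhds 0) := by
    intro t
    obtain ⟨k, hk⟩ := exists_nat_ge t
    have hz : Tendsto (fun k : ℕ => 16 * (1 / 16 : ℝ) ^ k) atTop (nhds 0) := by
      simpa using (tendsto_pow_atTop_nhds_zero_of_lt_one (r := (1 / 16 : ℝ)) (by norm_num) (by norm_num)).const_mul 16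
    refine squeeze_zero' (Eventually.of_forall fun _ => integral_nonneg fun _ => sq_nonneg _) ?_ hz
    filter_upwards [eventually_ge_atTop k] with l hl
    have := (hLp t l (hk.trans (by exact_mod_cast hl))).2
    refine le_trans (le_of_eq ?_) this
    refine integral_congr_ae (Eventually.of_forall fun ω => ?_)
    simp only
    ring
  refine ⟨V, ⟨had, hVL, ?_⟩, ?_, ?_, hlim, hL2⟩
  · intro s t hs hst η hη hη2
    have h1 := l2_lim (fun k => ((hS k).memLp t).sub (hVL t)) (hVL t) hη2 (hL2 t)
    have h2 := l2_lim (fun k => ((hS k).memLp s).sub (hVL s)) (hVL s) hη2 (hL2 s)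
    refine tendsto_nhds_unique h1 (h2.congr fun k => ?_)
    exact ((hS k).mart s t hs hst η hη hη2).symm
  · intro ω
    by_cases hω : ω ∈ E
    · simp only [hV, hω, if_true]
      exact (hp ω hω).2
    · simp only [hV, hω, if_false]
      exact continuous_const
  · intro t ht ω
    simp only [hV]
    split_ifs
    · simp only [h0 _ t ht]
      exact tendsto_const_nhds.limUnder_eq
    · rfl
end
end GB

namespace GB
open Set
set_option linter.unusedSectionVars false

section
variable {Ω : Type*} [m : MeasurableSpace Ω] {P : Measure Ω} [IsProbabilityMeasure P]
  {G : Filtration ℝ m}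

lemma strip_finite (T : ℝ) : IsFiniteMeasure ((volume.prod P).restrict (Ioc 0 T ×ˢ univ)) := by
  constructor
  rw [Measure.restrict_apply_univ, Measure.prod_prod]
  simp

/-- Identify a Brownian motion via conditional characteristic functions. -/
lemma bm_of_char {V : ℝ → Ω → ℝ} (had : ∀ t, StronglyMeasurable[G t] (V t))
    (hc : ∀ ω, Continuous fun t => V t ω) (h0 : ∀ ω, V 0 ω = 0)
    (h : ∀ s t, 0 ≤ s → s ≤ t → ∀ (Z : Ω → ℂ), StronglyMeasurable[G s] Z →
      (∃ C, ∀ ω, ‖Z ω‖ ≤ C) → ∀ u : ℝ,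
      ∫ ω, Z ω * Complex.exp ((u * (V t ω - V s ω) : ℝ) * Complex.I) ∂P
      = Complex.exp ((-(u ^ 2 * (t - s) / 2) : ℝ)) * ∫ ω, Z ω ∂P) :
    IsBrownianMotion P G V := by
  have hΔ : ∀ s t, Measurable fun ω => V t ω - V s ω := fun s t =>
    ((had t).mono (G.le t)).measurable.sub ((had s).mono (G.le s)).measurable
  have key : ∀ s t, 0 ≤ s → s ≤ t → ∀ A, MeasurableSet[G s] A →
      (P.restrict A).map (fun ω => V t ω - V s ω) = P A • gaussianReal 0 (Real.toNNReal (t - s)) := by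
    intro s t hs hst A hA
    have hAm := G.le s A hA
    have : IsFiniteMeasure (P A • gaussianReal 0 (Real.toNNReal (t - s))) := by
      constructor
      simp
    apply Measure.ext_of_charFun
    ext u
    have h1 := h s t hs hst (A.indicator 1) (stronglyMeasurable_one.indicator hA)
      ⟨1, fun ω => by by_cases hω : ω ∈ A <;> simp [hω]⟩ u
    rw [charFun_apply_real, charFun_apply_real, integral_smul_measure, ← charFun_apply_real (μ := gaussianReal 0 _),
      charFun_gaussianReal, integral_map (hΔ s t).aemeasurable (by fun_prop)]
    have e1 : ∫ ω, A.indicator (1 : Ω → ℂ) ω * Complex.exp ((u * (V t ω - V s ω) : ℝ) * Complex.I) ∂P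
        = ∫ ω in A, Complex.exp (u * ((V t ω - V s ω : ℝ) : ℂ) * Complex.I) ∂P := by
      rw [← integral_indicator hAm]
      refine integral_congr_ae (Eventually.of_forall fun ω => ?_)
      by_cases hω : ω ∈ A <;> simp [hω]
    have e2 : ∫ ω, A.indicator (1 : Ω → ℂ) ω ∂P = ((P A).toReal : ℂ) := by
      rw [integral_indicator hAm]
      simp [Measure.real]
    rw [← e1, h1, e2, mul_comm, Complex.real_smul]
    congr 2
    rw [Real.coe_toNNReal _ (by linarith)]
    push_cast
    ring
  have k1 : ∀ s t, 0 ≤ s → s ≤ t →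
      P.map (fun ω => V t ω - V s ω) = gaussianReal 0 (Real.toNNReal (t - s)) := by
    intro s t hs hst
    have := key s t hs hst univ MeasurableSet.univ
    simpa using this
  refine ⟨h0, hc, fun t => (had t).measurable, k1, ?_⟩
  intro s t hs hst
  rw [Indep_iff]
  rintro B A ⟨B', hB', rfl⟩ hA
  have hB'' : MeasurableSet B' := by
    rw [BorelSpace.measurable_eq (α := ℝ)]; exact hB'
  have h1 := congrArg (fun μ => μ B') (key s t hs hst A hA)
  have h2 := congrArg (fun μ => μ B') (k1 s t hs hst)
  simp only [Measure.smul_apply, smul_eq_mul] at h1 h2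
  rw [Measure.map_apply (hΔ s t) hB''] at h1 h2
  rw [Measure.restrict_apply (hΔ s t hB'')] at h1
  rw [h1, h2, mul_comm]

lemma char_limit {S : ℕ → ℝ → Ω → ℝ} {V : ℝ → Ω → ℝ} (hS : ∀ k t, AEStronglyMeasurable (S k t) P)
    (hlim : ∀ t, ∀ᵐ ω ∂P, Tendsto (fun k => S k t ω) atTop (nhds (V t ω))) {s t : ℝ} {Z : Ω → ℂ}
    (hZ : AEStronglyMeasurable Z P) (hZb : ∃ C, ∀ ω, ‖Z ω‖ ≤ C) (u : ℝ) {z : ℂ}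
    (h : ∀ᶠ k in atTop, ∫ ω, Z ω * Complex.exp ((u * (S k t ω - S k s ω) : ℝ) * Complex.I) ∂P = z) :
    ∫ ω, Z ω * Complex.exp ((u * (V t ω - V s ω) : ℝ) * Complex.I) ∂P = z := by
  obtain ⟨C, hC⟩ := hZb
  have h1 : Tendsto (fun k => ∫ ω, Z ω * Complex.exp ((u * (S k t ω - S k s ω) : ℝ) * Complex.I) ∂P) atTop
      (nhds (∫ ω, Z ω * Complex.exp ((u * (V t ω - V s ω) : ℝ) * Complex.I) ∂P)) := by
    refine tendsto_integral_of_dominated_convergence (fun _ => C) (fun k => ?_) (integrable_const C) ?_ ?_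
    · refine hZ.mul ?_
      have hcont : Continuous fun x : ℝ => Complex.exp ((u * x : ℝ) * Complex.I) := by fun_prop
      exact hcont.comp_aestronglyMeasurable ((hS k t).sub (hS k s))
    · intro k
      refine Eventually.of_forall fun ω => ?_
      rw [norm_mul, Complex.norm_exp_ofReal_mul_I, mul_one]
      exact hC ω
    · filter_upwards [hlim t, hlim s] with ω h1 h2
      have hcont : Continuous fun x : ℝ => Complex.exp ((u * x : ℝ) * Complex.I) := by fun_prop
      exact ((hcont.tendsto _).comp (h1.sub h2)).const_mul _
  exact tendsto_nhds_unique h1 ((tendsto_congr' h).2 tendsto_const_nhds)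

lemma weighted_lim {A : ℕ → ℝ → Ω → ℝ} {a c : ℝ → Ω → ℝ} {R R' : Set (ℝ × Ω)} (hR : R ⊆ R')
    (hfin : IsFiniteMeasure ((volume.prod P).restrict R'))
    (hAm : ∀ k, Measurable fun p : ℝ × Ω => A k p.1 p.2) (ham : Measurable fun p : ℝ × Ω => a p.1 p.2)
    (hAb : ∀ k r ω, |A k r ω| ≤ 1) (hab : ∀ r ω, |a r ω| ≤ 1)
    (hlim : Tendsto (fun k => ∫ p in R', (A k p.1 p.2 - a p.1 p.2) ^ 2 ∂(volume.prod P)) atTop (nhds 0))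
    (hc : MemLp (fun p : ℝ × Ω => c p.1 p.2) 2 ((volume.prod P).restrict R'))
    {ξ : Ω → ℝ} (hξ : Measurable ξ) (hξb : ∃ C, ∀ ω, |ξ ω| ≤ C) :
    (∀ k, IntegrableOn (fun p => ξ p.2 * (A k p.1 p.2 * c p.1 p.2)) R (volume.prod P)) ∧
    IntegrableOn (fun p => ξ p.2 * (a p.1 p.2 * c p.1 p.2)) R (volume.prod P) ∧
    Tendsto (fun k => ∫ p in R, ξ p.2 * (A k p.1 p.2 * c p.1 p.2) ∂(volume.prod P)) atTop
      (nhds (∫ p in R, ξ p.2 * (a p.1 p.2 * c p.1 p.2) ∂(volume.prod P))) := by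
  have hle : (volume.prod P).restrict R ≤ (volume.prod P).restrict R' := Measure.restrict_mono hR le_rfl
  obtain ⟨C, hC⟩ := hξb
  have hA2 : ∀ k, MemLp (fun p : ℝ × Ω => A k p.1 p.2) 2 ((volume.prod P).restrict R') := fun k =>
    MemLp.of_bound (hAm k).aestronglyMeasurable 1 (Eventually.of_forall fun p => hAb k _ _)
  have ha2 : MemLp (fun p : ℝ × Ω => a p.1 p.2) 2 ((volume.prod P).restrict R') :=
    MemLp.of_bound ham.aestronglyMeasurable 1 (Eventually.of_forall fun p => hab _ _)
  have hη : MemLp (fun p : ℝ × Ω => ξ p.2 * c p.1 p.2) 2 ((volume.prod P).restrict R') := by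
    have h1 : MemLp (fun p : ℝ × Ω => ξ p.2) ⊤ ((volume.prod P).restrict R') :=
      memLp_top_of_bound (hξ.comp measurable_snd).aestronglyMeasurable C (Eventually.of_forall fun p => hC _)
    exact hc.mul h1
  have hηR := hη.mono_measure hle
  have e : ∀ (f : ℝ → Ω → ℝ), (fun p : ℝ × Ω => ξ p.2 * (f p.1 p.2 * c p.1 p.2))
      = fun p => (ξ p.2 * c p.1 p.2) * f p.1 p.2 := by
    intro f; ext p; ring
  refine ⟨fun k => ?_, ?_, ?_⟩
  · rw [e (A k)]
    exact hηR.integrable_mul ((hA2 k).mono_measure hle)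
  · rw [e a]
    exact hηR.integrable_mul (ha2.mono_measure hle)
  · simp only [e]
    refine l2_lim (fun k => ((hA2 k).sub ha2).mono_measure hle) (ha2.mono_measure hle) hηR ?_
    refine squeeze_zero (fun k => integral_nonneg fun _ => sq_nonneg _) (fun k => ?_) hlim
    refine setIntegral_mono_set ?_ (Eventually.of_forall fun _ => sq_nonneg _) hR.eventuallyLE
    exact ((hA2 k).sub ha2).integrable_sq

lemma Cov.limit {S : ℕ → ℝ → Ω → ℝ} {V N : ℝ → Ω → ℝ} (hS : ∀ k, L2M P G (S k)) (hV : L2M P G V)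
    (hN : L2M P G N)
    (hL2 : ∀ t, Tendsto (fun k => ∫ ω, (S k t ω - V t ω) ^ 2 ∂P) atTop (nhds 0))
    {A B : ℕ → ℝ → Ω → ℝ} {a b c d : ℝ → Ω → ℝ}
    (hAm : ∀ k, Measurable fun p : ℝ × Ω => A k p.1 p.2) (ham : Measurable fun p : ℝ × Ω => a p.1 p.2)
    (hBm : ∀ k, Measurable fun p : ℝ × Ω => B k p.1 p.2) (hbm : Measurable fun p : ℝ × Ω => b p.1 p.2)
    (hAb : ∀ k r ω, |A k r ω| ≤ 1) (hab : ∀ r ω, |a r ω| ≤ 1)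
    (hBb : ∀ k r ω, |B k r ω| ≤ 1) (hbb : ∀ r ω, |b r ω| ≤ 1)
    (hAl : ∀ T, Tendsto (fun k => ∫ p in Ioc 0 T ×ˢ univ, (A k p.1 p.2 - a p.1 p.2) ^ 2 ∂(volume.prod P))
      atTop (nhds 0))
    (hBl : ∀ T, Tendsto (fun k => ∫ p in Ioc 0 T ×ˢ univ, (B k p.1 p.2 - b p.1 p.2) ^ 2 ∂(volume.prod P))
      atTop (nhds 0))
    (hc : ∀ T, MemLp (fun p : ℝ × Ω => c p.1 p.2) 2 ((volume.prod P).restrict (Ioc 0 T ×ˢ univ)))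
    (hd : ∀ T, MemLp (fun p : ℝ × Ω => d p.1 p.2) 2 ((volume.prod P).restrict (Ioc 0 T ×ˢ univ)))
    (h : ∀ k, Cov P G (S k) N (fun r ω => A k r ω * c r ω + B k r ω * d r ω)) :
    Cov P G V N (fun r ω => a r ω * c r ω + b r ω * d r ω) := by
  constructor
  · intro T
    have h1 := (weighted_lim (c := c) (R := Ioc 0 T ×ˢ univ) subset_rfl (strip_finite T) hAm ham hAb hab (hAl T)
      (hc T) (ξ := fun _ => 1) measurable_const ⟨1, fun _ => by simp⟩).2.1
    have h2 := (weighted_lim (c := d) (R := Ioc 0 T ×ˢ univ) subset_rfl (strip_finite T) hBm hbm hBb hbb (hBl T)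
      (hd T) (ξ := fun _ => 1) measurable_const ⟨1, fun _ => by simp⟩).2.1
    simp only [one_mul] at h1 h2
    exact h1.add h2
  · intro s t hs hst ξ hξ hξb
    have hsub : Ioc s t ×ˢ (univ : Set Ω) ⊆ Ioc 0 t ×ˢ univ := prod_mono (Ioc_subset_Ioc_left hs) subset_rfl
    have hξm : Measurable ξ := (hξ.mono (G.le s)).measurable
    obtain ⟨h1a, h1b, h1c⟩ := weighted_lim (c := c) hsub (strip_finite t) hAm ham hAb hab (hAl t)
      (hc t) hξm hξb
    obtain ⟨h2a, h2b, h2c⟩ := weighted_lim (c := d) hsub (strip_finite t) hBm hbm hBb hbb (hBl t)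
      (hd t) hξm hξb
    have hr := h1c.add h2c
    have hl : ∀ r, Tendsto (fun k => ∫ ω, ξ ω * (S k r ω * N r ω) ∂P) atTop
        (nhds (∫ ω, ξ ω * (V r ω * N r ω) ∂P)) := by
      intro r
      have e : ∀ f : Ω → ℝ, (fun ω => ξ ω * (f ω * N r ω)) = fun ω => (ξ ω * N r ω) * f ω := by
        intro f; ext ω; ring
      simp only [e]
      exact l2_lim (fun k => ((hS k).memLp r).sub (hV.memLp r)) (hV.memLp r)
        (memLp_bdd_mul (sm hξ) hξb (hN.memLp r)) (hL2 r)
    have e1 : ∫ p in Ioc s t ×ˢ univ, ξ p.2 * (a p.1 p.2 * c p.1 p.2 + b p.1 p.2 * d p.1 p.2) ∂(volume.prod P)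
        = ∫ p in Ioc s t ×ˢ univ, ξ p.2 * (a p.1 p.2 * c p.1 p.2) ∂(volume.prod P)
          + ∫ p in Ioc s t ×ˢ univ, ξ p.2 * (b p.1 p.2 * d p.1 p.2) ∂(volume.prod P) := by
      rw [← integral_add h1b h2b]
      simp only [mul_add]
    rw [e1]
    refine tendsto_nhds_unique ((hl t).sub (hl s)) (hr.congr fun k => ?_)
    rw [(h k).eq s t hs hst ξ hξ hξb, ← integral_add (h1a k) (h2a k)]
    simp only [mul_add]
end
end GB

namespace GB
open Set
set_option linter.unusedSectionVars false

section
variable {Ω : Type*} [m : MeasurableSpace Ω] {P : Measure Ω} [IsProbabilityMeasure P]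
  {G : Filtration ℝ m}

lemma sq_le_four {x y : ℝ} (hx : |x| ≤ 1) (hy : |y| ≤ 1) : (x - y) ^ 2 ≤ 4 := by
  have := abs_le.1 hx
  have := abs_le.1 hy
  nlinarith

/-- squared error on a strip -/
def err (P : Measure Ω) (R : Set (ℝ × Ω)) (A B a b : ℝ → Ω → ℝ) : ℝ :=
  ∫ p in R, ((A p.1 p.2 - a p.1 p.2) ^ 2 + (B p.1 p.2 - b p.1 p.2) ^ 2) ∂(volume.prod P)

lemma err_tendsto {T : ℝ} {A B : ℕ → ℝ → Ω → ℝ} {a b a' b' : ℝ → Ω → ℝ}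
    (hAm : ∀ k, Measurable fun p : ℝ × Ω => A k p.1 p.2) (ham : Measurable fun p : ℝ × Ω => a p.1 p.2)
    (hBm : ∀ k, Measurable fun p : ℝ × Ω => B k p.1 p.2) (hbm : Measurable fun p : ℝ × Ω => b p.1 p.2)
    (hAb : ∀ k r ω, |A k r ω| ≤ 1) (hab : ∀ r ω, |a r ω| ≤ 1)
    (hBb : ∀ k r ω, |B k r ω| ≤ 1) (hbb : ∀ r ω, |b r ω| ≤ 1)
    (hA : ∀ r ∈ Ioc 0 T, ∀ ω, Tendsto (fun k => A k r ω) atTop (nhds (a' r ω)))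
    (hB : ∀ r ∈ Ioc 0 T, ∀ ω, Tendsto (fun k => B k r ω) atTop (nhds (b' r ω))) :
    Tendsto (fun k => err P (Ioc 0 T ×ˢ univ) (A k) (B k) a b) atTop
      (nhds (err P (Ioc 0 T ×ˢ univ) a' b' a b)) := by
  have := strip_finite (P := P) T
  refine tendsto_integral_of_dominated_convergence (fun _ => 8) (fun k => ?_) (integrable_const _) (fun k => ?_) ?_
  · exact ((((hAm k).sub ham).pow_const 2).add (((hBm k).sub hbm).pow_const 2)).aestronglyMeasurable
  · refine Eventually.of_forall fun p => ?_
    rw [Real.norm_of_nonneg (by positivity)]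
    linarith [sq_le_four (hAb k p.1 p.2) (hab p.1 p.2), sq_le_four (hBb k p.1 p.2) (hbb p.1 p.2)]
  · rw [ae_restrict_iff' (measurableSet_Ioc.prod .univ)]
    refine Eventually.of_forall fun p hp => ?_
    exact (((hA p.1 hp.1 p.2).sub_const _).pow 2).add (((hB p.1 hp.1 p.2).sub_const _).pow 2)

lemma diag {T : ℝ} (hT : 0 ≤ T) {a b : ℕ → ℝ → Ω → ℝ} {a' b' : ℝ → Ω → ℝ}
    (ham : ∀ j r, Measurable (a j r)) (hbm : ∀ j r, Measurable (b j r))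
    (hac : ∀ j ω, Continuous fun r => a j r ω) (hbc : ∀ j ω, Continuous fun r => b j r ω)
    (hab : ∀ j r ω, |a j r ω| ≤ 1) (hbb : ∀ j r ω, |b j r ω| ≤ 1)
    (ham' : Measurable fun p : ℝ × Ω => a' p.1 p.2) (hbm' : Measurable fun p : ℝ × Ω => b' p.1 p.2)
    (hab' : ∀ r ω, |a' r ω| ≤ 1) (hbb' : ∀ r ω, |b' r ω| ≤ 1)
    (hA : ∀ r ω, Tendsto (fun k => a k r ω) atTop (nhds (a' r ω)))
    (hB : ∀ r ω, Tendsto (fun k => b k r ω) atTop (nhds (b' r ω))) {ε : ℝ} (hε : 0 < ε) :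
    ∃ j n, err P (Ioc 0 T ×ˢ univ) (SA 0 T n (a j)) (SA 0 T n (b j)) a' b' ≤ ε := by
  have h1 := err_tendsto (P := P) (T := T) (fun k => joint_meas (hac k) (ham k)) ham'
    (fun k => joint_meas (hbc k) (hbm k)) hbm' hab hab' hbb hbb' (fun r _ ω => hA r ω) (fun r _ ω => hB r ω)
  have e0 : err P (Ioc 0 T ×ˢ univ) a' b' a' b' = 0 := by simp [err]
  rw [e0] at h1
  obtain ⟨j, hj⟩ := (h1.eventually (gt_mem_nhds hε)).exists
  have h2 := err_tendsto (P := P) (T := T) (A := fun n => SA 0 T n (a j)) (B := fun n => SA 0 T n (b j))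
    (fun n => SA_measurable n (ham j)) ham' (fun n => SA_measurable n (hbm j)) hbm'
    (fun n => SA_bdd hT n zero_le_one (hab j)) hab' (fun n => SA_bdd hT n zero_le_one (hbb j)) hbb'
    (fun r hr ω => SA_tendsto hr ω (hac j ω)) (fun r hr ω => SA_tendsto hr ω (hbc j ω))
  obtain ⟨n, hn⟩ := (h2.eventually (gt_mem_nhds hj)).exists
  exact ⟨j, n, le_of_lt hn⟩

lemma err_le {R R' : Set (ℝ × Ω)} (hR : R ⊆ R') (hfin : IsFiniteMeasure ((volume.prod P).restrict R'))
    {A B a b : ℝ → Ω → ℝ}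
    (hAm : Measurable fun p : ℝ × Ω => A p.1 p.2) (ham : Measurable fun p : ℝ × Ω => a p.1 p.2)
    (hBm : Measurable fun p : ℝ × Ω => B p.1 p.2) (hbm : Measurable fun p : ℝ × Ω => b p.1 p.2)
    (hAb : ∀ r ω, |A r ω| ≤ 1) (hab : ∀ r ω, |a r ω| ≤ 1)
    (hBb : ∀ r ω, |B r ω| ≤ 1) (hbb : ∀ r ω, |b r ω| ≤ 1) :
    IntegrableOn (fun p : ℝ × Ω => (A p.1 p.2 - a p.1 p.2) ^ 2) R' (volume.prod P) ∧
    IntegrableOn (fun p : ℝ × Ω => (B p.1 p.2 - b p.1 p.2) ^ 2) R' (volume.prod P) ∧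
    IntegrableOn (fun p : ℝ × Ω => (A p.1 p.2 - a p.1 p.2) ^ 2 + (B p.1 p.2 - b p.1 p.2) ^ 2) R (volume.prod P) ∧
    (∫ p in R, (A p.1 p.2 - a p.1 p.2) ^ 2 ∂(volume.prod P)) ≤ err P R' A B a b ∧
    (∫ p in R, (B p.1 p.2 - b p.1 p.2) ^ 2 ∂(volume.prod P)) ≤ err P R' A B a b ∧
    err P R A B a b ≤ err P R' A B a b := by
  have i1 : IntegrableOn (fun p : ℝ × Ω => (A p.1 p.2 - a p.1 p.2) ^ 2) R' (volume.prod P) := by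
    refine Integrable.of_bound ((hAm.sub ham).pow_const 2).aestronglyMeasurable 4 (Eventually.of_forall fun p => ?_)
    rw [Real.norm_of_nonneg (by positivity)]
    exact sq_le_four (hAb _ _) (hab _ _)
  have i2 : IntegrableOn (fun p : ℝ × Ω => (B p.1 p.2 - b p.1 p.2) ^ 2) R' (volume.prod P) := by
    refine Integrable.of_bound ((hBm.sub hbm).pow_const 2).aestronglyMeasurable 4 (Eventually.of_forall fun p => ?_)
    rw [Real.norm_of_nonneg (by positivity)]
    exact sq_le_four (hBb _ _) (hbb _ _)
  have i3 : IntegrableOn (fun p : ℝ × Ω => (A p.1 p.2 - a p.1 p.2) ^ 2 + (B p.1 p.2 - b p.1 p.2) ^ 2) R' (volume.prod P) :=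
    i1.add i2
  have h3 : err P R A B a b ≤ err P R' A B a b :=
    setIntegral_mono_set i3 (Eventually.of_forall fun _ => by positivity) hR.eventuallyLE
  refine ⟨i1, i2, i3.mono_set hR, le_trans ?_ h3, le_trans ?_ h3, h3⟩
  · refine integral_mono (i1.mono_set hR) (i3.mono_set hR) fun p => ?_
    exact le_add_of_nonneg_right (sq_nonneg _)
  · refine integral_mono (i2.mono_set hR) (i3.mono_set hR) fun p => ?_
    exact le_add_of_nonneg_left (sq_nonneg _)

theorem construct_bm (hnull : ∀ t A, MeasurableSet A → (∀ᵐ ω ∂P, ω ∈ A) → MeasurableSet[G t] A)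
    {W₁ W₂ : ℝ → Ω → ℝ} (h1 : L2M P G W₁) (h2 : L2M P G W₂)
    (c1 : ∀ ω, Continuous fun t => W₁ t ω) (c2 : ∀ ω, Continuous fun t => W₂ t ω)
    (h11 : Cov P G W₁ W₁ fun _ _ => 1) (h22 : Cov P G W₂ W₂ fun _ _ => 1)
    (h12 : Cov P G W₁ W₂ fun _ _ => 0) (hR : Rot P G W₁ W₂)
    {a b : ℕ → ℝ → Ω → ℝ} {a' b' : ℝ → Ω → ℝ}
    (haa : ∀ j r, StronglyMeasurable[G r] (a j r)) (hba : ∀ j r, StronglyMeasurable[G r] (b j r))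
    (hac : ∀ j ω, Continuous fun r => a j r ω) (hbc : ∀ j ω, Continuous fun r => b j r ω)
    (habs : ∀ j r ω, a j r ω ^ 2 + b j r ω ^ 2 = 1)
    (hA : ∀ r ω, Tendsto (fun k => a k r ω) atTop (nhds (a' r ω)))
    (hB : ∀ r ω, Tendsto (fun k => b k r ω) atTop (nhds (b' r ω))) :
    ∃ V : ℝ → Ω → ℝ, IsBrownianMotion P G V ∧ L2M P G V ∧ (∀ t ≤ 0, ∀ ω, V t ω = 0) ∧
      ∀ N c d, L2M P G N → Cov P G W₁ N c → Cov P G W₂ N d →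
      (∀ T, MemLp (fun p : ℝ × Ω => c p.1 p.2) 2 ((volume.prod P).restrict (Ioc 0 T ×ˢ univ))) →
      (∀ T, MemLp (fun p : ℝ × Ω => d p.1 p.2) 2 ((volume.prod P).restrict (Ioc 0 T ×ˢ univ))) →
      Cov P G V N (fun r ω => a' r ω * c r ω + b' r ω * d r ω) := by
  have ham : ∀ j r, Measurable (a j r) := fun j r => ((haa j r).mono (G.le r)).measurable
  have hbm : ∀ j r, Measurable (b j r) := fun j r => ((hba j r).mono (G.le r)).measurable
  have hab : ∀ j r ω, |a j r ω| ≤ 1 := fun j r ω => by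
    rw [abs_le_one_iff_mul_self_le_one]; nlinarith [habs j r ω, sq_nonneg (b j r ω)]
  have hbb : ∀ j r ω, |b j r ω| ≤ 1 := fun j r ω => by
    rw [abs_le_one_iff_mul_self_le_one]; nlinarith [habs j r ω, sq_nonneg (a j r ω)]
  have ham' : Measurable fun p : ℝ × Ω => a' p.1 p.2 :=
    measurable_of_tendsto_metrizable (fun k => joint_meas (hac k) (ham k))
      (tendsto_pi_nhds.2 fun p => hA p.1 p.2)
  have hbm' : Measurable fun p : ℝ × Ω => b' p.1 p.2 :=
    measurable_of_tendsto_metrizable (fun k => joint_meas (hbc k) (hbm k))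
      (tendsto_pi_nhds.2 fun p => hB p.1 p.2)
  have hab' : ∀ r ω, |a' r ω| ≤ 1 := fun r ω =>
    le_of_tendsto (hA r ω).abs (Eventually.of_forall fun k => hab k r ω)
  have hbb' : ∀ r ω, |b' r ω| ≤ 1 := fun r ω =>
    le_of_tendsto (hB r ω).abs (Eventually.of_forall fun k => hbb k r ω)
  choose j n hjn using fun k : ℕ => diag (P := P) (Nat.cast_nonneg (α := ℝ) k) ham hbm hac hbc hab hbb ham' hbm'
    hab' hbb' hA hB (ε := (1 / 16) ^ k) (by positivity)
  set A : ℕ → ℝ → Ω → ℝ := fun k => SA 0 k (n k) (a (j k)) with hAdef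
  set B : ℕ → ℝ → Ω → ℝ := fun k => SA 0 k (n k) (b (j k)) with hBdef
  set S : ℕ → ℝ → Ω → ℝ := fun k t ω => SI 0 k (n k) (a (j k)) W₁ t ω + SI 0 k (n k) (b (j k)) W₂ t ω with hSdef
  have hk : ∀ k : ℕ, (0 : ℝ) ≤ k := fun k => Nat.cast_nonneg k
  have hAm : ∀ k, Measurable fun p : ℝ × Ω => A k p.1 p.2 := fun k => SA_measurable _ (ham _)
  have hBm : ∀ k, Measurable fun p : ℝ × Ω => B k p.1 p.2 := fun k => SA_measurable _ (hbm _)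
  have hAb : ∀ k r ω, |A k r ω| ≤ 1 := fun k => SA_bdd (hk k) _ zero_le_one (hab _)
  have hBb : ∀ k r ω, |B k r ω| ≤ 1 := fun k => SA_bdd (hk k) _ zero_le_one (hbb _)
  have l1 : ∀ k : ℕ, L2M P G (SI 0 k (n k) (a (j k)) W₁) := fun k =>
    L2M.SI le_rfl (hk k) _ h1 (haa _) (hab _)
  have l2 : ∀ k : ℕ, L2M P G (SI 0 k (n k) (b (j k)) W₂) := fun k =>
    L2M.SI le_rfl (hk k) _ h2 (hba _) (hbb _)
  have hS : ∀ k, L2M P G (S k) := fun k => (l1 k).add (l2 k)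
  have hSc : ∀ k ω, Continuous fun t => S k t ω := fun k ω =>
    (SI_cont _ ω (c1 ω)).add (SI_cont _ ω (c2 ω))
  have hS0 : ∀ k, ∀ t ≤ 0, ∀ ω, S k t ω = 0 := fun k t ht ω => by
    simp only [hSdef]
    rw [SI_zero (hk k) _ ht, SI_zero (hk k) _ ht, add_zero]
  have hcov : ∀ k {N c d : ℝ → Ω → ℝ}, L2M P G N → Cov P G W₁ N c → Cov P G W₂ N d →
      Cov P G (S k) N (fun r ω => A k r ω * c r ω + B k r ω * d r ω) := by
    intro k N c d hN hc hd
    exact Cov.add (l1 k) (l2 k) hN (Cov.SI le_rfl (hk k) _ h1 hN hc (haa _) (hab _))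
      (Cov.SI le_rfl (hk k) _ h2 hN hd (hba _) (hbb _))
  have hstrip : ∀ {s t : ℝ}, s ≤ t → Ioc 0 s ×ˢ (univ : Set Ω) ⊆ Ioc 0 t ×ˢ univ := fun h =>
    prod_mono (Ioc_subset_Ioc_right h) subset_rfl
  have herr : ∀ k {t : ℝ}, t ≤ (k : ℕ) → _ := fun k t ht =>
    err_le (P := P) (hstrip ht) (strip_finite (k : ℝ)) (hAm k) ham' (hBm k) hbm' (hAb k) hab' (hBb k) hbb'
  have hD : ∀ k l : ℕ, k ≤ l → ∀ t : ℝ, t ≤ k → ∫ ω, (S l t ω - S k t ω) ^ 2 ∂P ≤ 16 * (1 / 16) ^ k := by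
    intro k l hkl t htk
    rcases le_total t 0 with ht | ht
    · simp [hS0 _ t ht]
    have hDL : L2M P G (fun t ω => S l t ω + - S k t ω) := (hS l).add (hS k).neg
    have hDW1 := Cov.add (hS l) (hS k).neg h1 (hcov l h1 h11 h12.symm) (hcov k h1 h11 h12.symm).neg
    have hDW2 := Cov.add (hS l) (hS k).neg h2 (hcov l h2 h12 h22) (hcov k h2 h12 h22).neg
    have hDD := Cov.add (hS l) (hS k).neg hDL (hcov l hDL hDW1.symm hDW2.symm)
      (hcov k hDL hDW1.symm hDW2.symm).neg
    have e1 := hDD.eq0 (fun ω => by simp [hS0 _ 0 le_rfl]) ht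
    have e2 : ∫ ω, (S l t ω - S k t ω) ^ 2 ∂P = ∫ ω, (S l t ω + - S k t ω) * (S l t ω + - S k t ω) ∂P := by
      refine integral_congr_ae (Eventually.of_forall fun ω => ?_)
      simp only
      ring
    rw [e2, e1]
    obtain ⟨-, -, ik, -, -, ek⟩ := herr k htk
    have htl : t ≤ l := htk.trans (by exact_mod_cast hkl)
    obtain ⟨-, -, il, -, -, el⟩ := herr l htl
    have hle : ∫ p in Ioc 0 t ×ˢ univ, ((A l p.1 p.2 * (A l p.1 p.2 * 1 + B l p.1 p.2 * 0 + -(A k p.1 p.2 * 1 + B k p.1 p.2 * 0))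
        + B l p.1 p.2 * (A l p.1 p.2 * 0 + B l p.1 p.2 * 1 + -(A k p.1 p.2 * 0 + B k p.1 p.2 * 1)))
        + -(A k p.1 p.2 * (A l p.1 p.2 * 1 + B l p.1 p.2 * 0 + -(A k p.1 p.2 * 1 + B k p.1 p.2 * 0))
        + B k p.1 p.2 * (A l p.1 p.2 * 0 + B l p.1 p.2 * 1 + -(A k p.1 p.2 * 0 + B k p.1 p.2 * 1)))) ∂(volume.prod P)
        ≤ ∫ p in Ioc 0 t ×ˢ univ, (2 * ((A k p.1 p.2 - a' p.1 p.2) ^ 2 + (B k p.1 p.2 - b' p.1 p.2) ^ 2)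
          + 2 * ((A l p.1 p.2 - a' p.1 p.2) ^ 2 + (B l p.1 p.2 - b' p.1 p.2) ^ 2)) ∂(volume.prod P) := by
      refine integral_mono (hDD.int t) ((ik.const_mul 2).add (il.const_mul 2)) fun p => ?_
      simp only
      nlinarith [sq_nonneg ((A k p.1 p.2 - a' p.1 p.2) + (A l p.1 p.2 - a' p.1 p.2)),
        sq_nonneg ((B k p.1 p.2 - b' p.1 p.2) + (B l p.1 p.2 - b' p.1 p.2))]
    refine hle.trans ?_
    rw [integral_add (ik.const_mul 2) (il.const_mul 2), integral_const_mul, integral_const_mul]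
    have f1 := ek.trans (hjn k)
    have f2 := (el.trans (hjn l)).trans (pow_le_pow_of_le_one (by norm_num) (by norm_num) hkl)
    simp only [err] at f1 f2
    have : (0 : ℝ) < (1 / 16) ^ k := by positivity
    linarith
  obtain ⟨V, hVL, hVc, hV0, hVlim, hVL2⟩ := exists_limit hnull hS hSc hS0 hD
  have hz : Tendsto (fun k : ℕ => (1 / 16 : ℝ) ^ k) atTop (nhds 0) :=
    tendsto_pow_atTop_nhds_zero_of_lt_one (by norm_num) (by norm_num)
  refine ⟨V, ?_, hVL, hV0, ?_⟩
  · refine bm_of_char hVL.adapted hVc (hV0 0 le_rfl) ?_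
    intro s t hs hst Z hZ hZb u
    refine char_limit (fun k r => ((hS k).memLp r).1) hVlim (hZ.mono (G.le s)).aestronglyMeasurable hZb u ?_
    obtain ⟨k0, hk0⟩ := exists_nat_ge t
    filter_upwards [eventually_ge_atTop k0] with k hkk
    exact SI_rot hR (hk k) (n k) h1 h2 (haa _) (hba _) (habs _) hs hst (hk0.trans (by exact_mod_cast hkk)) Z hZ hZb u
  · intro N c d hN hc hd hc2 hd2
    refine Cov.limit hS hVL hN hVL2 hAm ham' hBm hbm' hAb hab' hBb hbb' ?_ ?_ hc2 hd2 (fun k => hcov k hN hc hd)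
    · intro T
      obtain ⟨k0, hk0⟩ := exists_nat_ge T
      refine squeeze_zero' (Eventually.of_forall fun _ => integral_nonneg fun _ => sq_nonneg _) ?_ hz
      filter_upwards [eventually_ge_atTop k0] with k hkk
      exact (herr k (hk0.trans (by exact_mod_cast hkk))).2.2.2.1.trans (hjn k)
    · intro T
      obtain ⟨k0, hk0⟩ := exists_nat_ge T
      refine squeeze_zero' (Eventually.of_forall fun _ => integral_nonneg fun _ => sq_nonneg _) ?_ hz
      filter_upwards [eventually_ge_atTop k0] with k hkk
      exact (herr k (hk0.trans (by exact_mod_cast hkk))).2.2.2.2.1.trans (hjn k)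
end
end GB

namespace GB
open Set
set_option linter.unusedSectionVars false

/-- Regularized weights. -/
def ca (e u v : ℝ) : ℝ := Real.sqrt ((max u 0 + e) / (max u 0 + max v 0 + e))
def cb (e u v : ℝ) : ℝ := Real.sqrt (max v 0 / (max u 0 + max v 0 + e))
def la (u v : ℝ) : ℝ := if max u 0 + max v 0 = 0 then 1 else Real.sqrt (max u 0 / (max u 0 + max v 0))
def lb (u v : ℝ) : ℝ := if max u 0 + max v 0 = 0 then 0 else Real.sqrt (max v 0 / (max u 0 + max v 0))

lemma cab {e : ℝ} (he : 0 < e) (u v : ℝ) : ca e u v ^ 2 + cb e u v ^ 2 = 1 := by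
  have h1 : 0 ≤ max u 0 := le_max_right _ _
  have h2 : 0 ≤ max v 0 := le_max_right _ _
  unfold ca cb
  rw [Real.sq_sqrt (by positivity), Real.sq_sqrt (by positivity)]
  field_simp
  ring

lemma ca_cont {e : ℝ} (he : 0 < e) : Continuous fun p : ℝ × ℝ => ca e p.1 p.2 := by
  unfold ca
  refine Real.continuous_sqrt.comp (Continuous.div (by fun_prop) (by fun_prop) fun p => ?_)
  have h1 : 0 ≤ max p.1 0 := le_max_right _ _
  have h2 : 0 ≤ max p.2 0 := le_max_right _ _
  positivity

lemma cb_cont {e : ℝ} (he : 0 < e) : Continuous fun p : ℝ × ℝ => cb e p.1 p.2 := by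
  unfold cb
  refine Real.continuous_sqrt.comp (Continuous.div (by fun_prop) (by fun_prop) fun p => ?_)
  have h1 : 0 ≤ max p.1 0 := le_max_right _ _
  have h2 : 0 ≤ max p.2 0 := le_max_right _ _
  positivity

lemma ca_lim (u v : ℝ) : Tendsto (fun j : ℕ => ca (1 / ((j : ℝ) + 1)) u v) atTop (nhds (la u v)) := by
  have h1 : 0 ≤ max u 0 := le_max_right _ _
  have h2 : 0 ≤ max v 0 := le_max_right _ _
  have he := tendsto_one_div_add_atTop_nhds_zero_nat (𝕜 := ℝ)
  unfold la
  split_ifs with h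
  · have hu : max u 0 = 0 := by linarith
    have hv : max v 0 = 0 := by linarith
    refine tendsto_const_nhds.congr fun j => ?_
    have : (1 : ℝ) / ((j : ℝ) + 1) ≠ 0 := by positivity
    rw [ca, hu, hv]
    simp only [zero_add]
    rw [div_self this, Real.sqrt_one]
  · have := ((he.const_add (max u 0)).div (he.const_add (max u 0 + max v 0)) (by simpa using h)).sqrt
    simpa [ca] using this

lemma cb_lim (u v : ℝ) : Tendsto (fun j : ℕ => cb (1 / ((j : ℝ) + 1)) u v) atTop (nhds (lb u v)) := by
  have h1 : 0 ≤ max u 0 := le_max_right _ _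
  have h2 : 0 ≤ max v 0 := le_max_right _ _
  have he := tendsto_one_div_add_atTop_nhds_zero_nat (𝕜 := ℝ)
  unfold lb
  split_ifs with h
  · have hv : max v 0 = 0 := by linarith
    refine tendsto_const_nhds.congr fun j => ?_
    rw [cb, hv]
    simp
  · have := ((tendsto_const_nhds (x := max v 0)).div (he.const_add (max u 0 + max v 0)) (by simpa using h)).sqrt
    simpa [cb] using this

lemma lab_sigma {u v : ℝ} (hu : 0 ≤ u) (hv : 0 ≤ v) :
    la u v * besqSigma u + lb u v * besqSigma v = besqSigma (u + v) := by
  unfold la lb besqSigma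
  rw [max_eq_left hu, max_eq_left hv]
  split_ifs with h
  · have hu' : u = 0 := by linarith
    have hv' : v = 0 := by linarith
    simp [hu', hv']
  · have hp : 0 < u + v := lt_of_le_of_ne (by positivity) (Ne.symm h)
    have hs : 0 < Real.sqrt (u + v) := Real.sqrt_pos.2 hp
    rw [Real.sqrt_div hu, Real.sqrt_div hv]
    have e1 := Real.mul_self_sqrt hu
    have e2 := Real.mul_self_sqrt hv
    have e3 := Real.mul_self_sqrt hp.le
    field_simp
    nlinarith

lemma sigma_sq_add {u v : ℝ} (hu : 0 ≤ u) (hv : 0 ≤ v) :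
    besqSigma u ^ 2 + besqSigma v ^ 2 = besqSigma (u + v) ^ 2 := by
  rw [sigma_sq, sigma_sq, sigma_sq, max_eq_left hu, max_eq_left hv, max_eq_left (by positivity)]
  ring

section
variable {Ω₁ Ω₂ : Type*} [m₁ : MeasurableSpace Ω₁] [m₂ : MeasurableSpace Ω₂]
  {P₁ : Measure Ω₁} {P₂ : Measure Ω₂} [IsProbabilityMeasure P₁] [IsProbabilityMeasure P₂]
  {F₁ : Filtration ℝ m₁} {F₂ : Filtration ℝ m₂}

theorem sum_sol {W X M : ℝ → Ω₁ → ℝ} {W' Y M' : ℝ → Ω₂ → ℝ} {β δ δ' : ℝ → ℝ} {x x' : ℝ}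
    (hβ : MemD β) (hδ : MemD δ) (hδ' : MemD δ') (hx : 0 ≤ x) (hx' : 0 ≤ x')
    (h : Sol P₁ F₁ W X M β δ x) (h' : Sol P₂ F₂ W' Y M' β δ' x') :
    ∃ V, IsBrownianMotion (P₁.prod P₂) (PF P₁ P₂ F₁ F₂) V ∧
      IsGBESQ (P₁.prod P₂) (PF P₁ P₂ F₁ F₂) V β (fun u => δ u + δ' u) (x + x')
        (fun t p => X t p.1 + Y t p.2) := by
  set Q := P₁.prod P₂ with hQ
  set G := PF P₁ P₂ F₁ F₂ with hG
  have hML := h.ML2 hβ hδ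
  have hML' := h'.ML2 hβ hδ'
  have hWL := h.WL2
  have hWL' := h'.WL2
  -- lifted martingales
  have LM : L2M Q G (fun t p => M t p.1) := lift_L2M1 h.Mm hML.memLp
  have LM' : L2M Q G (fun t p => M' t p.2) := lift_L2M2 h'.Mm hML'.memLp
  have LW : L2M Q G (fun t p => W t p.1) := lift_L2M1 h.Wm hWL.memLp
  have LW' : L2M Q G (fun t p => W' t p.2) := lift_L2M2 h'.Wm hWL'.memLp
  -- integrability
  have i1 : ∀ T, IntegrableOn (fun p : ℝ × (Ω₁ × Ω₂) => besqSigma (X p.1 p.2.1) ^ 2) (Ioc 0 T ×ˢ univ)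
      (volume.prod Q) := fun T => lift_int1 (c := fun r ω => besqSigma (X r ω) ^ 2) (h.sq_int hβ hδ T)
  have i2 : ∀ T, IntegrableOn (fun p : ℝ × (Ω₁ × Ω₂) => besqSigma (Y p.1 p.2.2) ^ 2) (Ioc 0 T ×ˢ univ)
      (volume.prod Q) := fun T => lift_int2 (c := fun r ω => besqSigma (Y r ω) ^ 2) (h'.sq_int hβ hδ' T)
  have mX : Measurable fun p : ℝ × (Ω₁ × Ω₂) => besqSigma (X p.1 p.2.1) :=
    sigma_cont.measurable.comp (h.Xmeas.comp (measurable_fst.prodMk (measurable_fst.comp measurable_snd)))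
  have mY : Measurable fun p : ℝ × (Ω₁ × Ω₂) => besqSigma (Y p.1 p.2.2) :=
    sigma_cont.measurable.comp (h'.Xmeas.comp (measurable_fst.prodMk (measurable_snd.comp measurable_snd)))
  have j1 := fun T => int_of_sq (P := Q) (T := T) mX (i1 T)
  have j2 := fun T => int_of_sq (P := Q) (T := T) mY (i2 T)
  have one_int : ∀ T, IntegrableOn (fun p : ℝ × (Ω₁ × Ω₂) => (1 : ℝ)) (Ioc 0 T ×ˢ univ) (volume.prod Q) := by
    intro T
    have := strip_finite (P := Q) T
    exact integrable_const _
  -- covariations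
  have cMM : Cov Q G (fun t p => M t p.1) (fun t p => M t p.1) (fun r p => besqSigma (X r p.1) ^ 2) :=
    Cov.of_martingale LM LM i1 (lift_mart1 h.MM)
  have cMM' : Cov Q G (fun t p => M' t p.2) (fun t p => M' t p.2) (fun r p => besqSigma (Y r p.2) ^ 2) :=
    Cov.of_martingale LM' LM' i2 (lift_mart2 h'.MM)
  have cMW : Cov Q G (fun t p => M t p.1) (fun t p => W t p.1) (fun r p => besqSigma (X r p.1)) :=
    Cov.of_martingale LM LW j1 (lift_mart1 h.MW)
  have cMW' : Cov Q G (fun t p => M' t p.2) (fun t p => W' t p.2) (fun r p => besqSigma (Y r p.2)) :=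
    Cov.of_martingale LM' LW' j2 (lift_mart2 h'.MW)
  have cWW : Cov Q G (fun t p => W t p.1) (fun t p => W t p.1) (fun _ _ => 1) :=
    Cov.of_martingale LW LW one_int (lift_mart1 h.WW)
  have cWW' : Cov Q G (fun t p => W' t p.2) (fun t p => W' t p.2) (fun _ _ => 1) :=
    Cov.of_martingale LW' LW' one_int (lift_mart2 h'.WW)
  have c0 : Cov Q G (fun t p => M t p.1) (fun t p => M' t p.2) (fun _ _ => 0) :=
    lift_cov0 h.Mm hML.memLp h'.Mm hML'.memLp
  have c1 : Cov Q G (fun t p => M t p.1) (fun t p => W' t p.2) (fun _ _ => 0) :=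
    lift_cov0 h.Mm hML.memLp h'.Wm hWL'.memLp
  have c2 : Cov Q G (fun t p => W t p.1) (fun t p => M' t p.2) (fun _ _ => 0) :=
    lift_cov0 h.Wm hWL.memLp h'.Mm hML'.memLp
  have c3 : Cov Q G (fun t p => W t p.1) (fun t p => W' t p.2) (fun _ _ => 0) :=
    lift_cov0 h.Wm hWL.memLp h'.Wm hWL'.memLp
  -- the sum
  set N : ℝ → Ω₁ × Ω₂ → ℝ := fun t p => M t p.1 + M' t p.2 with hN
  have LN : L2M Q G N := LM.add LM'
  have cNW : Cov Q G (fun t p => W t p.1) N (fun r p => besqSigma (X r p.1) + 0) :=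
    (Cov.add LM LM' LW cMW c2.symm).symm
  have cNW' : Cov Q G (fun t p => W' t p.2) N (fun r p => 0 + besqSigma (Y r p.2)) :=
    (Cov.add LM LM' LW' c1 cMW').symm
  have cMN : Cov Q G (fun t p => M t p.1) N (fun r p => besqSigma (X r p.1) ^ 2 + 0) :=
    (Cov.add LM LM' LM cMM c0.symm).symm
  have cMN' : Cov Q G (fun t p => M' t p.2) N (fun r p => 0 + besqSigma (Y r p.2) ^ 2) :=
    (Cov.add LM LM' LM' c0 cMM').symm
  have cNN := Cov.add LM LM' LN cMN cMN'
  have pos : ∀ᵐ p ∂Q, ∀ t, 0 ≤ X t p.1 ∧ 0 ≤ Y t p.2 := by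
    have q1 := (Measure.quasiMeasurePreserving_fst (μ := P₁) (ν := P₂)).ae (h.pos hβ hδ hx)
    have q2 := (Measure.quasiMeasurePreserving_snd (μ := P₁) (ν := P₂)).ae (h'.pos hβ hδ' hx')
    filter_upwards [q1, q2] with p a b t using ⟨a t, b t⟩
  have Xa : ∀ t, StronglyMeasurable[G t] (fun p : Ω₁ × Ω₂ => X t p.1) := fun t => lift_fst (h.Xa t)
  have Ya : ∀ t, StronglyMeasurable[G t] (fun p : Ω₁ × Ω₂ => Y t p.2) := fun t => lift_snd (h'.Xa t)
  have ep : ∀ j : ℕ, (0 : ℝ) < 1 / ((j : ℝ) + 1) := fun j => by positivity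
  obtain ⟨V, hVB, hVL, hV0, hVcov⟩ := construct_bm (P := Q) (G := G) (fun t A hA h0 => PF_null hA h0) LW LW'
    (fun p => h.Wc p.1) (fun p => h'.Wc p.2) cWW cWW' c3
    (Rot_prod (fun t => ((h.Wm.1 t).mono (F₁.le t)).measurable) (fun t => ((h'.Wm.1 t).mono (F₂.le t)).measurable)
      h.gau h.ind h'.gau h'.ind)
    (a := fun j r p => ca (1 / ((j : ℝ) + 1)) (X r p.1) (Y r p.2))
    (b := fun j r p => cb (1 / ((j : ℝ) + 1)) (X r p.1) (Y r p.2))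
    (fun j r => (ca_cont (ep j)).comp_stronglyMeasurable ((Xa r).prodMk (Ya r)))
    (fun j r => (cb_cont (ep j)).comp_stronglyMeasurable ((Xa r).prodMk (Ya r)))
    (fun j p => (ca_cont (ep j)).comp ((h.Xc p.1).prodMk (h'.Xc p.2)))
    (fun j p => (cb_cont (ep j)).comp ((h.Xc p.1).prodMk (h'.Xc p.2)))
    (fun j r p => cab (ep j) _ _) (fun r p => ca_lim _ _) (fun r p => cb_lim _ _)
  have l1 : ∀ T, MemLp (fun p : ℝ × (Ω₁ × Ω₂) => besqSigma (X p.1 p.2.1) + 0) 2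
      ((volume.prod Q).restrict (Ioc 0 T ×ˢ univ)) := fun T => by
    simp only [add_zero]
    exact (memLp_two_iff_integrable_sq mX.aestronglyMeasurable).2 (i1 T)
  have l2 : ∀ T, MemLp (fun p : ℝ × (Ω₁ × Ω₂) => 0 + besqSigma (Y p.1 p.2.2)) 2
      ((volume.prod Q).restrict (Ioc 0 T ×ˢ univ)) := fun T => by
    simp only [zero_add]
    exact (memLp_two_iff_integrable_sq mY.aestronglyMeasurable).2 (i2 T)
  have cVN := hVcov N _ _ LN cNW cNW' l1 l2
  have cNV : Cov Q G N V (fun r p => besqSigma (X r p.1 + Y r p.2)) := by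
    refine cVN.symm.congr ?_
    filter_upwards [pos] with p hp r _
    rw [add_zero, zero_add]
    exact lab_sigma (hp r).1 (hp r).2
  have cNN' : Cov Q G N N (fun r p => besqSigma (X r p.1 + Y r p.2) ^ 2) := by
    refine cNN.congr ?_
    filter_upwards [pos] with p hp r _
    rw [add_zero, zero_add]
    exact sigma_sq_add (hp r).1 (hp r).2
  have N0 : ∀ t ≤ 0, N t =ᵐ[Q] 0 := by
    intro t ht
    refine Eventually.of_forall fun p => ?_
    simp [hN, h.Mdef, h'.Mdef, h.X0 t ht, h'.X0 t ht, Ioc_eq_empty (not_lt.2 ht)]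
  have Hc : ∀ p : Ω₁ × Ω₂, Continuous fun t => X t p.1 + Y t p.2 := fun p => (h.Xc p.1).add (h'.Xc p.2)
  have Ha : ∀ t, StronglyMeasurable[G t] (fun p : Ω₁ × Ω₂ => X t p.1 + Y t p.2) := fun t => (Xa t).add (Ya t)
  have a1 : ∀ t, StronglyMeasurable[G t] (fun p : Ω₁ × Ω₂ => ∫ r in Ioc 0 t, besqSigma (X r p.1 + Y r p.2)) := by
    intro t
    have := integral_adapted (G := G) (c := fun r p => besqSigma (X r p.1 + Y r p.2)) (fun p => sigma_cont.comp (Hc p))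
      (fun r => sigma_cont.comp_stronglyMeasurable (Ha r)) (β := fun _ => 1) measurable_const t
    simpa using this
  have a2 : ∀ t, StronglyMeasurable[G t] (fun p : Ω₁ × Ω₂ => ∫ r in Ioc 0 t, besqSigma (X r p.1 + Y r p.2) ^ 2) := by
    intro t
    have := integral_adapted (G := G) (c := fun r p => besqSigma (X r p.1 + Y r p.2) ^ 2)
      (fun p => (sigma_cont.comp (Hc p)).pow 2)
      (fun r => (sigma_cont.comp_stronglyMeasurable (Ha r)).pow 2) (β := fun _ => 1) measurable_const t
    simpa using this
  have eN : ∀ t (p : Ω₁ × Ω₂), X t p.1 + Y t p.2 - (x + x')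
      - ∫ s in Ioc 0 t, gbesqDrift β (fun u => δ u + δ' u) s (X s p.1 + Y s p.2) = N t p := by
    intro t p
    have e : ∫ s in Ioc 0 t, gbesqDrift β (fun u => δ u + δ' u) s (X s p.1 + Y s p.2)
        = (∫ s in Ioc 0 t, gbesqDrift β δ s (X s p.1)) + ∫ s in Ioc 0 t, gbesqDrift β δ' s (Y s p.2) := by
      rw [← integral_add ((drift_int hβ hδ (h.Xc p.1) t).mono_set Ioc_subset_Icc_self)
        ((drift_int hβ hδ' (h'.Xc p.2) t).mono_set Ioc_subset_Icc_self)]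
      refine integral_congr_ae (Eventually.of_forall fun s => ?_)
      simp only [gbesqDrift]
      ring
    rw [e]
    simp only [hN, h.Mdef, h'.Mdef]
    ring
  refine ⟨V, hVB, ?_, Hc, fun t => (Ha t).measurable, ?_, ?_, ?_⟩
  · intro p
    simp only [h.X0 0 le_rfl, h'.X0 0 le_rfl]
  · simp only [eN]
    exact LN.martingale N0
  · simp only [eN, pow_two]
    have := Cov.martingale LN LN cNN' N0 a2
    simpa only [pow_two] using this
  · simp only [eN]
    exact Cov.martingale LN hVL cNV N0 a1
end

lemma law_eq {Ω : Type*} [m : MeasurableSpace Ω] {P : Measure Ω} [IsProbabilityMeasure P]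
    {ℱ ℱ' : Filtration ℝ m} {W W' X Y : ℝ → Ω → ℝ} {β δ δ' : ℝ → ℝ} {x x' : ℝ}
    (hX : IsGBESQ P ℱ W β δ x X) (hY : IsGBESQ P ℱ' W' β δ' x' Y)
    (hindep : IndepFun (fun ω => ((fun u => X u ω, fun u => W u ω) : RPath × RPath))
      (fun ω => ((fun u => Y u ω, fun u => W' u ω) : RPath × RPath)) P) :
    pathLaw P (fun u ω => X u ω + Y u ω)
      = pathLaw (P.prod P) (fun t p => X (max t 0) p.1 + Y (max t 0) p.2) := by
  have mX : ∀ t, Measurable (X t) := fun t => (hX.adapted t).mono (ℱ.le t) le_rfl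
  have mY : ∀ t, Measurable (Y t) := fun t => (hY.adapted t).mono (ℱ'.le t) le_rfl
  have pX : Measurable fun ω => (fun t => X t ω : RPath) := measurable_pi_lambda _ mX
  have pY : Measurable fun ω => (fun t => Y t ω : RPath) := measurable_pi_lambda _ mY
  have pX' : Measurable fun ω => (fun t => X (max t 0) ω : RPath) := measurable_pi_lambda _ fun t => mX _
  have pY' : Measurable fun ω => (fun t => Y (max t 0) ω : RPath) := measurable_pi_lambda _ fun t => mY _
  have madd : Measurable fun p : RPath × RPath => p.1 + p.2 := by
    refine measurable_pi_lambda _ fun t => ?_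
    exact ((measurable_pi_apply t).comp measurable_fst).add ((measurable_pi_apply t).comp measurable_snd)
  have hi : IndepFun (fun ω => (fun t => X t ω : RPath)) (fun ω => (fun t => Y t ω : RPath)) P :=
    hindep.comp measurable_fst measurable_fst
  have e := (indepFun_iff_map_prod_eq_prod_map_map pX.aemeasurable pY.aemeasurable).1 hi
  have eX : P.map (fun ω => (fun t => X t ω : RPath)) = P.map (fun ω => (fun t => X (max t 0) ω : RPath)) := by
    refine Measure.map_congr ?_
    filter_upwards [path_eq hX] with ω hω using funext hω
  have eY : P.map (fun ω => (fun t => Y t ω : RPath)) = P.map (fun ω => (fun t => Y (max t 0) ω : RPath)) := by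
    refine Measure.map_congr ?_
    filter_upwards [path_eq hY] with ω hω using funext hω
  rw [eX, eY, Measure.map_prod_map _ _ pX' pY'] at e
  have e' := congrArg (fun μ => Measure.map (fun p : RPath × RPath => p.1 + p.2) μ) e
  rw [Measure.map_map madd (pX.prodMk pY), Measure.map_map madd (pX'.prodMap pY')] at e'
  exact e'

end GB

/-- Additivity of generalized squared Bessel processes: if `X ∼ {}^β Q^δ_x` and
`Y ∼ {}^β Q^{δ'}_{x'}` are independent (driven by independent Brownian motions),
then `X + Y ∼ {}^β Q^{δ+δ'}_{x+x'}`. -/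
theorem gbesq_additivity {Ω : Type} [m : MeasurableSpace Ω]
    (P : Measure Ω) [IsProbabilityMeasure P] (ℱ ℱ' : Filtration ℝ m)
    (W W' : ℝ → Ω → ℝ) (hW : IsBrownianMotion P ℱ W)
    (hW' : IsBrownianMotion P ℱ' W')
    (β δ δ' : ℝ → ℝ) (hβ : MemD β) (hβbd : ∃ C, ∀ u, β u ≤ C)
    (hδ : MemD δ) (hδ' : MemD δ') (x x' : ℝ) (hx : 0 ≤ x) (hx' : 0 ≤ x')
    (X Y : ℝ → Ω → ℝ) (hX : IsGBESQ P ℱ W β δ x X)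
    (hY : IsGBESQ P ℱ' W' β δ' x' Y)
    (hindep : IndepFun (fun ω => ((fun u => X u ω, fun u => W u ω) : RPath × RPath))
      (fun ω => ((fun u => Y u ω, fun u => W' u ω) : RPath × RPath)) P) :
    IsGBESQLaw β (fun u => δ u + δ' u) (x + x')
      (pathLaw P fun u ω => X u ω + Y u ω) := by
  obtain ⟨M, hM⟩ := GB.Sol.mk' hβ hδ hW hX
  obtain ⟨M', hM'⟩ := GB.Sol.mk' hβ hδ' hW' hY
  obtain ⟨V, hV, hsol⟩ := GB.sum_sol hβ hδ hδ' hx hx' hM hM'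
  exact ⟨{ Ω := Ω × Ω
           P := P.prod P
           ℱ := GB.PF P P ℱ ℱ'
           W := V
           X := fun t p => X (max t 0) p.1 + Y (max t 0) p.2
           prob := inferInstance
           bm := hV
           sol := hsol
           law := GB.law_eq hX hY hindep }⟩
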